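/- Let Γ ⊆ ℝ² be a compact convex set with nonempty interior, and for each n let X₁,…,X_{2n} be independent random points each uniformly distributed (normalized Lebesgue measure) on Γ. Then the probability of the event that the points are in general position and that for every set S of edges of {X₁,…,X_{2n}} with |S| ≤ n + n/(3·log(2n)) there exists a non-crossing perfect matching of {X₁,…,X_{2n}} avoiding S, tends to 1 as n → ∞. -/

import Mathlib

open MeasureTheory Set Filter

noncomputable section

abbrev Pt : Type := ℝ × ℝ

/-- A finite point set is in general position: no three distinct points are collinear. -/
def GenPos (X : Finset Pt) : Prop :=
  ∀ a ∈ X, ∀ b ∈ X, ∀ c ∈ X, a ≠ b → a ≠ c → b ≠ c → ¬ Collinear ℝ ({a, b, c} : Set Pt)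

/-- `e` is an edge of `X`: an unordered pair of distinct points of `X`. -/
def IsEdgeOf (X : Finset Pt) (e : Sym2 Pt) : Prop :=
  ¬ e.IsDiag ∧ ∀ p ∈ e, p ∈ X

/-- The closed segment joining the two points of an unordered pair. -/
def edgeSeg (e : Sym2 Pt) : Set Pt :=
  Sym2.lift ⟨fun u v => segment ℝ u v, fun u v => segment_symm ℝ u v⟩ e

/-- `M` is a non-crossing perfect matching of `X`: a partition of `X` into unordered pairs
whose closed segments are pairwise disjoint. -/
def IsNCMatching (X : Finset Pt) (M : Finset (Sym2 Pt)) : Prop :=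
  (∀ e ∈ M, IsEdgeOf X e) ∧
  (∀ p ∈ X, ∃! e, e ∈ M ∧ p ∈ e) ∧
  (M : Set (Sym2 Pt)).Pairwise fun e f => Disjoint (edgeSeg e) (edgeSeg f)

/-- The matching `M` avoids the edge set `S`. -/
def Avoids (M S : Finset (Sym2 Pt)) : Prop := ∀ e ∈ M, e ∉ S

/-- The uniform probability distribution on `Γ`: normalized Lebesgue measure restricted to `Γ`. -/
def unifOn (Γ : Set Pt) : Measure Pt := (volume Γ)⁻¹ • volume.restrict Γ

namespace PlaneMatching

/-- A multiple of `m` strictly between `0` and `2 * m` is `m`. -/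
theorem eq_of_dvd_of_lt_two_mul {m a : ℕ} (hd : m ∣ a) (h0 : 0 < a) (h2 : a < 2 * m) : a = m := by
  obtain ⟨k, rfl⟩ := hd
  have h1 : k < 2 := by
    by_contra h
    have : m * 2 ≤ m * k := Nat.mul_le_mul_left _ (by omega)
    omega
  have h3 : k ≠ 0 := by rintro rfl; simp at h0
  have : k = 1 := by omega
  simp [this]

theorem sum_eq_of_modEq {m k : ℕ} {s : ℕ → ℕ} (hpos : ∀ i < k, 1 ≤ s i)
    (htot : ∑ i ∈ Finset.range k, s i = 2 * m) {I J : Finset ℕ} (hIJ : I ⊆ J)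
    (hJ : J ⊆ Finset.range k) (hne : I ≠ J) (h : (∑ i ∈ J, s i) ≡ (∑ i ∈ I, s i) [MOD m])
    (hlt : ∃ i < k, i ∉ J \ I) : ∑ i ∈ J \ I, s i = m := by
  have hsum := Finset.sum_sdiff (f := s) hIJ
  have hdvd : m ∣ ∑ i ∈ J \ I, s i := by
    have h2 : (∑ i ∈ I, s i) ≡ (∑ i ∈ J, s i) [MOD m] := h.symm
    have := (Nat.modEq_iff_dvd' (by omega)).1 h2
    have h3 : ∑ i ∈ J, s i - ∑ i ∈ I, s i = ∑ i ∈ J \ I, s i := by omega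
    rwa [h3] at this
  refine eq_of_dvd_of_lt_two_mul hdvd ?_ ?_
  · obtain ⟨i, hi, hi'⟩ := Finset.exists_of_ssubset (Finset.ssubset_iff_subset_ne.2 ⟨hIJ, hne⟩)
    have hi2 : i ∈ J \ I := Finset.mem_sdiff.2 ⟨hi, hi'⟩
    have := Finset.single_le_sum (f := s) (fun _ _ => Nat.zero_le _) hi2
    have := hpos i (Finset.mem_range.1 (hJ hi))
    omega
  · obtain ⟨i, hi, hi'⟩ := hlt
    have hsub : J \ I ⊆ Finset.range k := Finset.sdiff_subset.trans hJ
    rw [← htot]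
    exact Finset.sum_lt_sum_of_subset hsub (Finset.mem_range.2 hi) hi'
      (hpos i hi) (fun _ _ _ => Nat.zero_le _)

theorem exists_sum_eq {m k : ℕ} (hm : 1 ≤ m) (hk : m < k) {s : ℕ → ℕ} (hpos : ∀ i < k, 1 ≤ s i)
    (htot : ∑ i ∈ Finset.range k, s i = 2 * m) :
    ∃ I ⊆ Finset.range k, ∑ i ∈ I, s i = m := by
  obtain ⟨x, hx, y, hy, hxy, heq⟩ := Finset.exists_ne_map_eq_of_card_lt_of_maps_to
    (s := Finset.range (m + 1)) (t := Finset.range m)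
    (f := fun i => (∑ j ∈ Finset.range i, s j) % m) (by simp)
    (by intro i _; simpa using Nat.mod_lt _ hm)
  wlog hlt : x < y generalizing x y
  · exact this y hy x hx hxy.symm heq.symm (by omega)
  simp only [Finset.mem_range] at hx hy
  refine ⟨Finset.range y \ Finset.range x, ?_, ?_⟩
  · intro i; simp; omega
  · refine sum_eq_of_modEq hpos htot (by simpa using hlt.le) (by simp; omega)
      (by intro h; have := congrArg Finset.card h; simp at this; omega) heq.symm
      ⟨m, hk, by simp; omega⟩

theorem modEq_succ_of_forall_sum_ne {m : ℕ} {s : ℕ → ℕ} (hpos : ∀ i < m, 1 ≤ s i)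
    (htot : ∑ i ∈ Finset.range m, s i = 2 * m)
    (hno : ∀ I ⊆ Finset.range m, ∑ i ∈ I, s i ≠ m) {j : ℕ} (hj : j + 1 < m) :
    s j ≡ s (j + 1) [MOD m] := by
  by_contra hcon
  let I : ℕ → Finset ℕ := fun i =>
    if i = m then insert (j + 1) (Finset.range j) else Finset.range i
  obtain ⟨x, hx, y, hy, hxy, heq⟩ := Finset.exists_ne_map_eq_of_card_lt_of_maps_to
    (s := Finset.range (m + 1)) (t := Finset.range m)
    (f := fun i => (∑ j ∈ I i, s j) % m) (by simp)
    (by intro i _; simpa using Nat.mod_lt _ (by omega))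
  wlog hlt : x < y generalizing x y
  · exact this y hy x hx hxy.symm heq.symm (by omega)
  simp only [Finset.mem_range] at hx hy
  have hxm : x ≠ m := by omega
  by_cases hym : y = m
  · simp only [I, hym, hxm, if_true, if_false] at heq
    rcases lt_trichotomy x (j + 1) with h | h | h
    · refine hno (insert (j + 1) (Finset.range j) \ Finset.range x) ?_
        (sum_eq_of_modEq hpos htot ?_ ?_ ?_ heq.symm ⟨j, by omega, by simp⟩)
      · intro i; simp; omega
      · intro i; simp; omega
      · intro i; simp; omega
      · intro h'
        have : j + 1 ∈ Finset.range x := h' ▸ Finset.mem_insert_self _ _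
        simp at this; omega
    · subst h
      apply hcon
      have heq' : (∑ i ∈ Finset.range (j + 1), s i) ≡
        (∑ i ∈ insert (j + 1) (Finset.range j), s i) [MOD m] := heq
      rw [Finset.sum_range_succ, Finset.sum_insert (by simp), add_comm] at heq'
      exact Nat.ModEq.add_right_cancel' _ heq'
    · refine hno (Finset.range x \ insert (j + 1) (Finset.range j)) ?_
        (sum_eq_of_modEq hpos htot ?_ ?_ ?_ heq ⟨j + 1, by omega, by simp⟩)
      · intro i; simp; omega
      · intro i; simp; omega
      · intro i; simp; omega
      · intro h'
        have : j ∈ insert (j + 1) (Finset.range j) := by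
          rw [h']; simp; omega
        simp at this
  · simp only [I, hym, hxm, if_false] at heq
    refine hno (Finset.range y \ Finset.range x) ?_ (sum_eq_of_modEq hpos htot
      (by simpa using hlt.le) (by simp; omega)
      (by intro h; have := congrArg Finset.card h; simp at this; omega) heq.symm ?_)
    · intro i; simp; omega
    · exact if h : x = 0 then ⟨y, by omega, by simp⟩ else ⟨0, by omega, by simp; omega⟩

theorem eq_two_or_eq_succ {m : ℕ} {s : ℕ → ℕ} (hpos : ∀ i < m, 1 ≤ s i)
    (htot : ∑ i ∈ Finset.range m, s i = 2 * m)
    (hno : ∀ I ⊆ Finset.range m, ∑ i ∈ I, s i ≠ m) :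
    (∀ i < m, s i = 2) ∨ ∃ i < m, s i = m + 1 := by
  by_cases hex : ∃ i < m, s i = m + 1
  · exact Or.inr hex
  push Not at hex
  left
  have hle : ∀ i < m, s i ≤ m := by
    intro i hi
    have h1 : ∑ j ∈ (Finset.range m).erase i, 1 ≤ ∑ j ∈ (Finset.range m).erase i, s j :=
      Finset.sum_le_sum (fun j hj => hpos j (by simpa using (Finset.mem_erase.1 hj).2))
    have h2 := Finset.add_sum_erase (Finset.range m) s (Finset.mem_range.2 hi)
    rw [Finset.sum_const, Finset.card_erase_of_mem (Finset.mem_range.2 hi), Finset.card_range] at h1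
    have := hex i hi
    simp at h1
    omega
  have hlt : ∀ i < m, s i < m := by
    intro i hi
    refine lt_of_le_of_ne (hle i hi) fun h => hno {i} (by simpa using hi) (by simpa using h)
  have hconst : ∀ i < m, s i = s 0 := by
    intro i
    induction i with
    | zero => intro _; rfl
    | succ i ih =>
      intro hi
      rw [← ih (by omega)]
      have h := modEq_succ_of_forall_sum_ne hpos htot hno hi
      exact (Nat.ModEq.eq_of_lt_of_lt h (hlt i (by omega)) (hlt _ hi)).symm
  intro i hi
  rw [Finset.sum_congr rfl (fun i hi => hconst i (Finset.mem_range.1 hi)), Finset.sum_const,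
    Finset.card_range, smul_eq_mul, mul_comm 2 m] at htot
  rw [hconst i hi]
  exact Nat.eq_of_mul_eq_mul_left (by omega) htot

section Labels
variable {V L : Type*} [DecidableEq V] [DecidableEq L]

/-- The pairs of `S` with both ends in `Y`. -/
def inner (S : Finset (Sym2 V)) (Y : Finset V) : Finset (Sym2 V) := S ∩ Y.sym2

theorem mem_inner {S : Finset (Sym2 V)} {Y : Finset V} {a b : V} :
    s(a, b) ∈ inner S Y ↔ s(a, b) ∈ S ∧ a ∈ Y ∧ b ∈ Y := by
  simp [inner]

theorem inner_mono {S : Finset (Sym2 V)} {Y Z : Finset V} (h : Y ⊆ Z) : inner S Y ⊆ inner S Z :=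
  Finset.inter_subset_inter_left (Finset.sym2_mono h)

/-- `T` is constant on the pairs of `T`. -/
theorem exists_label (T : Finset (Sym2 V)) (Y : Finset V) :
    ∃ φ : V → V, (∀ a b, s(a, b) ∈ T → φ a = φ b) ∧ Y.card ≤ (Y.image φ).card + T.card := by
  induction T using Finset.induction_on with
  | empty => exact ⟨id, by simp, by simp⟩
  | insert e T he ih =>
    obtain ⟨φ, h1, h2⟩ := ih
    induction e using Sym2.ind with
    | _ u v =>
    refine ⟨fun x => if φ x = φ v then φ u else φ x, ?_, ?_⟩
    · intro a b hab
      rcases Finset.mem_insert.1 hab with h | h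
      · rcases Sym2.eq_iff.1 h with ⟨rfl, rfl⟩ | ⟨rfl, rfl⟩ <;> simp
      · simp [h1 a b h]
    · rw [Finset.card_insert_of_notMem he]
      have : (Y.image φ).erase (φ v) ⊆ Y.image (fun x => if φ x = φ v then φ u else φ x) := by
        intro z hz
        obtain ⟨hz1, hz2⟩ := Finset.mem_erase.1 hz
        obtain ⟨x, hx, rfl⟩ := Finset.mem_image.1 hz2
        exact Finset.mem_image.2 ⟨x, hx, by simp [hz1]⟩
      have h3 := Finset.card_le_card this
      have h4 := Finset.pred_card_le_card_erase (s := Y.image φ) (a := φ v)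
      omega

/-- Enumerating the classes of a labelling. -/
theorem exists_enum (Y : Finset V) (φ : V → L) :
    ∃ e : ℕ → Finset V, (∀ i < (Y.image φ).card, (e i).Nonempty ∧ ∃ l, e i = {x ∈ Y | φ x = l}) ∧
      (∀ x ∈ Y, ∃ i < (Y.image φ).card, x ∈ e i) ∧
      ∀ i < (Y.image φ).card, ∀ j < (Y.image φ).card, i ≠ j → Disjoint (e i) (e j) := by
  let E := (Y.image φ).equivFin
  refine ⟨fun i => if h : i < (Y.image φ).card then {x ∈ Y | φ x = (E.symm ⟨i, h⟩ : L)} else ∅,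
    ?_, ?_, ?_⟩
  · intro i hi
    simp only [hi, dif_pos]
    refine ⟨?_, _, rfl⟩
    obtain ⟨x, hx, h⟩ := Finset.mem_image.1 (E.symm ⟨i, hi⟩).2
    exact ⟨x, by simp [hx, h]⟩
  · intro x hx
    refine ⟨E ⟨φ x, Finset.mem_image_of_mem _ hx⟩, Fin.is_lt _, ?_⟩
    simp [hx]
  · intro i hi j hj hij
    simp only [hi, hj, dif_pos]
    rw [Finset.disjoint_left]
    intro x hx hx'
    simp only [Finset.mem_filter] at hx hx'
    have := hx.2.symm.trans hx'.2
    have := E.symm.injective (Subtype.ext this)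
    simp at this
    exact hij this

theorem exists_enum_sum {Y : Finset V} {φ : V → L} {e : ℕ → Finset V} {k : ℕ}
    (h1 : ∀ i < k, (e i).Nonempty ∧ ∃ l, e i = {x ∈ Y | φ x = l})
    (h2 : ∀ x ∈ Y, ∃ i < k, x ∈ e i)
    (h3 : ∀ i < k, ∀ j < k, i ≠ j → Disjoint (e i) (e j)) :
    ∑ i ∈ Finset.range k, (e i).card = Y.card ∧ ∀ I ⊆ Finset.range k,
      ∃ U ⊆ Y, U.card = ∑ i ∈ I, (e i).card ∧ ∀ x ∈ U, ∀ y ∈ Y, φ x = φ y → y ∈ U := by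
  have key : ∀ I ⊆ Finset.range k, (I.biUnion e).card = ∑ i ∈ I, (e i).card := by
    intro I hI
    refine Finset.card_biUnion fun i hi j hj hij => ?_
    exact h3 i (Finset.mem_range.1 (hI hi)) j (Finset.mem_range.1 (hI hj)) hij
  constructor
  · rw [← key _ subset_rfl]
    congr 1
    ext x
    simp only [Finset.mem_biUnion, Finset.mem_range]
    constructor
    · rintro ⟨i, hi, hx⟩
      obtain ⟨-, l, hl⟩ := h1 i hi
      rw [hl] at hx
      exact (Finset.mem_filter.1 hx).1
    · exact h2 x
  · intro I hI
    refine ⟨I.biUnion e, ?_, key I hI, ?_⟩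
    · intro x hx
      obtain ⟨i, hi, hx⟩ := Finset.mem_biUnion.1 hx
      obtain ⟨-, l, hl⟩ := h1 i (Finset.mem_range.1 (hI hi))
      rw [hl] at hx
      exact (Finset.mem_filter.1 hx).1
    · intro x hx y hy hxy
      obtain ⟨i, hi, hx⟩ := Finset.mem_biUnion.1 hx
      refine Finset.mem_biUnion.2 ⟨i, hi, ?_⟩
      obtain ⟨-, l, hl⟩ := h1 i (Finset.mem_range.1 (hI hi))
      rw [hl] at hx ⊢
      exact Finset.mem_filter.2 ⟨hy, hxy ▸ (Finset.mem_filter.1 hx).2⟩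

/-- With more than `m` labels on `2 * m` points, some union of classes has `m` points. -/
theorem exists_saturated {Y : Finset V} {m : ℕ} (hm : 1 ≤ m) (hY : Y.card = 2 * m) (φ : V → L)
    (hφ : m < (Y.image φ).card) :
    ∃ U ⊆ Y, U.card = m ∧ ∀ x ∈ U, ∀ y ∈ Y, φ x = φ y → y ∈ U := by
  obtain ⟨e, h1, h2, h3⟩ := exists_enum Y φ
  obtain ⟨h4, h5⟩ := exists_enum_sum h1 h2 h3
  obtain ⟨I, hI, hs⟩ := exists_sum_eq hm hφ (s := fun i => (e i).card)
    (fun i hi => Finset.card_pos.2 (h1 i hi).1) (h4.trans hY)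
  obtain ⟨U, hU, hc, h⟩ := h5 I hI
  exact ⟨U, hU, hc.trans hs, h⟩

theorem saturated_dichotomy {Y : Finset V} {m : ℕ} (hY : Y.card = 2 * m)
    (φ : V → L) (hφ : (Y.image φ).card = m)
    (hno : ∀ U ⊆ Y, (∀ x ∈ U, ∀ y ∈ Y, φ x = φ y → y ∈ U) → U.card ≠ m) :
    (∀ x ∈ Y, {y ∈ Y | φ y = φ x}.card = 2) ∨ ∃ x ∈ Y, {y ∈ Y | φ y = φ x}.card = m + 1 := by
  obtain ⟨e, h1, h2, h3⟩ := exists_enum Y φ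
  rw [hφ] at h1 h2 h3
  obtain ⟨h4, h5⟩ := exists_enum_sum h1 h2 h3
  have hcl : ∀ i < m, ∀ x ∈ e i, e i = {y ∈ Y | φ y = φ x} ∧ x ∈ Y := by
    intro i hi x hx
    obtain ⟨-, l, hl⟩ := h1 i hi
    rw [hl] at hx ⊢
    obtain ⟨ha, hb⟩ := Finset.mem_filter.1 hx
    rw [hb]; exact ⟨rfl, ha⟩
  rcases eq_two_or_eq_succ (s := fun i => (e i).card)
    (fun i hi => Finset.card_pos.2 (h1 i hi).1) (h4.trans hY)
    (fun I hI hs => by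
      obtain ⟨U, hU, hc, h⟩ := h5 I hI
      exact hno U hU h (hc.trans hs)) with h | ⟨i, hi, h⟩
  · left
    intro x hx
    obtain ⟨i, hi, hxi⟩ := h2 x hx
    rw [← (hcl i hi x hxi).1]; exact h i hi
  · right
    obtain ⟨x, hx⟩ := (h1 i hi).1
    exact ⟨x, (hcl i hi x hx).2, by rw [← (hcl i hi x hx).1]; exact h⟩

end Labels

section PartialSums
variable {V : Type*} [DecidableEq V]

theorem exists_balanced_before {Z : Finset V} {κ : V → ℝ} {w : V → ℤ}
    (hκ : Set.InjOn κ Z) (hw : ∀ p ∈ Z, w p = 1 ∨ w p = -1) {F : ℤ} (hF : 0 ≤ F)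
    (hlt : F + ∑ p ∈ Z, w p < 0) :
    ∃ p ∈ Z, w p = -1 ∧ F + ∑ q ∈ Z with κ q < κ p, w q = 0 := by
  induction Z using Finset.induction_on_max_value κ with
  | empty => simp at hlt; omega
  | insert a s ha hmax ih =>
    rw [Finset.sum_insert ha] at hlt
    by_cases hs : F + ∑ p ∈ s, w p < 0
    · obtain ⟨p, hp, hp1, hp2⟩ := ih (hκ.mono (by simp))
        (fun p hp => hw p (Finset.mem_insert_of_mem hp)) hs
      refine ⟨p, Finset.mem_insert_of_mem hp, hp1, ?_⟩
      rw [Finset.filter_insert, if_neg (not_lt.2 (hmax p hp))]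
      exact hp2
    · have := hw a (Finset.mem_insert_self _ _)
      refine ⟨a, Finset.mem_insert_self _ _, by omega, ?_⟩
      rw [Finset.filter_insert, if_neg (lt_irrefl _), Finset.filter_true_of_mem]
      · omega
      · intro q hq
        refine lt_of_le_of_ne (hmax q hq) fun h => ?_
        have := hκ (by simp [hq]) (by simp) h
        exact ha (this ▸ hq)

theorem exists_balanced_lower {Z : Finset V} {κ : V → ℝ} {w : V → ℤ}
    (hκ : Set.InjOn κ Z) (hw : ∀ p ∈ Z, w p = 1 ∨ w p = -1) {F : ℤ} (hF : 0 ≤ F)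
    (hle : F + ∑ p ∈ Z, w p ≤ 0) :
    ∃ Z' ⊆ Z, (∀ p ∈ Z', ∀ q ∈ Z \ Z', κ p < κ q) ∧ F + ∑ q ∈ Z', w q = 0 := by
  induction Z using Finset.induction_on_max_value κ with
  | empty => exact ⟨∅, by simp, by simp, by simp at hle ⊢; omega⟩
  | insert a s ha hmax ih =>
    rw [Finset.sum_insert ha] at hle
    by_cases hs : F + ∑ p ∈ s, w p ≤ 0
    · obtain ⟨Z', hZ, h1, h2⟩ := ih (hκ.mono (by simp))
        (fun p hp => hw p (Finset.mem_insert_of_mem hp)) hs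
      refine ⟨Z', hZ.trans (Finset.subset_insert _ _), ?_, h2⟩
      intro p hp q hq
      obtain ⟨hq1, hq2⟩ := Finset.mem_sdiff.1 hq
      rcases Finset.mem_insert.1 hq1 with rfl | hq1
      · refine lt_of_le_of_ne (hmax p (hZ hp)) fun h => ?_
        have := hκ (by simp [hZ hp]) (by simp) h
        exact ha (this ▸ hZ hp)
      · exact h1 p hp q (Finset.mem_sdiff.2 ⟨hq1, hq2⟩)
    · have := hw a (Finset.mem_insert_self _ _)
      exact ⟨insert a s, subset_rfl, by simp, by rw [Finset.sum_insert ha]; omega⟩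

/-- The threshold form of the discrete intermediate value theorem. -/
theorem exists_threshold {Z : Finset V} {κ : V → ℝ} {w : V → ℤ}
    (hκ : Set.InjOn κ Z) (hw : ∀ p ∈ Z, w p = 1 ∨ w p = -1) {F : ℤ}
    (h : 0 ≤ F ∧ F + ∑ p ∈ Z, w p ≤ 0 ∨ F ≤ 0 ∧ 0 ≤ F + ∑ p ∈ Z, w p) :
    ∃ c : ℝ, (∀ p ∈ Z, κ p ≠ c) ∧ F + ∑ q ∈ Z with κ q < c, w q = 0 := by
  have key : ∃ Z' ⊆ Z, (∀ p ∈ Z', ∀ q ∈ Z \ Z', κ p < κ q) ∧ F + ∑ q ∈ Z', w q = 0 := by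
    rcases h with ⟨h1, h2⟩ | ⟨h1, h2⟩
    · exact exists_balanced_lower hκ hw h1 h2
    · obtain ⟨Z', h3, h4, h5⟩ := exists_balanced_lower (w := fun p => -w p) (F := -F) hκ
        (fun p hp => by have := hw p hp; omega) (by omega)
        (by rw [Finset.sum_neg_distrib]; omega)
      rw [Finset.sum_neg_distrib] at h5
      exact ⟨Z', h3, h4, by omega⟩
  obtain ⟨Z', h1, h2, h3⟩ := key
  obtain ⟨c, hc1, hc2⟩ := Order.exists_between_finsets (lo := Z'.image κ) (hi := (Z \ Z').image κ)
    (by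
      intro x hx y hy
      obtain ⟨p, hp, rfl⟩ := Finset.mem_image.1 hx
      obtain ⟨q, hq, rfl⟩ := Finset.mem_image.1 hy
      exact h2 p hp q hq)
  have hc1' : ∀ p ∈ Z', κ p < c := fun p hp => hc1 _ (Finset.mem_image_of_mem _ hp)
  have hc2' : ∀ p ∈ Z \ Z', c < κ p := fun p hp => hc2 _ (Finset.mem_image_of_mem _ hp)
  refine ⟨c, ?_, ?_⟩
  · intro p hp
    by_cases hp' : p ∈ Z'
    · exact (hc1' p hp').ne
    · exact (hc2' p (Finset.mem_sdiff.2 ⟨hp, hp'⟩)).ne'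
  · rw [← h3]
    congr 2
    ext p
    simp only [Finset.mem_filter]
    constructor
    · rintro ⟨hp, hpc⟩
      by_contra hp'
      exact absurd hpc (not_lt.2 (hc2' p (Finset.mem_sdiff.2 ⟨hp, hp'⟩)).le)
    · exact fun hp => ⟨h1 hp, hc1' p hp⟩

end PartialSums

end PlaneMatching

namespace PlaneMatching

/-! ### Orientation, separation and general position -/

/-- Twice the signed area of the triangle `a b p`. -/
def orient (a b p : Pt) : ℝ := (b.1 - a.1) * (p.2 - a.2) - (b.2 - a.2) * (p.1 - a.1)

/-- The algebraic form of general position. -/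
def GP (Y : Finset Pt) : Prop :=
  ∀ a ∈ Y, ∀ b ∈ Y, ∀ c ∈ Y, a ≠ b → a ≠ c → b ≠ c → orient a b c ≠ 0

theorem orient_swap (a b p : Pt) : orient b a p = -orient a b p := by
  simp only [orient]; ring

theorem orient_rotate (a b p : Pt) : orient b p a = orient a b p := by
  simp only [orient]; ring

theorem orient_swap_right (a b p : Pt) : orient a p b = -orient a b p := by
  simp only [orient]; ring

@[simp] theorem orient_left (a b : Pt) : orient a b a = 0 := by simp [orient]

@[simp] theorem orient_right (a b : Pt) : orient a b b = 0 := by simp only [orient]; ring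

theorem GP.mono {Y Z : Finset Pt} (h : GP Y) (hZ : Z ⊆ Y) : GP Z :=
  fun a ha b hb c hc => h a (hZ ha) b (hZ hb) c (hZ hc)

/-- Affine functions of the plane. -/
def IsAff (g : Pt → ℝ) : Prop := ∃ α β γ : ℝ, ∀ p, g p = α * p.1 + β * p.2 + γ

theorem isAff_orient (a b : Pt) : IsAff (orient a b) :=
  ⟨-(b.2 - a.2), b.1 - a.1, (b.2 - a.2) * a.1 - (b.1 - a.1) * a.2,
    fun p => by simp only [orient]; ring⟩

theorem isAff_linear (α β : ℝ) (u : Pt) : IsAff fun p => α * (p.1 - u.1) + β * (p.2 - u.2) :=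
  ⟨α, β, -α * u.1 - β * u.2, fun p => by ring⟩

theorem isAff_const (c : ℝ) : IsAff fun _ => c := ⟨0, 0, c, fun p => by ring⟩

theorem IsAff.add {f g : Pt → ℝ} (hf : IsAff f) (hg : IsAff g) : IsAff fun p => f p + g p := by
  obtain ⟨a, b, c, h⟩ := hf
  obtain ⟨a', b', c', h'⟩ := hg
  exact ⟨a + a', b + b', c + c', fun p => by simp only [h, h']; ring⟩

theorem IsAff.smul {f : Pt → ℝ} (hf : IsAff f) (t : ℝ) : IsAff fun p => t * f p := by
  obtain ⟨a, b, c, h⟩ := hf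
  exact ⟨t * a, t * b, t * c, fun p => by simp only [h]; ring⟩

theorem IsAff.neg {f : Pt → ℝ} (hf : IsAff f) : IsAff fun p => -f p := by
  simpa using hf.smul (-1)

/-- Strict separation of two finite sets by a line. -/
def Sep (A B : Finset Pt) : Prop := ∃ g, IsAff g ∧ (∀ p ∈ A, 0 < g p) ∧ ∀ p ∈ B, g p < 0

theorem Sep.symm {A B : Finset Pt} (h : Sep A B) : Sep B A := by
  obtain ⟨g, h1, h2, h3⟩ := h
  exact ⟨_, h1.neg, fun p hp => by simpa using h3 p hp, fun p hp => by simpa using h2 p hp⟩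

theorem Sep.mono {A B A' B' : Finset Pt} (h : Sep A B) (hA : A' ⊆ A) (hB : B' ⊆ B) :
    Sep A' B' := by
  obtain ⟨g, h1, h2, h3⟩ := h
  exact ⟨g, h1, fun p hp => h2 p (hA hp), fun p hp => h3 p (hB hp)⟩

theorem Sep.disjoint {A B : Finset Pt} (h : Sep A B) : Disjoint A B := by
  obtain ⟨g, h1, h2, h3⟩ := h
  exact Finset.disjoint_left.2 fun p hA hB => absurd (h2 p hA) (not_lt.2 (h3 p hB).le)

theorem exists_pos_perturb (f g : Pt → ℝ) (A : Finset Pt)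
    (h : ∀ p ∈ A, 0 < f p ∨ f p = 0 ∧ 0 < g p) :
    ∀ᶠ ε in nhdsWithin (0 : ℝ) (Ioi 0), ∀ p ∈ A, 0 < f p + ε * g p := by
  rw [Finset.eventually_all]
  intro p hp
  rcases h p hp with h | ⟨h0, h⟩
  · have : Tendsto (fun ε : ℝ => f p + ε * g p) (nhdsWithin (0 : ℝ) (Ioi 0)) (nhds (f p)) := by
      have h1 : Continuous fun ε : ℝ => f p + ε * g p := by fun_prop
      have h2 := (h1.tendsto 0).mono_left (nhdsWithin_le_nhds (s := Ioi (0 : ℝ)))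
      simpa using h2
    exact this.eventually (lt_mem_nhds h)
  · filter_upwards [self_mem_nhdsWithin] with ε hε
    rw [h0, zero_add]
    exact mul_pos hε h

theorem sep_lex {f g : Pt → ℝ} (hf : IsAff f) (hg : IsAff g) {A B : Finset Pt}
    (hA : ∀ p ∈ A, 0 < f p ∨ f p = 0 ∧ 0 < g p) (hB : ∀ p ∈ B, f p < 0 ∨ f p = 0 ∧ g p < 0) :
    Sep A B := by
  have h1 := exists_pos_perturb f g A hA
  have h2 := exists_pos_perturb (fun p => -f p) (fun p => -g p) B
    (fun p hp => by simpa using hB p hp)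
  obtain ⟨ε, h1, h2⟩ := (h1.and h2).exists
  exact ⟨_, hf.add (hg.smul ε), h1, fun p hp => by have := h2 p hp; linarith⟩

theorem sep_side {u w : Pt} {A B : Finset Pt} (hA : ∀ p ∈ A, 0 < orient u w p)
    (hB : ∀ p ∈ B, orient u w p < 0 ∨ p = u ∨ p = w) : Sep A B := by
  refine sep_lex (isAff_orient u w) (isAff_const (-1)) (fun p hp => Or.inl (hA p hp)) fun p hp => ?_
  rcases hB p hp with h | rfl | rfl
  · exact Or.inl h
  · simp
  · simp

theorem dist_sq_pos {u w : Pt} (h : u ≠ w) : 0 < (w.1 - u.1) ^ 2 + (w.2 - u.2) ^ 2 := by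
  by_contra hc
  apply h
  have h1 := sq_nonneg (w.1 - u.1)
  have h2 := sq_nonneg (w.2 - u.2)
  have h3 : w.1 - u.1 = 0 := by nlinarith
  have h4 : w.2 - u.2 = 0 := by nlinarith
  exact Prod.ext (by linarith) (by linarith)

/-! ### Unblocked sets -/

/-- `Y` has a non-crossing perfect matching avoiding `S`. -/
def Unbl (S : Finset (Sym2 Pt)) (Y : Finset Pt) : Prop := ∃ M, IsNCMatching Y M ∧ Avoids M S

theorem unbl_empty (S : Finset (Sym2 Pt)) : Unbl S ∅ :=
  ⟨∅, ⟨by simp, by simp, by simp⟩, by simp [Avoids]⟩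

theorem unbl_pair {S : Finset (Sym2 Pt)} {x y : Pt} (hxy : x ≠ y) (h : s(x, y) ∉ S) :
    Unbl S {x, y} := by
  refine ⟨{s(x, y)}, ⟨?_, ?_, by simp⟩, by simpa [Avoids] using h⟩
  · simp [IsEdgeOf, hxy]
  · intro p hp
    refine ⟨s(x, y), by simpa using hp, by simp⟩

theorem edgeSeg_pos {g : Pt → ℝ} (hg : IsAff g) {e : Sym2 Pt} (h : ∀ p ∈ e, 0 < g p) :
    ∀ p ∈ edgeSeg e, 0 < g p := by
  induction e using Sym2.ind with
  | _ u v =>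
  intro p hp
  obtain ⟨α, β, γ, hg⟩ := hg
  have hu := h u (by simp)
  have hv := h v (by simp)
  obtain ⟨s, t, hs, ht, hst, rfl⟩ : p ∈ segment ℝ u v := hp
  rw [hg] at hu hv ⊢
  have e1 : α * (s • u + t • v).1 + β * (s • u + t • v).2 + γ =
      s * (α * u.1 + β * u.2 + γ) + t * (α * v.1 + β * v.2 + γ) := by
    simp only [Prod.fst_add, Prod.smul_fst, Prod.snd_add, Prod.smul_snd, smul_eq_mul]
    linear_combination -γ * hst
  rw [e1]
  rcases hs.eq_or_lt with rfl | hs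
  · have : t = 1 := by linarith
    subst this; simpa using hv
  · have := mul_pos hs hu
    have := mul_nonneg ht hv.le
    linarith

theorem Sep.edgeSeg_disjoint {A B : Finset Pt} (h : Sep A B) {e f : Sym2 Pt}
    (he : ∀ p ∈ e, p ∈ A) (hf : ∀ p ∈ f, p ∈ B) : Disjoint (edgeSeg e) (edgeSeg f) := by
  obtain ⟨g, h1, h2, h3⟩ := h
  refine Set.disjoint_left.2 fun p hpe hpf => ?_
  have h4 := edgeSeg_pos h1 (fun p hp => h2 p (he p hp)) p hpe
  have h5 := edgeSeg_pos h1.neg (fun p hp => by simpa using h3 p (hf p hp)) p hpf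
  linarith

theorem Unbl.union {S : Finset (Sym2 Pt)} {A B : Finset Pt} (hA : Unbl S A) (hB : Unbl S B)
    (h : Sep A B) : Unbl S (A ∪ B) := by
  obtain ⟨M, ⟨a1, a2, a3⟩, a4⟩ := hA
  obtain ⟨N, ⟨b1, b2, b3⟩, b4⟩ := hB
  have hd := h.disjoint
  refine ⟨M ∪ N, ⟨?_, ?_, ?_⟩, ?_⟩
  · intro e he
    rcases Finset.mem_union.1 he with he | he
    · exact ⟨(a1 e he).1, fun p hp => Finset.mem_union_left _ ((a1 e he).2 p hp)⟩
    · exact ⟨(b1 e he).1, fun p hp => Finset.mem_union_right _ ((b1 e he).2 p hp)⟩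
  · intro p hp
    rcases Finset.mem_union.1 hp with hp | hp
    · obtain ⟨e, ⟨he, hpe⟩, hu⟩ := a2 p hp
      refine ⟨e, ⟨Finset.mem_union_left _ he, hpe⟩, ?_⟩
      rintro f ⟨hf, hpf⟩
      rcases Finset.mem_union.1 hf with hf | hf
      · exact hu f ⟨hf, hpf⟩
      · exact absurd ((b1 f hf).2 p hpf) (Finset.disjoint_left.1 hd hp)
    · obtain ⟨e, ⟨he, hpe⟩, hu⟩ := b2 p hp
      refine ⟨e, ⟨Finset.mem_union_right _ he, hpe⟩, ?_⟩
      rintro f ⟨hf, hpf⟩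
      rcases Finset.mem_union.1 hf with hf | hf
      · exact absurd ((a1 f hf).2 p hpf) (fun h => Finset.disjoint_left.1 hd h hp)
      · exact hu f ⟨hf, hpf⟩
  · intro e he f hf hne
    rcases Finset.mem_union.1 (Finset.mem_coe.1 he) with he | he <;>
      rcases Finset.mem_union.1 (Finset.mem_coe.1 hf) with hf | hf
    · exact a3 he hf hne
    · exact h.edgeSeg_disjoint (a1 e he).2 (b1 f hf).2
    · exact h.symm.edgeSeg_disjoint (b1 e he).2 (a1 f hf).2
    · exact b3 he hf hne
  · intro e he
    rcases Finset.mem_union.1 he with he | he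
    · exact a4 e he
    · exact b4 e he

/-- A separated decomposition of `Y`. -/
theorem Unbl.of_sep {S : Finset (Sym2 Pt)} {Y A B : Finset Pt} (hA : Unbl S A) (hB : Unbl S B)
    (h : Sep A B) (hY : ∀ p, p ∈ Y ↔ p ∈ A ∨ p ∈ B) : Unbl S Y := by
  have : Y = A ∪ B := by ext p; simp [hY]
  exact this ▸ hA.union hB h

/-- Matching along a line and on both its sides. -/
theorem Unbl.of_line {S : Finset (Sym2 Pt)} {Y A B : Finset Pt} {u w : Pt} (huw : u ≠ w)
    (hS : s(u, w) ∉ S) (hA : Unbl S A) (hB : Unbl S B) (hAp : ∀ p ∈ A, 0 < orient u w p)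
    (hBp : ∀ p ∈ B, orient u w p < 0) (hY : ∀ p, p ∈ Y ↔ p ∈ A ∨ p ∈ B ∨ p = u ∨ p = w) :
    Unbl S Y := by
  have h1 : Unbl S (B ∪ {u, w}) := by
    refine hB.union (unbl_pair huw hS) (sep_side (u := w) (w := u) ?_ ?_)
    · intro p hp; rw [orient_swap]; linarith [hBp p hp]
    · intro p hp; right; simp at hp; tauto
  refine hA.of_sep h1 (sep_side hAp ?_) ?_
  · intro p hp
    simp at hp
    rcases hp with rfl | rfl | hp
    · simp
    · simp
    · exact Or.inl (hBp p hp)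
  · intro p; rw [hY]; simp; tauto

/-! ### Convex position -/

/-- `u` is a vertex of the convex hull of `Y`. -/
def HV (Y : Finset Pt) (u : Pt) : Prop :=
  u ∈ Y ∧ ∃ α β : ℝ, ∀ p ∈ Y, p ≠ u → 0 < α * (p.1 - u.1) + β * (p.2 - u.2)

/-- All other points of `Y` lie to the left of the directed line `x y`. -/
def HE (Y : Finset Pt) (x y : Pt) : Prop :=
  x ∈ Y ∧ y ∈ Y ∧ x ≠ y ∧ ∀ p ∈ Y, p ≠ x → p ≠ y → 0 < orient x y p

theorem HV.of_lex {Y : Finset Pt} {u : Pt} (hu : u ∈ Y) {α β α' β' : ℝ}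
    (h : ∀ p ∈ Y, p ≠ u → 0 < α * (p.1 - u.1) + β * (p.2 - u.2) ∨
      α * (p.1 - u.1) + β * (p.2 - u.2) = 0 ∧ 0 < α' * (p.1 - u.1) + β' * (p.2 - u.2)) :
    HV Y u := by
  obtain ⟨ε, hε⟩ := (exists_pos_perturb (fun p => α * (p.1 - u.1) + β * (p.2 - u.2))
    (fun p => α' * (p.1 - u.1) + β' * (p.2 - u.2)) (Y.erase u)
    (fun p hp => h p (Finset.mem_of_mem_erase hp) (Finset.ne_of_mem_erase hp))).exists
  refine ⟨hu, α + ε * α', β + ε * β', fun p hp hne => ?_⟩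
  have := hε p (Finset.mem_erase.2 ⟨hne, hp⟩)
  linarith

theorem exists_HV {Y : Finset Pt} (hY : Y.Nonempty) : ∃ u, HV Y u := by
  obtain ⟨u, hu, h⟩ := Finset.exists_min_image Y (fun p => toLex p) hY
  refine ⟨u, HV.of_lex hu (α := 1) (β := 0) (α' := 0) (β' := 1) fun p hp hne => ?_⟩
  have h1 := h p hp
  rw [Prod.Lex.toLex_le_toLex] at h1
  rcases h1 with h1 | ⟨h1, h2⟩
  · left; linarith
  · right
    refine ⟨by linarith, ?_⟩
    have : u.2 ≠ p.2 := fun h => hne (Prod.ext h1.symm h.symm)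
    have := lt_of_le_of_ne h2 this
    linarith

theorem HE.ne {Y : Finset Pt} {x y : Pt} (h : HE Y x y) : x ≠ y := h.2.2.1

theorem HE.left_HV {Y : Finset Pt} {x y : Pt} (h : HE Y x y) : HV Y x := by
  obtain ⟨hx, hy, hne, h⟩ := h
  refine HV.of_lex hx (α := -(y.2 - x.2)) (β := y.1 - x.1) (α' := y.1 - x.1) (β' := y.2 - x.2)
    fun p hp hpx => ?_
  by_cases hpy : p = y
  · subst hpy
    right
    exact ⟨by ring, by have := dist_sq_pos hne; nlinarith⟩
  · left
    have := h p hp hpx hpy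
    simp only [orient] at this; linarith

theorem HE.right_HV {Y : Finset Pt} {x y : Pt} (h : HE Y x y) : HV Y y := by
  obtain ⟨hx, hy, hne, h⟩ := h
  refine HV.of_lex hy (α := -(y.2 - x.2)) (β := y.1 - x.1) (α' := x.1 - y.1) (β' := x.2 - y.2)
    fun p hp hpy => ?_
  by_cases hpx : p = x
  · subst hpx
    right
    exact ⟨by ring, by have := dist_sq_pos hne; nlinarith⟩
  · left
    have := h p hp hpx hpy
    simp only [orient] at this; linarith

/-- Removing a hull edge. -/
theorem HE.unbl {S : Finset (Sym2 Pt)} {Y : Finset Pt} {x y : Pt} (h : HE Y x y)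
    (hS : s(x, y) ∉ S) (hZ : Unbl S (Y \ {x, y})) : Unbl S Y := by
  refine hZ.of_line h.ne hS (unbl_empty S) ?_ (by simp) ?_
  · intro p hp
    simp at hp
    exact h.2.2.2 p hp.1 hp.2.1 hp.2.2
  · intro p
    have h1 := h.1
    have h2 := h.2.1
    simp
    by_cases hx : p = x <;> by_cases hy : p = y <;> simp_all

/-- The radial coordinate around a hull vertex. -/
theorem HV.exists_key {Y : Finset Pt} {u : Pt} (h : HV Y u) :
    ∃ κ : Pt → ℝ, ∀ p ∈ Y, ∀ q ∈ Y, p ≠ u → q ≠ u → (κ p < κ q ↔ 0 < orient u p q) := by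
  obtain ⟨hu, α, β, h⟩ := h
  refine ⟨fun p => (-β * (p.1 - u.1) + α * (p.2 - u.2)) / (α * (p.1 - u.1) + β * (p.2 - u.2)),
    fun p hp q hq hpu hqu => ?_⟩
  have h1 := h p hp hpu
  have h2 := h q hq hqu
  simp only
  rw [div_lt_div_iff₀ h1 h2]
  have hpos : 0 < α ^ 2 + β ^ 2 := by
    by_contra hc
    have ha : α = 0 := by nlinarith [sq_nonneg α, sq_nonneg β]
    have hb : β = 0 := by nlinarith [sq_nonneg α, sq_nonneg β]
    subst ha hb
    simp at h1
  have e : (-β * (q.1 - u.1) + α * (q.2 - u.2)) * (α * (p.1 - u.1) + β * (p.2 - u.2)) -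
      (-β * (p.1 - u.1) + α * (p.2 - u.2)) * (α * (q.1 - u.1) + β * (q.2 - u.2)) =
      (α ^ 2 + β ^ 2) * orient u p q := by simp only [orient]; ring
  rw [← sub_pos, e]
  exact ⟨fun h => (pos_iff_pos_of_mul_pos h).1 hpos, fun h => mul_pos hpos h⟩

theorem key_injOn {Y : Finset Pt} {u : Pt} (hY : GP Y) (hu : u ∈ Y) {κ : Pt → ℝ}
    (hκ : ∀ p ∈ Y, ∀ q ∈ Y, p ≠ u → q ≠ u → (κ p < κ q ↔ 0 < orient u p q)) :
    Set.InjOn κ (Y.erase u : Finset Pt) := by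
  intro p hp q hq heq
  simp at hp hq
  by_contra hne
  have h1 := hκ p hp.1 q hq.1 hp.2 hq.2
  have h2 := hκ q hq.1 p hp.1 hq.2 hp.2
  have h3 := hY u hu p hp.1 q hq.1 (Ne.symm hp.2) (Ne.symm hq.2) hne
  rw [heq] at h1 h2
  rw [orient_swap_right] at h2
  simp at h1 h2
  exact h3 (le_antisymm h1 h2)

theorem HV.exists_HE_left {Y : Finset Pt} {u : Pt} (hY : GP Y) (h : HV Y u) (h2 : 2 ≤ Y.card) :
    ∃ y, HE Y u y := by
  obtain ⟨κ, hκ⟩ := h.exists_key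
  have hne : (Y.erase u).Nonempty := by
    rw [← Finset.card_pos, Finset.card_erase_of_mem h.1]; omega
  obtain ⟨y, hy, hmin⟩ := Finset.exists_min_image (Y.erase u) κ hne
  obtain ⟨hyu, hyY⟩ := Finset.mem_erase.1 hy
  refine ⟨y, h.1, hyY, hyu.symm, fun p hp hpu hpy => ?_⟩
  rw [← hκ y hyY p hp hyu hpu]
  refine lt_of_le_of_ne (hmin p (by simp [hp, hpu])) fun he => hpy ?_
  exact (key_injOn hY h.1 hκ (by simp [hyu, hyY]) (by simp [hpu, hp]) he).symm

theorem HV.exists_HE_right {Y : Finset Pt} {u : Pt} (hY : GP Y) (h : HV Y u) (h2 : 2 ≤ Y.card) :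
    ∃ y, HE Y y u := by
  obtain ⟨κ, hκ⟩ := h.exists_key
  have hne : (Y.erase u).Nonempty := by
    rw [← Finset.card_pos, Finset.card_erase_of_mem h.1]; omega
  obtain ⟨y, hy, hmax⟩ := Finset.exists_max_image (Y.erase u) κ hne
  obtain ⟨hyu, hyY⟩ := Finset.mem_erase.1 hy
  refine ⟨y, hyY, h.1, hyu, fun p hp hpy hpu => ?_⟩
  rw [← orient_rotate, ← hκ p hp y hyY hpu hyu]
  refine lt_of_le_of_ne (hmax p (by simp [hp, hpu])) fun he => hpy ?_
  exact key_injOn hY h.1 hκ (by simp [hpu, hp]) (by simp [hyu, hyY]) he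

theorem HE.not_symm {Y : Finset Pt} {x y : Pt} (h3 : 3 ≤ Y.card) (h : HE Y x y) : ¬ HE Y y x := by
  intro h'
  obtain ⟨p, hp, hpn⟩ : ∃ p ∈ Y, p ∉ ({x, y} : Finset Pt) := by
    by_contra hc
    push Not at hc
    have := Finset.card_le_card (s := Y) (t := {x, y}) hc
    have := Finset.card_le_two (a := x) (b := y)
    omega
  simp at hpn
  have h1 := h.2.2.2 p hp hpn.1 hpn.2
  have h2 := h'.2.2.2 p hp hpn.2 hpn.1
  rw [orient_swap] at h2
  linarith

theorem mul_le_mul_of_div_le_div_of_neg {a b c d : ℝ} (hb : b < 0) (hd : d < 0)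
    (h : a / b ≤ c / d) : a * d ≤ c * b := by
  rw [← neg_div_neg_eq a b, ← neg_div_neg_eq c d, div_le_div_iff₀ (by linarith) (by linarith)] at h
  linarith

/-- If `v` is not a hull vertex, the ray from `w` through `v` leaves the hull of `Y` across
a hull edge. -/
theorem exists_exit {Y : Finset Pt} (hY : GP Y) {v w : Pt} (hv : v ∈ Y) (hw : w ∈ Y) (hvw : v ≠ w)
    (hnot : ¬ HV Y v) :
    ∃ x ∈ Y, ∃ y ∈ Y, 0 < orient v w x ∧ orient v w y < 0 ∧ (HE Y x y ∨ HE Y y x) := by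
  have hN := dist_sq_pos hvw
  let s : Pt → ℝ := orient v w
  let t : Pt → ℝ := fun p => (v.1 - w.1) * (p.1 - v.1) + (v.2 - w.2) * (p.2 - v.2)
  have htw : t w < 0 := by simp only [t]; nlinarith
  have hs0 : ∀ p ∈ Y, p ≠ v → s p = 0 → p = w := fun p hp hpv h0 => by
    by_contra hpw
    exact hY v hv w hw p hp hvw (Ne.symm hpv) (Ne.symm hpw) h0
  let L := Y.filter fun p => 0 < s p
  let R := Y.filter fun p => s p < 0
  by_cases hL : L.Nonempty
  swap
  · exfalso
    refine hnot (HV.of_lex hv (α := w.2 - v.2) (β := -(w.1 - v.1)) (α' := w.1 - v.1)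
      (β' := w.2 - v.2) fun p hp hpv => ?_)
    have h1 : s p ≤ 0 := by
      by_contra hc
      exact hL ⟨p, by simp [L, hp]; linarith⟩
    have e : (w.2 - v.2) * (p.1 - v.1) + -(w.1 - v.1) * (p.2 - v.2) = -s p := by
      simp only [s, orient]; ring
    rw [e]
    rcases h1.lt_or_eq with h1 | h1
    · left; linarith
    · right
      have := hs0 p hp hpv h1
      subst this
      exact ⟨by rw [h1]; simp, by nlinarith⟩
  by_cases hR : R.Nonempty
  swap
  · exfalso
    refine hnot (HV.of_lex hv (α := -(w.2 - v.2)) (β := w.1 - v.1) (α' := w.1 - v.1)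
      (β' := w.2 - v.2) fun p hp hpv => ?_)
    have h1 : 0 ≤ s p := by
      by_contra hc
      exact hR ⟨p, by simp [R, hp]; linarith⟩
    have e : -(w.2 - v.2) * (p.1 - v.1) + (w.1 - v.1) * (p.2 - v.2) = s p := by
      simp only [s, orient]; ring
    rw [e]
    rcases h1.lt_or_eq with h1 | h1
    · left; linarith
    · right
      have := hs0 p hp hpv h1.symm
      subst this
      exact ⟨h1.symm, by nlinarith⟩
  let τ : Pt × Pt → ℝ := fun z => (t z.1 * s z.2 - t z.2 * s z.1) / (s z.2 - s z.1)
  obtain ⟨⟨x, y⟩, hxy, hmax⟩ := Finset.exists_max_image (L ×ˢ R) τ (hL.product hR)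
  obtain ⟨hxL, hyR⟩ := Finset.mem_product.1 hxy
  simp only at hxL hyR
  obtain ⟨hx, hsx⟩ := Finset.mem_filter.1 hxL
  obtain ⟨hy, hsy⟩ := Finset.mem_filter.1 hyR
  have hxv : x ≠ v := by rintro rfl; simp [s] at hsx
  have hyv : y ≠ v := by rintro rfl; simp [s] at hsy
  have hxney : x ≠ y := by rintro rfl; linarith
  have hΔ : ∀ x y p : Pt, (s y - s x) * (t p - t x) - (t y - t x) * (s p - s x) =
      ((w.1 - v.1) ^ 2 + (w.2 - v.2) ^ 2) * orient x y p := by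
    intro x y p; simp only [s, t, orient]; ring
  have hsv : s v = 0 := by simp [s]
  have htv : t v = 0 := by simp [t]
  have hsw : s w = 0 := by simp [s]
  rcases le_or_gt (t x * s y - t y * s x) 0 with hτ | hτ
  swap
  · -- all crossings lie on the side of `w`, so `v` is a hull vertex
    exfalso
    have hall : ∀ p ∈ L, ∀ q ∈ R, t p / s p < t q / s q := by
      intro p hp q hq
      have hsp : 0 < s p := (Finset.mem_filter.1 hp).2
      have hsq : s q < 0 := (Finset.mem_filter.1 hq).2
      have h1 := hmax (p, q) (Finset.mem_product.2 ⟨hp, hq⟩)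
      have h2 : τ (x, y) < 0 := div_neg_of_pos_of_neg hτ (by linarith)
      have h3 : (t p * s q - t q * s p) / (s q - s p) < 0 := lt_of_le_of_lt h1 h2
      have h4 : 0 < t p * s q - t q * s p := by
        by_contra hc
        have := div_nonneg_of_nonpos (not_lt.1 hc) (by linarith : s q - s p ≤ 0)
        linarith
      rw [← sub_pos, div_sub_div _ _ hsq.ne hsp.ne']
      exact div_pos_of_neg_of_neg (by linarith) (mul_neg_of_neg_of_pos hsq hsp)
    obtain ⟨c, hc1, hc2⟩ := Order.exists_between_finsets (lo := L.image fun p => t p / s p)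
      (hi := R.image fun p => t p / s p) (by
        intro a ha b hb
        obtain ⟨p, hp, rfl⟩ := Finset.mem_image.1 ha
        obtain ⟨q, hq, rfl⟩ := Finset.mem_image.1 hb
        exact hall p hp q hq)
    refine hnot ⟨hv, -(v.1 - w.1) - c * (w.2 - v.2), -(v.2 - w.2) + c * (w.1 - v.1),
      fun p hp hpv => ?_⟩
    have e : (-(v.1 - w.1) - c * (w.2 - v.2)) * (p.1 - v.1) +
        (-(v.2 - w.2) + c * (w.1 - v.1)) * (p.2 - v.2) = c * s p - t p := by
      simp only [s, t, orient]; ring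
    rw [e]
    rcases lt_trichotomy (s p) 0 with h | h | h
    · have := hc2 _ (Finset.mem_image_of_mem (fun p => t p / s p)
        (show p ∈ R by simp [R, hp, h]))
      rw [lt_div_iff_of_neg h] at this
      linarith
    · have := hs0 p hp hpv h
      subst this
      rw [h]; linarith
    · have := hc1 _ (Finset.mem_image_of_mem (fun p => t p / s p)
        (show p ∈ L by simp [L, hp, h]))
      rw [div_lt_iff₀ h] at this
      linarith
  · refine ⟨x, hx, y, hy, hsx, hsy, Or.inl ⟨hx, hy, hxney, fun p hp hpx hpy => ?_⟩⟩
    have hne := hY x hx y hy p hp hxney (Ne.symm hpx) (Ne.symm hpy)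
    have hnev := hY x hx y hy v hv hxney hxv hyv
    have hv' := hΔ x y v
    rw [hsv, htv] at hv'
    have hτ' : t x * s y - t y * s x < 0 := by
      refine lt_of_le_of_ne hτ fun h0 => hnev ?_
      have : ((w.1 - v.1) ^ 2 + (w.2 - v.2) ^ 2) * orient x y v = 0 := by
        rw [← hv']; linarith
      exact (mul_eq_zero.1 this).resolve_left hN.ne'
    have goal : 0 ≤ (s y - s x) * (t p - t x) - (t y - t x) * (s p - s x) := by
      rcases lt_trichotomy (s p) 0 with h | h | h
      · have h1 : τ (x, p) ≤ τ (x, y) :=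
          hmax (x, p) (Finset.mem_product.2 ⟨hxL, by simp [R, hp, h]⟩)
        simp only [τ] at h1
        have h1 := mul_le_mul_of_div_le_div_of_neg (by linarith) (by linarith) h1
        nlinarith
      · have hpt : t p ≤ 0 := by
          by_cases hpv : p = v
          · rw [hpv, htv]
          · rw [hs0 p hp hpv h]; exact htw.le
        rw [h]
        nlinarith
      · have h1 : τ (p, y) ≤ τ (x, y) :=
          hmax (p, y) (Finset.mem_product.2 ⟨by simp [L, hp, h], hyR⟩)
        simp only [τ] at h1
        have h1 := mul_le_mul_of_div_le_div_of_neg (by linarith) (by linarith) h1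
        nlinarith
    rw [hΔ] at goal
    have h0 : 0 ≤ orient x y p := by
      by_contra hc
      have := mul_neg_of_pos_of_neg hN (not_le.1 hc)
      linarith
    exact lt_of_le_of_ne h0 hne.symm

end PlaneMatching

namespace PlaneMatching

/-! ### Bichromatic matchings and sparse edge sets -/

/-- A balanced two-coloured set without forbidden bichromatic edges can be matched. -/
theorem unbl_of_colouring {S : Finset (Sym2 Pt)} {Y : Finset Pt} (hY : GP Y) {w : Pt → ℤ}
    (hw : ∀ p ∈ Y, w p = 1 ∨ w p = -1) (h0 : ∑ p ∈ Y, w p = 0)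
    (hS : ∀ a ∈ Y, ∀ b ∈ Y, w a ≠ w b → s(a, b) ∉ S) : Unbl S Y := by
  induction hn : Y.card using Nat.strong_induction_on generalizing Y with
  | _ n ih =>
  rcases Y.eq_empty_or_nonempty with rfl | hne
  · exact unbl_empty S
  obtain ⟨u, hu⟩ := exists_HV hne
  obtain ⟨κ, hκ⟩ := hu.exists_key
  have huY := hu.1
  have hinj := key_injOn hY huY hκ
  have hwu := hw u huY
  have hsum := Finset.add_sum_erase Y w huY
  obtain ⟨q, hq, hq1, hq2⟩ := exists_balanced_before (w := fun p => w u * w p) (F := 0) hinj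
    (fun p hp => by
      rcases hwu with h | h <;> rcases hw p (Finset.mem_of_mem_erase hp) with h' | h' <;>
        simp [h, h']) le_rfl (by
      rw [← Finset.mul_sum]
      have : ∑ p ∈ Y.erase u, w p = -w u := by linarith
      rw [this]
      rcases hwu with h | h <;> simp [h])
  obtain ⟨hqu, hqY⟩ := Finset.mem_erase.1 hq
  let A := (Y.erase u).filter fun p => κ p < κ q
  let B := (Y.erase u).filter fun p => κ q < κ p
  have hwq := hw q hqY
  have hA0 : ∑ p ∈ A, w p = 0 := by
    rw [← Finset.mul_sum, zero_add] at hq2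
    exact (mul_eq_zero.1 hq2).resolve_left (by omega)
  have hB0 : ∑ p ∈ B, w p = 0 := by
    have h1 := Finset.add_sum_erase (Y.erase u) w hq
    have h2 := Finset.sum_filter_add_sum_filter_not ((Y.erase u).erase q) (fun p => κ p < κ q) w
    have h3 : ((Y.erase u).erase q).filter (fun p => κ p < κ q) = A := by
      ext p; simp only [A, Finset.mem_filter, Finset.mem_erase]
      constructor
      · tauto
      · rintro ⟨h, h'⟩
        exact ⟨⟨by rintro rfl; exact lt_irrefl _ h', h⟩, h'⟩
    have h4 : ((Y.erase u).erase q).filter (fun p => ¬ κ p < κ q) = B := by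
      ext p; simp only [B, Finset.mem_filter, Finset.mem_erase]
      constructor
      · rintro ⟨⟨h1, h2⟩, h3⟩
        refine ⟨h2, lt_of_le_of_ne (not_lt.1 h3) fun he => h1 ?_⟩
        exact (hinj (Finset.mem_coe.2 hq) (by simpa using h2.symm) he).symm
      · rintro ⟨h, h'⟩
        exact ⟨⟨by rintro rfl; exact lt_irrefl _ h', h⟩, not_lt.2 h'.le⟩
    rw [h3, h4, hA0] at h2
    have : w u * w q = -1 := hq1
    rcases hwu with h | h <;> rw [h] at this hsum <;> omega
  have hsubA : A ⊆ Y := (Finset.filter_subset _ _).trans (Finset.erase_subset _ _)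
  have hsubB : B ⊆ Y := (Finset.filter_subset _ _).trans (Finset.erase_subset _ _)
  have huA : u ∉ A := by simp [A]
  have huB : u ∉ B := by simp [B]
  have hlt : ∀ Z ⊆ Y, u ∉ Z → ∑ p ∈ Z, w p = 0 → Unbl S Z := by
    intro Z hZ huZ hZ0
    refine ih Z.card ?_ (hY.mono hZ) (fun p hp => hw p (hZ hp)) hZ0
      (fun a ha b hb => hS a (hZ ha) b (hZ hb)) rfl
    rw [← hn]
    exact Finset.card_lt_card ⟨hZ, fun h => huZ (h huY)⟩
  have hne' : w u ≠ w q := by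
    intro h; have h' : w u * w q = -1 := hq1
    rw [h] at h'; rcases hwq with h | h <;> rw [h] at h' <;> omega
  refine (hlt B hsubB huB hB0).of_line (Ne.symm hqu) (hS u huY q hqY hne')
    (hlt A hsubA huA hA0) ?_ ?_ ?_
  · intro p hp
    simp only [B, Finset.mem_filter, Finset.mem_erase] at hp
    exact (hκ q hqY p hp.1.2 hqu hp.1.1).1 hp.2
  · intro p hp
    simp only [A, Finset.mem_filter, Finset.mem_erase] at hp
    have := (hκ p hp.1.2 q hqY hp.1.1 hqu).1 hp.2
    rw [orient_swap_right] at this; linarith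
  · intro p
    simp only [A, B, Finset.mem_filter, Finset.mem_erase]
    constructor
    · intro hp
      by_cases h1 : p = u
      · tauto
      rcases lt_trichotomy (κ p) (κ q) with h | h | h
      · tauto
      · right; right; right
        exact hinj (by simp [h1, hp]) (Finset.mem_coe.2 hq) h
      · tauto
    · rintro (h | h | rfl | rfl)
      · exact h.1.2
      · exact h.1.2
      · exact huY
      · exact hqY

theorem sum_sign {Y U : Finset Pt} (hU : U ⊆ Y) :
    ∑ p ∈ Y, (if p ∈ U then (1 : ℤ) else -1) = 2 * U.card - Y.card := by
  rw [Finset.sum_ite, Finset.sum_const, Finset.sum_const, Finset.filter_mem_eq_inter,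
    Finset.inter_eq_right.2 hU, Finset.filter_not, Finset.filter_mem_eq_inter,
    Finset.inter_eq_right.2 hU]
  have := Finset.card_sdiff_add_card_eq_card hU
  simp
  omega

theorem exists_edge_of_half {S : Finset (Sym2 Pt)} {Y : Finset Pt} (hY : GP Y) {m : ℕ}
    (hc : Y.card = 2 * m) (hb : ¬ Unbl S Y) {U : Finset Pt} (hU : U ⊆ Y) (hUc : U.card = m) :
    ∃ a ∈ U, ∃ b ∈ Y, b ∉ U ∧ s(a, b) ∈ S := by
  by_contra hcon
  push Not at hcon
  refine hb (unbl_of_colouring hY (w := fun p => if p ∈ U then 1 else -1) ?_ ?_ ?_)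
  · intro p _; by_cases h : p ∈ U <;> simp [h]
  · rw [sum_sign hU, hc, hUc]; push_cast; ring
  · intro a ha b hb hab
    by_cases h : a ∈ U <;> by_cases h' : b ∈ U <;> simp [h, h'] at hab
    · exact hcon a h b hb h'
    · rw [Sym2.eq_swap]; exact hcon b h' a ha h

theorem card_label_le {L : Type*} [DecidableEq L] {S : Finset (Sym2 Pt)} {Y : Finset Pt}
    (hY : GP Y) {m : ℕ} (hm : 1 ≤ m) (hc : Y.card = 2 * m) (hb : ¬ Unbl S Y) {φ : Pt → L}
    (hφ : ∀ a ∈ Y, ∀ b ∈ Y, s(a, b) ∈ S → φ a = φ b) : (Y.image φ).card ≤ m := by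
  by_contra hcon
  obtain ⟨U, hU, hUc, hsat⟩ := exists_saturated hm hc φ (not_le.1 hcon)
  obtain ⟨a, ha, b, hbY, hbU, hab⟩ := exists_edge_of_half hY hc hb hU hUc
  exact hbU (hsat a ha b hbY (hφ a (hU ha) b hbY hab))

theorem unbl_of_card_inner_lt {S : Finset (Sym2 Pt)} {Y : Finset Pt} (hY : GP Y) {m : ℕ}
    (hc : Y.card = 2 * m) (hlt : m = 0 ∨ (inner S Y).card < m) : Unbl S Y := by
  rcases Nat.eq_zero_or_pos m with rfl | hm
  · rw [Finset.card_eq_zero.1 hc]; exact unbl_empty S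
  · by_contra hb
    obtain ⟨φ, h1, h2⟩ := exists_label (inner S Y) Y
    have := card_label_le hY hm hc hb (φ := φ)
      fun a ha b hb' hab => h1 a b (mem_inner.2 ⟨hab, ha, hb'⟩)
    omega

/-- The points of `Y` with a neighbour in `Y`. -/
def core (S : Finset (Sym2 Pt)) (Y : Finset Pt) : Finset Pt := by
  classical exact Y.filter fun p => ∃ q ∈ Y, s(p, q) ∈ S

theorem mem_core {S : Finset (Sym2 Pt)} {Y : Finset Pt} {p : Pt} :
    p ∈ core S Y ↔ p ∈ Y ∧ ∃ q ∈ Y, s(p, q) ∈ S := by simp [core]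

theorem core_subset {S : Finset (Sym2 Pt)} {Y : Finset Pt} : core S Y ⊆ Y :=
  fun _ hp => (mem_core.1 hp).1

theorem core_mono {S : Finset (Sym2 Pt)} {Y Z : Finset Pt} (h : Y ⊆ Z) : core S Y ⊆ core S Z := by
  intro p hp
  obtain ⟨h1, q, hq, h2⟩ := mem_core.1 hp
  exact mem_core.2 ⟨h h1, q, h hq, h2⟩

theorem mem_core_left {S : Finset (Sym2 Pt)} {Y : Finset Pt} {a b : Pt} (ha : a ∈ Y) (hb : b ∈ Y)
    (h : s(a, b) ∈ S) : a ∈ core S Y := mem_core.2 ⟨ha, b, hb, h⟩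

theorem mem_core_right {S : Finset (Sym2 Pt)} {Y : Finset Pt} {a b : Pt} (ha : a ∈ Y) (hb : b ∈ Y)
    (h : s(a, b) ∈ S) : b ∈ core S Y := mem_core.2 ⟨hb, a, ha, by rwa [Sym2.eq_swap]⟩

/-- A minimal blocked configuration: `2 * m` points in general position spanning at most `m`
forbidden edges. -/
structure Tight (S : Finset (Sym2 Pt)) (Y : Finset Pt) (m : ℕ) : Prop where
  gp : GP Y
  card : Y.card = 2 * m
  pos : 1 ≤ m
  blocked : ¬ Unbl S Y
  le : (inner S Y).card ≤ m
  loopless : ∀ e ∈ S, ¬ e.IsDiag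

/-- A hull edge, without orientation. -/
def HEdge (Y : Finset Pt) (x y : Pt) : Prop := HE Y x y ∨ HE Y y x

theorem HEdge.symm {Y : Finset Pt} {x y : Pt} (h : HEdge Y x y) : HEdge Y y x := Or.symm h

theorem HEdge.left_HV {Y : Finset Pt} {x y : Pt} (h : HEdge Y x y) : HV Y x :=
  h.elim HE.left_HV HE.right_HV

theorem HEdge.mem_left {Y : Finset Pt} {x y : Pt} (h : HEdge Y x y) : x ∈ Y := h.left_HV.1

theorem HEdge.mem_right {Y : Finset Pt} {x y : Pt} (h : HEdge Y x y) : y ∈ Y := h.symm.left_HV.1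

theorem HEdge.ne {Y : Finset Pt} {x y : Pt} (h : HEdge Y x y) : x ≠ y :=
  h.elim HE.ne fun h => h.ne.symm

theorem HEdge.unbl {S : Finset (Sym2 Pt)} {Y : Finset Pt} {x y : Pt} (h : HEdge Y x y)
    (hS : s(x, y) ∉ S) (hZ : Unbl S (Y \ {x, y})) : Unbl S Y := by
  rcases h with h | h
  · exact h.unbl hS hZ
  · refine h.unbl (by rwa [Sym2.eq_swap]) ?_
    rwa [Finset.pair_comm]

theorem card_sdiff_pair {Y : Finset Pt} {x y : Pt} (hx : x ∈ Y) (hy : y ∈ Y) (hne : x ≠ y) :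
    (Y \ {x, y}).card + 2 = Y.card := by
  have h := Finset.card_sdiff_add_card_eq_card (s := {x, y}) (t := Y)
    (by intro p hp; simp at hp; rcases hp with rfl | rfl <;> assumption)
  rwa [Finset.card_pair hne] at h

theorem unbl_sdiff_pair {S : Finset (Sym2 Pt)} {Y : Finset Pt} (hY : GP Y) {m : ℕ}
    (hc : Y.card = 2 * m) (hle : (inner S Y).card ≤ m) {x y : Pt} (hne : x ≠ y)
    (hS : s(x, y) ∉ S) (hx : x ∈ core S Y) (hy : y ∈ core S Y) : Unbl S (Y \ {x, y}) := by
  obtain ⟨hxY, x', hx', hxx⟩ := mem_core.1 hx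
  obtain ⟨hyY, y', hy', hyy⟩ := mem_core.1 hy
  have hcard := card_sdiff_pair hxY hyY hne
  have hne' : s(x, x') ≠ s(y, y') := by
    intro h
    rcases Sym2.eq_iff.1 h with ⟨h1, -⟩ | ⟨h1, h2⟩
    · exact hne h1
    · rw [h2] at hxx; exact hS hxx
  have hsub : inner S (Y \ {x, y}) ⊆ inner S Y \ {s(x, x'), s(y, y')} := by
    intro e he
    induction e using Sym2.ind with
    | _ a b =>
    obtain ⟨h1, h2, h3⟩ := mem_inner.1 he
    simp only [Finset.mem_sdiff, Finset.mem_insert, Finset.mem_singleton, not_or] at h2 h3 ⊢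
    refine ⟨mem_inner.2 ⟨h1, h2.1, h3.1⟩, ?_, ?_⟩
    · intro h; rcases Sym2.eq_iff.1 h with ⟨h, -⟩ | ⟨-, h⟩
      · exact h2.2.1 h
      · exact h3.2.1 h
    · intro h; rcases Sym2.eq_iff.1 h with ⟨h, -⟩ | ⟨-, h⟩
      · exact h2.2.2 h
      · exact h3.2.2 h
  have h1 := Finset.card_le_card hsub
  have h2 := Finset.card_sdiff_add_card_eq_card (s := {s(x, x'), s(y, y')}) (t := inner S Y) (by
    intro e he; simp at he
    rcases he with rfl | rfl
    · exact mem_inner.2 ⟨hxx, hxY, hx'⟩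
    · exact mem_inner.2 ⟨hyy, hyY, hy'⟩)
  rw [Finset.card_pair hne'] at h2
  exact unbl_of_card_inner_lt (m := m - 1) (hY.mono Finset.sdiff_subset) (by omega) (by omega)

theorem Tight.ne {S : Finset (Sym2 Pt)} {Y : Finset Pt} {m : ℕ} (h : Tight S Y m) {a b : Pt}
    (hab : s(a, b) ∈ S) : a ≠ b := fun he => h.loopless _ hab (by simpa using he)

/-- A tight configuration spans exactly `m` edges, which form a connected graph on
`m + 1` points. -/
theorem Tight.connected {S : Finset (Sym2 Pt)} {Y : Finset Pt} {m : ℕ} (h : Tight S Y m) :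
    (inner S Y).card = m ∧ (core S Y).card = m + 1 ∧
    ∀ U ⊆ core S Y, U.Nonempty → U ≠ core S Y →
      ∃ a ∈ U, ∃ b ∈ core S Y, b ∉ U ∧ s(a, b) ∈ S := by
  have hm := h.pos
  have hc := h.card
  obtain ⟨φ, h1, h2⟩ := exists_label (inner S Y) Y
  have hφ : ∀ a ∈ Y, ∀ b ∈ Y, s(a, b) ∈ S → φ a = φ b :=
    fun a ha b hb hab => h1 a b (mem_inner.2 ⟨hab, ha, hb⟩)
  have h3 := card_label_le h.gp hm hc h.blocked hφ
  have h4 := h.le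
  have hm' : (Y.image φ).card = m := by omega
  refine ⟨by omega, ?_⟩
  -- a union of components cannot cut a class
  have hcut : ∀ U : Finset Pt, (∀ a ∈ U, ∀ b ∈ Y, b ∉ U → s(a, b) ∉ S) →
      ∀ x ∈ Y, ∀ y ∈ Y, φ x = φ y → x ∈ U → y ∈ U := by
    intro U hU x hx y hy hxy hxU
    by_contra hyU
    have h5 := card_label_le (φ := fun p => (φ p, decide (p ∈ U))) h.gp hm hc h.blocked (by
      intro a ha b hb hab
      refine Prod.ext (hφ a ha b hb hab) ?_
      by_cases haU : a ∈ U <;> by_cases hbU : b ∈ U <;> simp [haU, hbU]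
      · exact hU a haU b hb hbU hab
      · exact hU b hbU a ha haU (by rwa [Sym2.eq_swap]))
    have h6 : (Y.image fun p => (φ p, decide (p ∈ U))).image Prod.fst = Y.image φ := by
      rw [Finset.image_image]; rfl
    have h7 : ((Y.image fun p => (φ p, decide (p ∈ U))).image Prod.fst).card =
        (Y.image fun p => (φ p, decide (p ∈ U))).card := by
      apply le_antisymm Finset.card_image_le
      rw [h6, hm']; exact h5
    have h8 := Finset.injOn_of_card_image_eq h7
      (Finset.mem_coe.2 (Finset.mem_image_of_mem _ hx))
      (Finset.mem_coe.2 (Finset.mem_image_of_mem _ hy)) hxy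
    simp [hxU, hyU] at h8
  have hcut1 : ∀ p ∈ Y, p ∉ core S Y → ∀ y ∈ Y, φ p = φ y → y = p := by
    intro p hp hpc y hy hpy
    have := hcut {p} (by
      intro a ha b hb _ hab
      rw [Finset.mem_singleton] at ha
      subst ha
      exact hpc (mem_core.2 ⟨hp, b, hb, hab⟩)) p hp y hy hpy (by simp)
    simpa using this
  have big : ∀ x ∈ Y, {y ∈ Y | φ y = φ x}.card = m + 1 → (core S Y).card = m + 1 ∧
      ∀ U ⊆ core S Y, U.Nonempty → U ≠ core S Y →
        ∃ a ∈ U, ∃ b ∈ core S Y, b ∉ U ∧ s(a, b) ∈ S := by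
    intro x hx hK
    have hcore : core S Y = {y ∈ Y | φ y = φ x} := by
      ext p
      simp only [Finset.mem_filter]
      constructor
      · intro hp
        obtain ⟨hpY, q, hq, hpq⟩ := mem_core.1 hp
        refine ⟨hpY, ?_⟩
        by_contra hpx
        have h5 := Finset.card_filter_add_card_filter_not (s := Y) (fun y => φ y = φ x)
        have h6 : (Y.filter fun y => ¬ φ y = φ x).image φ = (Y.image φ).erase (φ x) := by
          ext l
          simp only [Finset.mem_image, Finset.mem_filter, Finset.mem_erase]
          constructor
          · rintro ⟨y, ⟨hy, hyx⟩, rfl⟩; exact ⟨hyx, y, hy, rfl⟩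
          · rintro ⟨hl, y, hy, rfl⟩; exact ⟨y, ⟨hy, hl⟩, rfl⟩
        have h7 := Finset.card_erase_of_mem (Finset.mem_image_of_mem φ hx)
        have h8 : ((Y.filter fun y => ¬ φ y = φ x).image φ).card =
            (Y.filter fun y => ¬ φ y = φ x).card := by rw [h6, h7]; omega
        have h9 := hφ p hpY q hq hpq
        have h10 := Finset.injOn_of_card_image_eq h8 (x₁ := p) (x₂ := q)
          (by simp [hpY, hpx]) (by simp [hq, ← h9, hpx]) h9
        exact h.ne hpq h10
      · rintro ⟨hpY, hpx⟩
        by_contra hpc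
        have : {y ∈ Y | φ y = φ x} ⊆ {p} := by
          intro y hy
          simp only [Finset.mem_filter, Finset.mem_singleton] at hy ⊢
          exact hcut1 p hpY hpc y hy.1 (hpx.trans hy.2.symm)
        have := Finset.card_le_card this
        simp at this; omega
    refine ⟨hcore ▸ hK, fun U hU ⟨z, hz⟩ hne => ?_⟩
    by_contra hcon
    push Not at hcon
    apply hne
    refine Finset.Subset.antisymm hU fun y hy => ?_
    have hzc := hU hz
    rw [hcore, Finset.mem_filter] at hzc hy
    refine hcut U (fun a ha b hb hbU hab => ?_) z hzc.1 y hy.1 (hzc.2.trans hy.2.symm) hz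
    exact hcon a ha b (mem_core_right (core_subset (hU ha)) hb hab) hbU hab
  rcases saturated_dichotomy hc φ hm' (fun U hU hsat hUc => by
    obtain ⟨a, ha, b, hbY, hbU, hab⟩ := exists_edge_of_half h.gp hc h.blocked hU hUc
    exact hbU (hsat a ha b hbY (hφ a (hU ha) b hbY hab))) with htwo | ⟨x, hx, hK⟩
  swap
  · exact big x hx hK
  have hYne : Y.Nonempty := by rw [← Finset.card_pos]; omega
  rcases hm.eq_or_lt with h1m | h1m
  · obtain ⟨x, hx⟩ := hYne
    exact big x hx (by rw [htwo x hx]; omega)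
  exfalso
  have hall : ∀ p ∈ Y, p ∈ core S Y := by
    intro p hp
    by_contra hpc
    have : {y ∈ Y | φ y = φ p} ⊆ {p} := by
      intro y hy
      simp only [Finset.mem_filter, Finset.mem_singleton] at hy ⊢
      exact hcut1 p hp hpc y hy.1 hy.2.symm
    have := Finset.card_le_card this
    rw [htwo p hp] at this
    simp at this
  obtain ⟨x, hx⟩ := exists_HV hYne
  obtain ⟨y, hy⟩ := hx.exists_HE_left h.gp (by omega)
  obtain ⟨z, hz⟩ := hx.exists_HE_right h.gp (by omega)
  have hyz : y ≠ z := by rintro rfl; exact hy.not_symm (by omega) hz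
  have hfin : ∀ y, HEdge Y x y → s(x, y) ∈ S := by
    intro y hy
    by_contra hS
    exact h.blocked (hy.unbl hS (unbl_sdiff_pair h.gp hc h.le hy.ne hS
      (hall x hx.1) (hall y hy.mem_right)))
  have hy' := hφ x hx.1 y hy.2.1 (hfin y (Or.inl hy))
  have hz' := hφ x hx.1 z hz.1 (hfin z (Or.inr hz))
  have hsub : ({x, y, z} : Finset Pt) ⊆ {p ∈ Y | φ p = φ x} := by
    intro p hp
    simp only [Finset.mem_insert, Finset.mem_singleton] at hp
    rw [Finset.mem_filter]
    rcases hp with rfl | rfl | rfl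
    · exact ⟨hx.1, rfl⟩
    · exact ⟨hy.2.1, hy'.symm⟩
    · exact ⟨hz.1, hz'.symm⟩
  have := Finset.card_le_card hsub
  rw [htwo x hx.1, Finset.card_eq_three.2 ⟨x, y, z, hy.ne, hz.ne.symm, hyz, rfl⟩] at this
  omega

/-- Every edge of a tight configuration is a bridge. -/
theorem Tight.exists_cut {S : Finset (Sym2 Pt)} {Y : Finset Pt} {m : ℕ} (h : Tight S Y m)
    {a b : Pt} (ha : a ∈ Y) (hb : b ∈ Y) (hab : s(a, b) ∈ S) :
    ∃ K : Finset Pt, a ∈ K ∧ b ∉ K ∧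
      ∀ x ∈ Y, ∀ y ∈ Y, x ∈ K → y ∉ K → s(x, y) ∈ S → x = a ∧ y = b := by
  obtain ⟨φ, h1, h2⟩ := exists_label ((inner S Y).erase s(a, b)) Y
  have hmem : s(a, b) ∈ inner S Y := mem_inner.2 ⟨hab, ha, hb⟩
  have h3 := Finset.card_erase_of_mem hmem
  have h4 := h.le
  have h5 := h.pos
  have h6 := h.card
  have hne : φ a ≠ φ b := by
    intro heq
    have := card_label_le (φ := φ) h.gp h5 h6 h.blocked (by
      intro x hx y hy hxy
      by_cases he : s(x, y) = s(a, b)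
      · rcases Sym2.eq_iff.1 he with ⟨rfl, rfl⟩ | ⟨rfl, rfl⟩
        · exact heq
        · exact heq.symm
      · exact h1 x y (Finset.mem_erase.2 ⟨he, mem_inner.2 ⟨hxy, hx, hy⟩⟩))
    omega
  refine ⟨{x ∈ Y | φ x = φ a}, by simp [ha], by simp [hne.symm], ?_⟩
  intro x hx y hy hxK hyK hxy
  simp only [Finset.mem_filter, hx, hy, true_and] at hxK hyK
  by_cases he : s(x, y) = s(a, b)
  · rcases Sym2.eq_iff.1 he with ⟨rfl, rfl⟩ | ⟨rfl, rfl⟩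
    · exact ⟨rfl, rfl⟩
    · exact absurd hxK hne.symm
  · have := h1 x y (Finset.mem_erase.2 ⟨he, mem_inner.2 ⟨hxy, hx, hy⟩⟩)
    exact absurd (this.symm.trans hxK) hyK

end PlaneMatching

namespace PlaneMatching

/-! ### Sides of an edge -/

/-- The points of `Y` to the left of the directed line `u w`. -/
def lft (Y : Finset Pt) (u w : Pt) : Finset Pt := Y.filter fun p => 0 < orient u w p

theorem mem_lft {Y : Finset Pt} {u w p : Pt} : p ∈ lft Y u w ↔ p ∈ Y ∧ 0 < orient u w p := by
  simp [lft]

/-- `A` and `B` are the two open sides of the line `u w`, in some order. -/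
def IsSides (Y : Finset Pt) (u w : Pt) (A B : Finset Pt) : Prop :=
  A = lft Y u w ∧ B = lft Y w u ∨ A = lft Y w u ∧ B = lft Y u w

namespace IsSides
variable {Y A B : Finset Pt} {u w : Pt}

theorem mk (Y : Finset Pt) (u w : Pt) : IsSides Y u w (lft Y u w) (lft Y w u) := Or.inl ⟨rfl, rfl⟩

theorem symm (h : IsSides Y u w A B) : IsSides Y u w B A := by
  unfold IsSides at *; tauto

theorem swap (h : IsSides Y u w A B) : IsSides Y w u A B := by
  unfold IsSides at *; tauto

theorem subset (h : IsSides Y u w A B) : A ⊆ Y := by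
  rcases h with ⟨rfl, -⟩ | ⟨rfl, -⟩ <;> exact Finset.filter_subset _ _

theorem orient_ne (h : IsSides Y u w A B) {p : Pt} (hp : p ∈ A) : orient u w p ≠ 0 := by
  rcases h with ⟨rfl, -⟩ | ⟨rfl, -⟩
  · exact (mem_lft.1 hp).2.ne'
  · have := (mem_lft.1 hp).2
    rw [orient_swap] at this
    linarith [this.ne]

theorem ne_left (h : IsSides Y u w A B) {p : Pt} (hp : p ∈ A) : p ≠ u := by
  rintro rfl; exact h.orient_ne hp (by simp)

theorem ne_right (h : IsSides Y u w A B) {p : Pt} (hp : p ∈ A) : p ≠ w := by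
  rintro rfl; exact h.orient_ne hp (by simp)

theorem disjoint (h : IsSides Y u w A B) {p : Pt} (hp : p ∈ A) : p ∉ B := by
  intro hp'
  rcases h with ⟨rfl, rfl⟩ | ⟨rfl, rfl⟩ <;>
  · have h1 := (mem_lft.1 hp).2
    have h2 := (mem_lft.1 hp').2
    rw [orient_swap] at h2
    linarith

theorem cases (h : IsSides Y u w A B) (hY : GP Y) (hu : u ∈ Y) (hw : w ∈ Y) (huw : u ≠ w)
    {p : Pt} (hp : p ∈ Y) : p ∈ A ∨ p ∈ B ∨ p = u ∨ p = w := by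
  by_cases h1 : p = u
  · tauto
  by_cases h2 : p = w
  · tauto
  have h3 := hY u hu w hw p hp huw (Ne.symm h1) (Ne.symm h2)
  rcases lt_or_gt_of_ne h3 with h3 | h3 <;> rcases h with ⟨rfl, rfl⟩ | ⟨rfl, rfl⟩
  · exact Or.inr (Or.inl (mem_lft.2 ⟨hp, by rw [orient_swap]; linarith⟩))
  · exact Or.inl (mem_lft.2 ⟨hp, by rw [orient_swap]; linarith⟩)
  · exact Or.inl (mem_lft.2 ⟨hp, h3⟩)
  · exact Or.inr (Or.inl (mem_lft.2 ⟨hp, h3⟩))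

theorem sep (h : IsSides Y u w A B) : Sep A (B ∪ {u, w}) := by
  rcases h with ⟨rfl, rfl⟩ | ⟨rfl, rfl⟩
  · refine sep_side (u := u) (w := w) (fun p hp => (mem_lft.1 hp).2) fun p hp => ?_
    simp only [Finset.mem_union, mem_lft, Finset.mem_insert, Finset.mem_singleton] at hp
    rcases hp with hp | hp
    · left; have := hp.2; rw [orient_swap] at this; linarith
    · exact Or.inr hp
  · refine sep_side (u := w) (w := u) (fun p hp => (mem_lft.1 hp).2) fun p hp => ?_
    simp only [Finset.mem_union, mem_lft, Finset.mem_insert, Finset.mem_singleton] at hp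
    rcases hp with hp | hp
    · left; have := hp.2; rw [orient_swap] at this; linarith
    · exact Or.inr (Or.symm hp)

theorem mono {Z : Finset Pt} (h : IsSides Y u w A B) (hZ : Z ⊆ Y) :
    IsSides Z u w (A ∩ Z) (B ∩ Z) := by
  have key : ∀ u w, lft Y u w ∩ Z = lft Z u w := by
    intro u w; ext p
    simp only [Finset.mem_inter, mem_lft]
    exact ⟨fun h => ⟨h.2, h.1.2⟩, fun h => ⟨⟨hZ h.1, h.2⟩, h.1⟩⟩
  rcases h with ⟨rfl, rfl⟩ | ⟨rfl, rfl⟩ <;> rw [key, key]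
  · exact Or.inl ⟨rfl, rfl⟩
  · exact Or.inr ⟨rfl, rfl⟩

theorem sum_add (h : IsSides Y u w A B) (hY : GP Y) (hu : u ∈ Y) (hw : w ∈ Y) (huw : u ≠ w)
    (f : Pt → ℤ) : ∑ p ∈ Y, f p = ∑ p ∈ A, f p + ∑ p ∈ B, f p + f u + f w := by
  have h1 : Y = (A ∪ B) ∪ {u, w} := by
    ext p
    simp only [Finset.mem_union, Finset.mem_insert, Finset.mem_singleton]
    constructor
    · intro hp; have := h.cases hY hu hw huw hp; tauto
    · rintro ((hp | hp) | rfl | rfl)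
      · exact h.subset hp
      · exact h.symm.subset hp
      · exact hu
      · exact hw
  have h2 : Disjoint A B := Finset.disjoint_left.2 fun p hp => h.disjoint hp
  have h3 : Disjoint (A ∪ B) {u, w} := by
    refine Finset.disjoint_left.2 fun p hp hp' => ?_
    simp only [Finset.mem_insert, Finset.mem_singleton] at hp'
    rcases Finset.mem_union.1 hp with hp | hp <;> rcases hp' with hp' | hp'
    · exact h.ne_left hp hp'
    · exact h.ne_right hp hp'
    · exact h.symm.ne_left hp hp'
    · exact h.symm.ne_right hp hp'
  conv_lhs => rw [h1]
  rw [Finset.sum_union h3, Finset.sum_union h2, Finset.sum_pair huw]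
  ring

end IsSides

theorem sum_sign_inter (A U : Finset Pt) :
    ∑ p ∈ A, (if p ∈ U then (1 : ℤ) else -1) = 2 * (A ∩ U).card - A.card := by
  have := sum_sign (Finset.inter_subset_left (s₁ := A) (s₂ := U))
  rw [← this]
  refine Finset.sum_congr rfl fun p hp => ?_
  simp [hp]

/-- If the only forbidden bichromatic edge is `a b`, then each side of the line `a b` is
balanced. -/
theorem balanced_side {S : Finset (Sym2 Pt)} {Y : Finset Pt} (hY : GP Y) (hbl : ¬ Unbl S Y)
    {w : Pt → ℤ} (hw : ∀ p ∈ Y, w p = 1 ∨ w p = -1) (h0 : ∑ p ∈ Y, w p = 0) {a b : Pt}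
    (ha : a ∈ Y) (hb : b ∈ Y) (hwa : w a = 1) (hwb : w b = -1)
    (hS : ∀ x ∈ Y, ∀ y ∈ Y, w x = 1 → w y = -1 → s(x, y) ∈ S → x = a ∧ y = b)
    {A B : Finset Pt} (hAB : IsSides Y a b A B) : ∑ p ∈ A, w p = 0 := by
  have hab : a ≠ b := by rintro rfl; omega
  have hsum := hAB.sum_add hY ha hb hab w
  suffices hL : ∑ p ∈ lft Y a b, w p = 0 by
    rcases hAB with ⟨rfl, rfl⟩ | ⟨rfl, rfl⟩ <;> omega
  clear hsum hAB A B
  have hAB := IsSides.mk Y a b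
  have hsum := hAB.sum_add hY ha hb hab w
  by_contra hne
  have hN := dist_sq_pos hab
  let ψ : Pt → ℝ := orient a b
  let t : Pt → ℝ := fun p => (b.1 - a.1) * (p.1 - a.1) + (b.2 - a.2) * (p.2 - a.2)
  let Z := Y \ {a, b}
  let κ : Pt → ℝ := fun p => -t p / ψ p
  let w' : Pt → ℤ := fun p => if 0 < ψ p then w p else -w p
  have hZ : ∀ p, p ∈ Z ↔ p ∈ Y ∧ p ≠ a ∧ p ≠ b := by
    intro p; simp [Z]
  have hψ : ∀ p ∈ Z, ψ p ≠ 0 := fun p hp => by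
    obtain ⟨h1, h2, h3⟩ := (hZ p).1 hp
    exact hY a ha b hb p h1 hab h2.symm h3.symm
  have hinj : Set.InjOn κ Z := by
    intro p hp q hq he
    have hp' := hψ p hp
    have hq' := hψ q hq
    obtain ⟨p1, p2, p3⟩ := (hZ p).1 hp
    obtain ⟨q1, q2, q3⟩ := (hZ q).1 hq
    by_contra hpq
    have h1 := hY a ha p p1 q q1 p2.symm q2.symm hpq
    simp only [κ] at he
    rw [div_eq_div_iff hp' hq'] at he
    have e : ((b.1 - a.1) ^ 2 + (b.2 - a.2) ^ 2) * orient a p q = t p * ψ q - t q * ψ p := by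
      simp only [t, ψ, orient]; ring
    have : ((b.1 - a.1) ^ 2 + (b.2 - a.2) ^ 2) * orient a p q = 0 := by rw [e]; linarith
    exact h1 ((mul_eq_zero.1 this).resolve_left hN.ne')
  have hLZ : (lft Y a b) = Z.filter fun p => 0 < ψ p := by
    ext p
    simp only [mem_lft, Finset.mem_filter, hZ]
    constructor
    · rintro ⟨h1, h2⟩
      refine ⟨⟨h1, ?_, ?_⟩, h2⟩ <;> rintro rfl <;> simp at h2
    · rintro ⟨h1, h2⟩; exact ⟨h1.1, h2⟩
  have hRZ : (lft Y b a) = Z.filter fun p => ¬ 0 < ψ p := by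
    ext p
    simp only [mem_lft, Finset.mem_filter, hZ]
    rw [orient_swap]
    constructor
    · rintro ⟨h1, h2⟩
      refine ⟨⟨h1, ?_, ?_⟩, not_lt.2 (by simp only [ψ]; linarith)⟩ <;> rintro rfl <;> simp at h2
    · rintro ⟨h1, h2⟩
      have h3 := hψ p ((hZ p).2 h1)
      exact ⟨h1.1, by have := lt_of_le_of_ne (not_lt.1 h2) h3; simp only [ψ] at this; linarith⟩
  have hw'sum : ∑ p ∈ Z, w' p = ∑ p ∈ lft Y a b, w p - ∑ p ∈ lft Y b a, w p := by
    rw [Finset.sum_ite, ← hLZ, ← hRZ, Finset.sum_neg_distrib]; ring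
  obtain ⟨c, hc1, hc2⟩ := exists_threshold (w := w') (F := -1 + ∑ p ∈ lft Y b a, w p) hinj
    (by
      intro p hp
      have := hw p ((hZ p).1 hp).1
      simp only [w']; split_ifs <;> omega)
    (by rw [hw'sum]; omega)
  let g : Pt → ℝ := fun p => t p + c * ψ p
  have hg : IsAff g := (isAff_linear _ _ a).add ((isAff_orient a b).smul c)
  have hga : g a = 0 := by simp [g, t, ψ]
  have hgb : 0 < g b := by simp only [g, t, ψ, orient_right]; nlinarith
  have hgpos : ∀ p ∈ Z, (0 < ψ p → (0 < g p ↔ κ p < c)) ∧ (¬ 0 < ψ p → (0 < g p ↔ ¬ κ p < c)) := by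
    intro p hp
    have h1 := hψ p hp
    have h2 := hc1 p hp
    simp only [κ, g] at h2 ⊢
    constructor
    · intro h
      rw [div_lt_iff₀ h]
      constructor <;> intro h <;> linarith
    · intro h
      have h3 := lt_of_le_of_ne (not_lt.1 h) h1
      rw [not_lt]
      constructor
      · intro h4
        rw [le_div_iff_of_neg h3]; linarith
      · intro h4
        have h5 := lt_of_le_of_ne h4 h2.symm
        rw [lt_div_iff_of_neg h3] at h5; linarith
  let H := Y.filter fun p => 0 < g p
  let G := Y.filter fun p => ¬ 0 < g p
  have hHG : ∑ p ∈ H, w p + ∑ p ∈ G, w p = 0 := by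
    rw [Finset.sum_filter_add_sum_filter_not, h0]
  have hH0 : ∑ p ∈ H, w p = 0 := by
    have h1 : ∑ p ∈ H, w p = w b + ∑ p ∈ Z with 0 < g p, w p := by
      have : H = insert b (Z.filter fun p => 0 < g p) := by
        ext p
        simp only [H, Finset.mem_filter, Finset.mem_insert, hZ]
        constructor
        · rintro ⟨h1, h2⟩
          by_cases hpb : p = b
          · exact Or.inl hpb
          · refine Or.inr ⟨⟨h1, ?_, hpb⟩, h2⟩
            rintro rfl; linarith
        · rintro (rfl | h)
          · exact ⟨hb, hgb⟩
          · exact ⟨h.1.1, h.2⟩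
      rw [this, Finset.sum_insert]
      simp [hZ]
    have h2 : ∑ p ∈ Z with 0 < g p, w p =
        ∑ p ∈ lft Y b a, w p + ∑ p ∈ Z with κ p < c, w' p := by
      rw [hRZ, Finset.sum_filter, Finset.sum_filter, Finset.sum_filter, ← Finset.sum_add_distrib]
      refine Finset.sum_congr rfl fun p hp => ?_
      obtain ⟨h3, h4⟩ := hgpos p hp
      by_cases h : 0 < ψ p
      · simp only [h3 h, w', h, if_true, not_true, if_false, zero_add]
      · simp only [h4 h, w', h, if_false, not_false_eq_true, if_true]
        by_cases h5 : κ p < c <;> simp [h5]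
    rw [h1, h2, hwb]; linarith
  have hcol : ∀ Z' ⊆ Y, (a ∉ Z' ∨ b ∉ Z') → ∑ p ∈ Z', w p = 0 → Unbl S Z' := by
    intro Z' hZ' hab' h0'
    refine unbl_of_colouring (hY.mono hZ') (fun p hp => hw p (hZ' hp)) h0' ?_
    intro x hx y hy hxy hS'
    rcases hw x (hZ' hx) with h1 | h1 <;> rcases hw y (hZ' hy) with h2 | h2
    · omega
    · obtain ⟨rfl, rfl⟩ := hS x (hZ' hx) y (hZ' hy) h1 h2 hS'
      tauto
    · obtain ⟨rfl, rfl⟩ := hS y (hZ' hy) x (hZ' hx) h2 h1 (by rwa [Sym2.eq_swap])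
      tauto
    · omega
  refine hbl ((hcol H (Finset.filter_subset _ _) (Or.inl ?_) hH0).of_sep
    (hcol G (Finset.filter_subset _ _) (Or.inr ?_) (by omega)) ?_ ?_)
  · simp [H, hga]
  · simp [G, hgb]
  · refine sep_lex hg (isAff_const (-1)) (fun p hp => Or.inl (Finset.mem_filter.1 hp).2)
      fun p hp => ?_
    have := (Finset.mem_filter.1 hp).2
    rcases (not_lt.1 this).lt_or_eq with h | h
    · exact Or.inl h
    · exact Or.inr ⟨h, by norm_num⟩
  · intro p
    simp only [H, G, Finset.mem_filter]
    tauto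

end PlaneMatching

namespace PlaneMatching

/-! ### Leaves of a tight configuration -/

variable {S : Finset (Sym2 Pt)} {Y : Finset Pt} {m : ℕ} {a b c v : Pt} {L R : Finset Pt}

/-- `a` has the single neighbour `v`. -/
def Leaf (S : Finset (Sym2 Pt)) (Y : Finset Pt) (a v : Pt) : Prop :=
  a ∈ Y ∧ v ∈ Y ∧ s(a, v) ∈ S ∧ ∀ q ∈ Y, s(a, q) ∈ S → q = v

/-- `b` has at least two neighbours. -/
def NonLeaf (S : Finset (Sym2 Pt)) (Y : Finset Pt) (b : Pt) : Prop :=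
  b ∈ Y ∧ ∃ q ∈ Y, ∃ q' ∈ Y, q ≠ q' ∧ s(b, q) ∈ S ∧ s(b, q') ∈ S

theorem NonLeaf.exists_ne (h : NonLeaf S Y b) (c : Pt) : ∃ q ∈ Y, q ≠ c ∧ s(b, q) ∈ S := by
  obtain ⟨-, q, hq, q', hq', hne, h1, h2⟩ := h
  by_cases hc : q = c
  · exact ⟨q', hq', fun h => hne (hc.trans h.symm), h2⟩
  · exact ⟨q, hq, hc, h1⟩

theorem NonLeaf.mem_core (h : NonLeaf S Y b) : b ∈ core S Y := by
  obtain ⟨hb, q, hq, -, -, -, h1, -⟩ := h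
  exact mem_core_left hb hq h1

theorem Leaf.mem_core (h : Leaf S Y a v) : a ∈ core S Y := mem_core_left h.1 h.2.1 h.2.2.1

theorem Leaf.mem_core_right (h : Leaf S Y a v) : v ∈ core S Y :=
  PlaneMatching.mem_core_right h.1 h.2.1 h.2.2.1

theorem Leaf.not_nonLeaf (h : Leaf S Y a v) : ¬ NonLeaf S Y a := fun h' => by
  obtain ⟨q, hq, hne, hS⟩ := h'.exists_ne v
  exact hne (h.2.2.2 q hq hS)

theorem leaf_or_nonLeaf {p : Pt} (hp : p ∈ core S Y) : (∃ v, Leaf S Y p v) ∨ NonLeaf S Y p := by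
  obtain ⟨hpY, q, hq, hS⟩ := mem_core.1 hp
  by_cases h : ∀ q' ∈ Y, s(p, q') ∈ S → q' = q
  · exact Or.inl ⟨q, hpY, hq, hS, h⟩
  · push Not at h
    obtain ⟨q', hq', hS', hne⟩ := h
    exact Or.inr ⟨hpY, q', hq', q, hq, hne, hS', hS⟩

theorem leaf_of_not_nonLeaf {p q : Pt} (hp : p ∈ Y) (hq : q ∈ Y) (hS : s(p, q) ∈ S)
    (h : ¬ NonLeaf S Y p) : Leaf S Y p q :=
  ⟨hp, hq, hS, fun q' hq' hS' => by
    by_contra hne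
    exact h ⟨hp, q', hq', q, hq, hne, hS', hS⟩⟩

/-- `1` on the core, `-1` elsewhere. -/
def cw (S : Finset (Sym2 Pt)) (Y : Finset Pt) (p : Pt) : ℤ := if p ∈ core S Y then 1 else -1

theorem cw_eq (S : Finset (Sym2 Pt)) (Y : Finset Pt) (p : Pt) :
    cw S Y p = 1 ∨ cw S Y p = -1 := by
  unfold cw; split_ifs <;> simp

theorem sum_cw (A : Finset Pt) :
    ∑ p ∈ A, cw S Y p = 2 * (A ∩ core S Y).card - A.card := sum_sign_inter A (core S Y)

theorem unbl_of_cw (hY : GP Y) {Z : Finset Pt} (hZ : Z ⊆ Y) (h0 : ∑ p ∈ Z, cw S Y p = 0) :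
    Unbl S Z := by
  refine unbl_of_colouring (hY.mono hZ) (fun p _ => cw_eq S Y p) h0 fun a ha b hb hab hS => hab ?_
  rw [cw, cw, if_pos (mem_core_left (hZ ha) (hZ hb) hS),
    if_pos (mem_core_right (hZ ha) (hZ hb) hS)]

theorem Tight.bal_leaf (h : Tight S Y m) (hl : Leaf S Y a v) (hs : IsSides Y a v L R) :
    2 * (L ∩ core S Y).card = L.card := by
  have hav := h.ne hl.2.2.1
  obtain ⟨-, hcore, -⟩ := h.connected
  let U := Y \ (core S Y).erase a
  have hUc : U.card = m := by
    have h1 := Finset.card_sdiff_add_card_eq_card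
      (s := (core S Y).erase a) (t := Y) ((Finset.erase_subset _ _).trans core_subset)
    rw [Finset.card_erase_of_mem hl.mem_core, hcore, h.card] at h1
    simp only [U]; omega
  have hU : ∀ p, p ∈ U ↔ p ∈ Y ∧ (p ∉ core S Y ∨ p = a) := by
    intro p; simp only [U, Finset.mem_sdiff, Finset.mem_erase]; tauto
  have key := balanced_side (w := fun p => if p ∈ U then 1 else -1) h.gp h.blocked
    (by intro p _; split_ifs <;> simp)
    (by rw [sum_sign Finset.sdiff_subset, hUc, h.card]; push_cast; ring) hl.1 hl.2.1
    (by simp [hU, hl.1]) (by simp [hU, hl.mem_core_right, hav.symm]) (by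
      intro x hx y hy hwx hwy hS
      have hxU : x ∈ U := by by_contra h; simp [h] at hwx
      have hxa : x = a :=
        ((hU x).1 hxU).2.resolve_left (not_not.2 (mem_core_left hx hy hS))
      subst hxa
      exact ⟨rfl, hl.2.2.2 y hy hS⟩) hs
  rw [sum_sign_inter] at key
  have h1 : L ∩ U = L \ (L ∩ core S Y) := by
    ext p
    simp only [Finset.mem_inter, hU, Finset.mem_sdiff]
    constructor
    · rintro ⟨h1, h2, h3⟩
      have := hs.ne_left h1
      tauto
    · rintro ⟨h1, h2⟩
      exact ⟨h1, hs.subset h1, by tauto⟩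
  have h2 := Finset.card_sdiff_add_card_eq_card (Finset.inter_subset_left (s₁ := L) (s₂ := core S Y))
  rw [h1] at key
  omega

theorem IsSides.mem_union (hs : IsSides Y a v L R) (hY : GP Y) (ha : a ∈ Y) (hv : v ∈ Y)
    (hav : a ≠ v) (p : Pt) : p ∈ Y ↔ p ∈ L ∨ p ∈ R ∨ p = a ∨ p = v := by
  constructor
  · exact hs.cases hY ha hv hav
  · rintro (h | h | rfl | rfl)
    · exact hs.subset h
    · exact hs.symm.subset h
    · exact ha
    · exact hv

theorem IsSides.union_subset (hs : IsSides Y a v L R) (ha : a ∈ Y) (hv : v ∈ Y) :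
    L ∪ {a, v} ⊆ Y := by
  intro p hp
  simp only [Finset.mem_union, Finset.mem_insert, Finset.mem_singleton] at hp
  rcases hp with hp | rfl | rfl
  · exact hs.subset hp
  · exact ha
  · exact hv

theorem IsSides.card_union (hs : IsSides Y a v L R) (hav : a ≠ v) :
    (L ∪ {a, v}).card = L.card + 2 := by
  rw [Finset.card_union_of_disjoint, Finset.card_pair hav]
  refine Finset.disjoint_left.2 fun p hp hp' => ?_
  simp only [Finset.mem_insert, Finset.mem_singleton] at hp'
  rcases hp' with h | h
  · exact hs.ne_left hp h
  · exact hs.ne_right hp h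

theorem Tight.leaf_split (h : Tight S Y m) (hl : Leaf S Y a v) (hs : IsSides Y a v L R) :
    Tight S (L ∪ {a, v}) ((L ∩ core S Y).card + 1) ∧ ∀ x ∈ L, ∀ y ∈ R, s(x, y) ∉ S := by
  have hav := h.ne hl.2.2.1
  obtain ⟨he, hcore, -⟩ := h.connected
  have hbal := h.bal_leaf hl hs
  have hbal' := h.bal_leaf hl hs.symm
  have hcY := h.card
  have hblk : ∀ {L R : Finset Pt}, IsSides Y a v L R → ¬ Unbl S (L ∪ {a, v}) := by
    intro L R hs hu
    have hR := unbl_of_cw (S := S) h.gp hs.symm.subset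
      (by rw [sum_cw]; have := h.bal_leaf hl hs.symm; omega)
    refine h.blocked (hR.of_sep hu hs.symm.sep fun p => ?_)
    rw [hs.mem_union h.gp hl.1 hl.2.1 hav]
    simp only [Finset.mem_union, Finset.mem_insert, Finset.mem_singleton]
    tauto
  have hin : ∀ {L R : Finset Pt}, IsSides Y a v L R →
      (L ∩ core S Y).card + 1 ≤ (inner S (L ∪ {a, v})).card := by
    intro L R hs
    by_contra hlt
    refine hblk hs (unbl_of_card_inner_lt (m := (L ∩ core S Y).card + 1)
      (h.gp.mono (hs.union_subset hl.1 hl.2.1)) ?_ (Or.inr (not_le.1 hlt)))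
    rw [hs.card_union hav, ← h.bal_leaf hl hs]; ring
  have hsum : L.card + R.card + 2 = 2 * m := by
    have h1 := hs.sum_add h.gp hl.1 hl.2.1 hav (fun _ => (1 : ℤ))
    simp at h1
    omega
  have hinter : inner S (L ∪ {a, v}) ∩ inner S (R ∪ {a, v}) ⊆ {s(a, v)} := by
    intro e he
    induction e using Sym2.ind with
    | _ x y =>
    obtain ⟨h1, h2⟩ := Finset.mem_inter.1 he
    obtain ⟨hS, h3, h4⟩ := mem_inner.1 h1
    obtain ⟨-, h5, h6⟩ := mem_inner.1 h2
    have hxy := h.ne hS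
    simp only [Finset.mem_union, Finset.mem_insert, Finset.mem_singleton] at h3 h4 h5 h6
    have key : ∀ p, (p ∈ L ∨ p = a ∨ p = v) → (p ∈ R ∨ p = a ∨ p = v) → p = a ∨ p = v := by
      rintro p (hp | hp) (hp' | hp')
      · exact absurd hp' (hs.disjoint hp)
      all_goals assumption
    rw [Finset.mem_singleton]
    rcases key x h3 h5 with rfl | rfl <;> rcases key y h4 h6 with rfl | rfl
    · exact absurd rfl hxy
    · rfl
    · exact Sym2.eq_swap
    · exact absurd rfl hxy
  have hunion : inner S (L ∪ {a, v}) ∪ inner S (R ∪ {a, v}) ⊆ inner S Y :=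
    Finset.union_subset (inner_mono (hs.union_subset hl.1 hl.2.1))
      (inner_mono (hs.symm.union_subset hl.1 hl.2.1))
  have h1 := Finset.card_union_add_card_inter (inner S (L ∪ {a, v})) (inner S (R ∪ {a, v}))
  have h2 := Finset.card_le_card hunion
  have h3 := Finset.card_le_card hinter
  rw [Finset.card_singleton] at h3
  have h4 := hin hs
  have h5 := hin hs.symm
  refine ⟨⟨h.gp.mono (hs.union_subset hl.1 hl.2.1), ?_, by omega, hblk hs, by omega, h.loopless⟩, ?_⟩
  · rw [hs.card_union hav]; omega
  · intro x hx y hy hS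
    have heq := Finset.eq_of_subset_of_card_le hunion (by omega)
    have : s(x, y) ∈ inner S Y := mem_inner.2 ⟨hS, hs.subset hx, hs.symm.subset hy⟩
    rw [← heq, Finset.mem_union] at this
    have out : ∀ {L R : Finset Pt}, IsSides Y a v L R → ∀ p ∈ R, p ∉ L ∪ {a, v} := by
      intro L R hs p hp hp'
      simp only [Finset.mem_union, Finset.mem_insert, Finset.mem_singleton] at hp'
      rcases hp' with h | h | h
      · exact hs.disjoint h hp
      · exact hs.symm.ne_left hp h
      · exact hs.symm.ne_right hp h
    rcases this with h | h
    · exact out hs y hy (mem_inner.1 h).2.2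
    · exact out hs.symm x hx (mem_inner.1 h).2.1

theorem Tight.exists_leaf (h : Tight S Y m) : ∃ a v, Leaf S Y a v := by
  by_contra hcon
  push Not at hcon
  obtain ⟨he, hcore, -⟩ := h.connected
  have := Finset.card_mul_le_card_mul (s := core S Y) (t := inner S Y) (m := 2) (n := 2)
    (fun p e => p ∈ e) (by
      intro p hp
      rcases leaf_or_nonLeaf hp with ⟨v, hv⟩ | hn
      · exact absurd hv (hcon p v)
      · obtain ⟨hpY, q, hq, q', hq', hne, h1, h2⟩ := hn
        have hne' : s(p, q) ≠ s(p, q') := fun h => hne (Sym2.congr_right.1 h)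
        rw [← Finset.card_pair hne']
        refine Finset.card_le_card fun e he => ?_
        simp only [Finset.mem_insert, Finset.mem_singleton] at he
        rw [Finset.mem_bipartiteAbove]
        rcases he with rfl | rfl
        · exact ⟨mem_inner.2 ⟨h1, hpY, hq⟩, by simp⟩
        · exact ⟨mem_inner.2 ⟨h2, hpY, hq'⟩, by simp⟩) (by
      intro e _
      induction e using Sym2.ind with
      | _ x y =>
      refine (Finset.card_le_card (t := {x, y}) fun p hp => ?_).trans Finset.card_le_two
      rw [Finset.mem_bipartiteBelow] at hp
      simpa using hp.2)
  omega

theorem Tight.closed (h : Tight S Y m) {U : Finset Pt} (hU : U ⊆ core S Y)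
    (hcl : ∀ x ∈ U, ∀ y ∈ Y, s(x, y) ∈ S → y ∈ U) {z : Pt} (hz : z ∈ core S Y) (hzU : z ∉ U) :
    U = ∅ := by
  by_contra hne
  obtain ⟨x, hx, y, hy, hyU, hS⟩ := h.connected.2.2 U hU (Finset.nonempty_iff_ne_empty.2 hne)
    (by rintro rfl; exact hzU hz)
  exact hyU (hcl x hx y (core_subset hy) hS)

theorem hedge_of_isSides (hY : GP Y) (hb : b ∈ Y) (hc : c ∈ Y) (hbc : b ≠ c)
    (hs : IsSides Y b c L ∅) : HEdge Y b c := by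
  have h1 : ∀ p ∈ Y, p ≠ b → p ≠ c → p ∈ L := by
    intro p hp hpb hpc
    rcases hs.cases hY hb hc hbc hp with h | h | h | h
    · exact h
    · simp at h
    · exact absurd h hpb
    · exact absurd h hpc
  rcases hs with ⟨rfl, -⟩ | ⟨rfl, -⟩
  · exact Or.inl ⟨hb, hc, hbc, fun p hp h2 h3 => (mem_lft.1 (h1 p hp h2 h3)).2⟩
  · exact Or.inr ⟨hc, hb, hbc.symm, fun p hp h2 h3 => (mem_lft.1 (h1 p hp h3 h2)).2⟩

theorem HEdge.isSides (h : HEdge Y b c) (hs : IsSides Y b c L R) : L = ∅ ∨ R = ∅ := by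
  have key : ∀ {x y : Pt}, HE Y x y → lft Y y x = ∅ := by
    intro x y hxy
    refine Finset.eq_empty_of_forall_notMem fun p hp => ?_
    obtain ⟨h1, h2⟩ := mem_lft.1 hp
    have hx : p ≠ x := by rintro rfl; simp at h2
    have hy : p ≠ y := by rintro rfl; simp at h2
    have := hxy.2.2.2 p h1 hx hy
    rw [orient_swap] at h2; linarith
  rcases h with h | h <;> rcases hs with ⟨rfl, rfl⟩ | ⟨rfl, rfl⟩ <;> simp [key h]

theorem Tight.nonLeaf_sides (h : Tight S Y m) (hb : NonLeaf S Y b) (hc : NonLeaf S Y c)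
    (hS : s(b, c) ∈ S) {K : Finset Pt} (hbK : b ∈ K) (hcK : c ∉ K)
    (hcut : ∀ x ∈ Y, ∀ y ∈ Y, x ∈ K → y ∉ K → s(x, y) ∈ S → x = b ∧ y = c) :
    3 ≤ m ∧ ∃ L R, IsSides Y b c L R ∧ R ⊆ core S Y ∧ 2 * (R ∩ K).card = R.card := by
  obtain ⟨-, hcore, -⟩ := h.connected
  have hC1 : 2 ≤ (core S Y ∩ K).card := by
    obtain ⟨q, hq, hqc, hbq⟩ := hb.exists_ne c
    have hqK : q ∈ K := by
      by_contra hqK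
      exact hqc (hcut b hb.1 q hq hbK hqK hbq).2
    rw [← Finset.card_pair (h.ne hbq)]
    refine Finset.card_le_card fun p hp => ?_
    simp only [Finset.mem_insert, Finset.mem_singleton] at hp
    rw [Finset.mem_inter]
    rcases hp with rfl | rfl
    · exact ⟨hb.mem_core, hbK⟩
    · exact ⟨mem_core_right hb.1 hq hbq, hqK⟩
  have hC2 : 2 ≤ (core S Y \ K).card := by
    obtain ⟨q, hq, hqb, hcq⟩ := hc.exists_ne b
    have hqK : q ∉ K := by
      intro hqK
      exact hqb (hcut q hq c hc.1 hqK hcK (by rwa [Sym2.eq_swap])).1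
    rw [← Finset.card_pair (h.ne hcq)]
    refine Finset.card_le_card fun p hp => ?_
    simp only [Finset.mem_insert, Finset.mem_singleton] at hp
    rw [Finset.mem_sdiff]
    rcases hp with rfl | rfl
    · exact ⟨hc.mem_core, hcK⟩
    · exact ⟨mem_core_right hc.1 hq hcq, hqK⟩
  have hC := Finset.card_inter_add_card_sdiff (core S Y) K
  have hD := Finset.card_sdiff_add_card_eq_card (core_subset (S := S) (Y := Y))
  rw [h.card] at hD
  have hDi : ∀ p ∈ Y \ core S Y, p ∉ core S Y := fun p hp => (Finset.mem_sdiff.1 hp).2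
  have key : ∀ D1 ⊆ Y \ core S Y, D1.card + 1 = (core S Y \ K).card → ∀ L R,
      IsSides Y b c L R → 2 * ((L ∩ (core S Y ∩ K)).card + (L ∩ D1).card) = L.card := by
    intro D1 hD1 hD1c L R hs
    let U := (core S Y ∩ K) ∪ D1
    have hdisj : Disjoint (core S Y ∩ K) D1 := Finset.disjoint_left.2 fun p hp hp' =>
      hDi p (hD1 hp') (Finset.mem_inter.1 hp).1
    have hUY : U ⊆ Y := Finset.union_subset (Finset.inter_subset_left.trans core_subset)
      (hD1.trans Finset.sdiff_subset)
    have hUc : U.card = m := by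
      simp only [U]; rw [Finset.card_union_of_disjoint hdisj]; omega
    have hcU : c ∉ U := by
      simp only [U, Finset.mem_union, Finset.mem_inter, not_or]
      exact ⟨fun h => hcK h.2, fun h => hDi c (hD1 h) hc.mem_core⟩
    have hUcore : ∀ p ∈ core S Y, p ∈ U ↔ p ∈ K := by
      intro p hp
      simp only [U, Finset.mem_union, Finset.mem_inter]
      have := fun h => hDi p (hD1 h)
      tauto
    have hbU : b ∈ U := (hUcore b hb.mem_core).2 hbK
    have hbal := balanced_side (w := fun p => if p ∈ U then 1 else -1) h.gp h.blocked
      (by intro p _; split_ifs <;> simp)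
      (by rw [sum_sign hUY, hUc, h.card]; push_cast; ring) hb.1 hc.1
      (by simp [hbU]) (by simp [hcU]) (by
        intro x hx y hy hwx hwy hS
        have hxU : x ∈ U := by by_contra h; simp [h] at hwx
        have hyU : y ∉ U := by intro h; simp [h] at hwy
        rw [hUcore x (mem_core_left hx hy hS)] at hxU
        rw [hUcore y (mem_core_right hx hy hS)] at hyU
        exact hcut x hx y hy hxU hyU hS) hs
    rw [sum_sign_inter, Finset.inter_union_distrib_left, Finset.card_union_of_disjoint
      (hdisj.mono Finset.inter_subset_right Finset.inter_subset_right)] at hbal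
    push_cast at hbal
    omega
  refine ⟨by omega, ?_⟩
  have hs := IsSides.mk Y b c
  set L0 := lft Y b c
  set R0 := lft Y c b
  have hno : (∀ p ∈ L0, p ∈ core S Y) ∨ ∀ p ∈ R0, p ∈ core S Y := by
    by_contra hcon
    push Not at hcon
    obtain ⟨⟨d, hd, hdc⟩, d', hd', hdc'⟩ := hcon
    have hdD : d ∈ Y \ core S Y := Finset.mem_sdiff.2 ⟨hs.subset hd, hdc⟩
    have hdD' : d' ∈ Y \ core S Y := Finset.mem_sdiff.2 ⟨hs.symm.subset hd', hdc'⟩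
    have hdd : d ≠ d' := by rintro rfl; exact hs.disjoint hd hd'
    obtain ⟨D1, h1, h2, h3⟩ := Finset.exists_subsuperset_card_eq
      (s := {d}) (t := (Y \ core S Y).erase d') (n := (core S Y \ K).card - 1)
      (by simp only [Finset.singleton_subset_iff, Finset.mem_erase]; exact ⟨hdd, hdD⟩)
      (by simp; omega) (by rw [Finset.card_erase_of_mem hdD']; omega)
    have hdm : d ∈ D1 := h1 (by simp)
    have hdn : d' ∉ D1 := fun h => by simpa using h2 h
    have hsub : D1 ⊆ Y \ core S Y := h2.trans (Finset.erase_subset _ _)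
    have e1 := key D1 hsub (by omega) _ _ hs
    have e2 := key (insert d' (D1.erase d))
      (by
        intro p hp
        rcases Finset.mem_insert.1 hp with rfl | hp
        · exact hdD'
        · exact hsub (Finset.mem_of_mem_erase hp)) (by
        rw [Finset.card_insert_of_notMem (by simp [hdn]), Finset.card_erase_of_mem hdm]
        omega) _ _ hs
    have e3 : L0 ∩ insert d' (D1.erase d) = (L0 ∩ D1).erase d := by
      ext p
      simp only [Finset.mem_inter, Finset.mem_insert, Finset.mem_erase]
      constructor
      · rintro ⟨h4, rfl | h5⟩
        · exact absurd hd' (hs.disjoint h4)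
        · tauto
      · tauto
    have hm : d ∈ L0 ∩ D1 := Finset.mem_inter.2 ⟨hd, hdm⟩
    rw [e3, Finset.card_erase_of_mem hm] at e2
    have := Finset.card_pos.2 ⟨d, hm⟩
    omega
  have fin : ∀ L R, IsSides Y b c L R → (∀ p ∈ R, p ∈ core S Y) → 2 * (R ∩ K).card = R.card := by
    intro L R hs hR
    obtain ⟨D1, h2, h3⟩ := Finset.exists_subset_card_eq
      (s := Y \ core S Y) (n := (core S Y \ K).card - 1) (by omega)
    have e := key D1 h2 (by omega) _ _ hs.symm
    have e1 : R ∩ D1 = ∅ := Finset.eq_empty_of_forall_notMem fun p hp => by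
      obtain ⟨hp1, hp2⟩ := Finset.mem_inter.1 hp
      exact hDi p (h2 hp2) (hR p hp1)
    have e2 : R ∩ (core S Y ∩ K) = R ∩ K := by
      ext p
      simp only [Finset.mem_inter]
      have := hR p
      tauto
    rw [e1, e2] at e
    simpa using e
  rcases hno with h1 | h1
  · exact ⟨R0, L0, hs.symm, h1, fin _ _ hs.symm h1⟩
  · exact ⟨L0, R0, hs, h1, fin _ _ hs h1⟩

end PlaneMatching

namespace PlaneMatching

variable {S : Finset (Sym2 Pt)} {Y : Finset Pt} {m : ℕ} {a b c v : Pt} {L R : Finset Pt}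

theorem mem_union_pair {A : Finset Pt} {p : Pt} : p ∈ A ∪ {a, v} ↔ p ∈ A ∨ p = a ∨ p = v := by
  simp; tauto

/-- Neighbours of a point on one side of a leaf edge stay on that side. -/
theorem Tight.nbr_side (h : Tight S Y m) (hl : Leaf S Y a v) (hs : IsSides Y a v L R) {x y : Pt}
    (hx : x ∈ L) (hy : y ∈ Y) (hS : s(x, y) ∈ S) : y ∈ L ∨ y = v := by
  rcases hs.cases h.gp hl.1 hl.2.1 (h.ne hl.2.2.1) hy with h1 | h1 | h1 | h1
  · exact Or.inl h1
  · exact absurd hS ((h.leaf_split hl hs).2 x hx y h1)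
  · subst h1
    exact absurd (hl.2.2.2 x (hs.subset hx) (by rwa [Sym2.eq_swap])) (hs.ne_right hx)
  · exact Or.inr h1

/-- Deleting a leaf and a hull neighbour outside the core. -/
theorem Tight.remove (h : Tight S Y m) (hm : 2 ≤ m) (hl : Leaf S Y a v) {x : Pt}
    (hx : HEdge Y a x) (hxc : x ∉ core S Y) :
    Tight S (Y \ {a, x}) (m - 1) ∧ core S (Y \ {a, x}) = (core S Y).erase a := by
  have hax := hx.ne
  have hxv : x ≠ v := by rintro rfl; exact hxc hl.mem_core_right
  have hS : s(a, x) ∉ S := fun h' => hxv (hl.2.2.2 x hx.mem_right h')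
  have hcard := card_sdiff_pair hx.mem_left hx.mem_right hax
  obtain ⟨he, hcore, -⟩ := h.connected
  have hmem : s(a, v) ∈ inner S Y := mem_inner.2 ⟨hl.2.2.1, hl.1, hl.2.1⟩
  have hsub : inner S (Y \ {a, x}) ⊆ (inner S Y).erase s(a, v) := by
    intro e he
    refine Finset.mem_erase.2 ⟨?_, inner_mono Finset.sdiff_subset he⟩
    rintro rfl
    have := (mem_inner.1 he).2.1
    simp at this
  have hle := Finset.card_le_card hsub
  rw [Finset.card_erase_of_mem hmem] at hle
  have hT : Tight S (Y \ {a, x}) (m - 1) :=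
    ⟨h.gp.mono Finset.sdiff_subset, by rw [h.card] at hcard; omega, by omega,
      fun hu => h.blocked (hx.unbl hS hu), by omega, h.loopless⟩
  refine ⟨hT, Finset.eq_of_subset_of_card_le (fun p hp => ?_) ?_⟩
  · have := core_subset hp
    refine Finset.mem_erase.2 ⟨?_, core_mono Finset.sdiff_subset hp⟩
    rintro rfl; simp at this
  · rw [Finset.card_erase_of_mem hl.mem_core, hcore, hT.connected.2.1]; omega

/-- The hull neighbours of a leaf that is joined to its parent by a hull edge. -/
theorem Tight.exists_hull_nbr (h : Tight S Y m) (hm : 2 ≤ m) (hl : Leaf S Y a v)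
    (he : HEdge Y a v) : ∃ x, HEdge Y a x ∧ x ≠ v ∧ x ∉ core S Y := by
  have hc := h.card
  obtain ⟨x, hx, hxv⟩ : ∃ x, HEdge Y a x ∧ x ≠ v := by
    rcases he with he | he
    · obtain ⟨x, hx⟩ := he.left_HV.exists_HE_right h.gp (by omega)
      refine ⟨x, Or.inr hx, ?_⟩
      rintro rfl
      exact he.not_symm (by omega) hx
    · obtain ⟨x, hx⟩ := he.right_HV.exists_HE_left h.gp (by omega)
      refine ⟨x, Or.inl hx, ?_⟩
      rintro rfl
      exact he.not_symm (by omega) hx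
  refine ⟨x, hx, hxv, fun hxc => ?_⟩
  have hS : s(a, x) ∉ S := fun h' => hxv (hl.2.2.2 x hx.mem_right h')
  exact h.blocked (hx.unbl hS
    (unbl_sdiff_pair h.gp h.card h.le hx.ne hS hl.mem_core hxc))

/-- An edge of a tight configuration between two non-leaves is a hull edge. -/
theorem Tight.hedge_of_nonLeaf (h : Tight S Y m) (hb : NonLeaf S Y b) (hc : NonLeaf S Y c)
    (hS : s(b, c) ∈ S) : HEdge Y b c := by
  induction hn : Y.card using Nat.strong_induction_on generalizing Y m with
  | _ n ih =>
  have hbc := h.ne hS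
  obtain ⟨K, hbK, hcK, hcut⟩ := h.exists_cut hb.1 hc.1 hS
  obtain ⟨hm3, L, R, hs, hRc, hR⟩ := h.nonLeaf_sides hb hc hS hbK hcK hcut
  suffices hRe : R = ∅ by subst hRe; exact hedge_of_isSides h.gp hb.1 hc.1 hbc hs
  obtain ⟨a, v, hl⟩ := h.exists_leaf
  have hav := h.ne hl.2.2.1
  have hab : a ≠ b := by rintro rfl; exact hl.not_nonLeaf hb
  have hac : a ≠ c := by rintro rfl; exact hl.not_nonLeaf hc
  have hcard := h.card
  -- both points on one side of the leaf edge
  have side : ∀ A B, IsSides Y a v A B → (b ∈ A ∨ b = v) → (c ∈ A ∨ c = v) → B.Nonempty →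
      R = ∅ := by
    intro A B hAB hbA hcA hB
    have hT := (h.leaf_split hl hAB).1
    have hsub := hAB.union_subset hl.1 hl.2.1
    have up : ∀ p q, p ∈ A ∨ p = v → q ∈ A ∨ q = v → p ≠ q → s(p, q) ∈ S → NonLeaf S Y p →
        NonLeaf S (A ∪ {a, v}) p := by
      rintro p q (hp | rfl) hq hpq hSpq hn
      · obtain ⟨r, hr, hrq, hpr⟩ := hn.exists_ne q
        have hr' := h.nbr_side hl hAB hp hr hpr
        exact ⟨mem_union_pair.2 (Or.inl hp), q, mem_union_pair.2 (by tauto), r,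
          mem_union_pair.2 (by tauto), hrq.symm, hSpq, hpr⟩
      · have hqA : q ∈ A := hq.resolve_right hpq.symm
        refine ⟨mem_union_pair.2 (by tauto), q, mem_union_pair.2 (by tauto), a,
          mem_union_pair.2 (by tauto), hAB.ne_left hqA, hSpq, ?_⟩
        rw [Sym2.eq_swap]; exact hl.2.2.1
    have hlt : (A ∪ {a, v}).card < n := by
      rw [← hn]
      refine Finset.card_lt_card ⟨hsub, fun hsup => ?_⟩
      obtain ⟨x, hx⟩ := hB
      rcases mem_union_pair.1 (hsup (hAB.symm.subset hx)) with h1 | h1 | h1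
      · exact hAB.disjoint h1 hx
      · exact hAB.symm.ne_left hx h1
      · exact hAB.symm.ne_right hx h1
    have hE := ih _ hlt hT (up b c hbA hcA hbc hS hb)
      (up c b hcA hbA hbc.symm (by rwa [Sym2.eq_swap]) hc) rfl
    have hAne : 0 < A.card := by
      refine Finset.card_pos.2 ?_
      rcases hbA with h1 | rfl
      · exact ⟨b, h1⟩
      · exact ⟨c, hcA.resolve_right hbc.symm⟩
    have hbal := h.bal_leaf hl hAB
    obtain ⟨d, hdA, hdc⟩ : ∃ d ∈ A, d ∉ core S Y := by
      by_contra hcon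
      push Not at hcon
      rw [Finset.inter_eq_left.2 hcon] at hbal
      omega
    have hdL : d ∈ L := by
      rcases hs.cases h.gp hb.1 hc.1 hbc (hAB.subset hdA) with h1 | h1 | rfl | rfl
      · exact h1
      · exact absurd (hRc h1) hdc
      · exact absurd hb.mem_core hdc
      · exact absurd hc.mem_core hdc
    have hR0 : R ∩ (A ∪ {a, v}) = ∅ := by
      refine (hE.isSides (hs.mono hsub)).resolve_left fun h0 => ?_
      have : d ∈ L ∩ (A ∪ {a, v}) := Finset.mem_inter.2 ⟨hdL, by simp [hdA]⟩
      rw [h0] at this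
      simp at this
    have hRB : ∀ p ∈ R, p ∈ B := by
      intro p hp
      have : p ∉ A ∪ {a, v} := fun h1 => by
        have := Finset.mem_inter.2 ⟨hp, h1⟩
        rw [hR0] at this; simp at this
      rw [mem_union_pair] at this
      have := hAB.cases h.gp hl.1 hl.2.1 hav (hs.symm.subset hp)
      tauto
    have hbB : b ∉ B := by
      rcases hbA with h1 | rfl
      · exact hAB.disjoint h1
      · exact fun h1 => hAB.symm.ne_right h1 rfl
    have hcB : c ∉ B := by
      rcases hcA with h1 | rfl
      · exact hAB.disjoint h1
      · exact fun h1 => hAB.symm.ne_right h1 rfl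
    by_cases hvK : v ∈ K
    · have hW : ((core S Y ∩ B) \ K) = ∅ := by
        refine h.closed (Finset.sdiff_subset.trans Finset.inter_subset_left) ?_ hb.mem_core
          (by simp [hbK])
        intro x hx y hy hxy
        simp only [Finset.mem_sdiff, Finset.mem_inter] at hx ⊢
        rcases h.nbr_side hl hAB.symm hx.1.2 hy hxy with h1 | h1
        · refine ⟨⟨mem_core_right (core_subset hx.1.1) hy hxy, h1⟩, fun hyK => ?_⟩
          have := hcut y hy x (core_subset hx.1.1) hyK hx.2 (by rwa [Sym2.eq_swap])
          exact hbB (this.1 ▸ h1)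
        · subst h1
          have := hcut y hy x (core_subset hx.1.1) hvK hx.2 (by rwa [Sym2.eq_swap])
          exact absurd (this.2 ▸ hx.1.2) hcB
      have : R ∩ K = R := by
        refine Finset.inter_eq_left.2 fun p hp => ?_
        by_contra hpK
        have : p ∈ ((core S Y ∩ B) \ K) := by simp [hRc hp, hRB p hp, hpK]
        rw [hW] at this; simp at this
      rw [this] at hR
      exact Finset.card_eq_zero.1 (by omega)
    · have hW : ((core S Y ∩ B) ∩ K) = ∅ := by
        refine h.closed (Finset.inter_subset_left.trans Finset.inter_subset_left) ?_ hc.mem_core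
          (by simp [hcK])
        intro x hx y hy hxy
        simp only [Finset.mem_inter] at hx ⊢
        rcases h.nbr_side hl hAB.symm hx.1.2 hy hxy with h1 | h1
        · refine ⟨⟨mem_core_right (core_subset hx.1.1) hy hxy, h1⟩, ?_⟩
          by_contra hyK
          have := hcut x (core_subset hx.1.1) y hy hx.2 hyK hxy
          exact hcB (this.2 ▸ h1)
        · subst h1
          have := hcut x (core_subset hx.1.1) y hy hx.2 hvK hxy
          exact absurd (this.1 ▸ hx.1.2) hbB
      have : R ∩ K = ∅ := by
        refine Finset.eq_empty_of_forall_notMem fun p hp => ?_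
        have hpR := Finset.mem_inter.1 hp
        have : p ∈ ((core S Y ∩ B) ∩ K) := by simp [hRc hpR.1, hRB p hpR.1, hpR.2]
        rw [hW] at this; simp at this
      rw [this] at hR
      exact Finset.card_eq_zero.1 (by simpa using hR.symm)
  have side' : ∀ A B, IsSides Y a v A B → A.Nonempty → B.Nonempty → R = ∅ := by
    intro A B hAB hA hB
    have hbi := hAB.cases h.gp hl.1 hl.2.1 hav hb.1
    have hSc : s(c, b) ∈ S := by rwa [Sym2.eq_swap]
    rcases hbi with h1 | h1 | h1 | h1
    · exact side A B hAB (Or.inl h1) (h.nbr_side hl hAB h1 hc.1 hS) hB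
    · exact side B A hAB.symm (Or.inl h1) (h.nbr_side hl hAB.symm h1 hc.1 hS) hA
    · exact absurd h1.symm hab
    · rcases hAB.cases h.gp hl.1 hl.2.1 hav hc.1 with h2 | h2 | h2 | h2
      · exact side A B hAB (Or.inr h1) (Or.inl h2) hB
      · exact side B A hAB.symm (Or.inr h1) (Or.inl h2) hA
      · exact absurd h2.symm hac
      · exact absurd (h1.trans h2.symm) hbc
  have hAB := IsSides.mk Y a v
  have hE : R = ∅ ∨ HEdge Y a v := by
    rcases (lft Y a v).eq_empty_or_nonempty with h1 | h1
    · rw [h1] at hAB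
      exact Or.inr (hedge_of_isSides h.gp hl.1 hl.2.1 hav hAB.symm)
    rcases (lft Y v a).eq_empty_or_nonempty with h2 | h2
    · rw [h2] at hAB
      exact Or.inr (hedge_of_isSides h.gp hl.1 hl.2.1 hav hAB)
    exact Or.inl (side' _ _ hAB h1 h2)
  rcases hE with hE | hE
  · exact hE
  obtain ⟨x, hx, hxv, hxc⟩ := h.exists_hull_nbr (by omega) hl hE
  obtain ⟨hT, hcore'⟩ := h.remove (by omega) hl hx hxc
  have hY' : ∀ p, p ∈ core S Y → p ≠ a → p ∈ Y \ {a, x} := by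
    intro p hp hpa
    have : p ≠ x := by rintro rfl; exact hxc hp
    simp [core_subset hp, hpa, this]
  have hb' := hY' b hb.mem_core hab.symm
  have hc' := hY' c hc.mem_core hac.symm
  have hs' := hs.mono (Finset.sdiff_subset (s := Y) (t := {a, x}))
  have fin : R ∩ (Y \ {a, x}) = ∅ → R = ∅ := by
    intro h0
    have : R ⊆ {a} := by
      intro p hp
      by_contra hpa
      have : p ∈ R ∩ (Y \ {a, x}) := Finset.mem_inter.2 ⟨hp, hY' p (hRc hp) (by simpa using hpa)⟩
      rw [h0] at this; simp at this
    have := Finset.card_le_card this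
    rw [Finset.card_singleton] at this
    exact Finset.card_eq_zero.1 (by omega)
  have leaf : ∀ p q, IsSides (Y \ {a, x}) p q (L ∩ (Y \ {a, x})) (R ∩ (Y \ {a, x})) →
      Leaf S (Y \ {a, x}) p q → R = ∅ := by
    intro p q hs' hl'
    have h1 := hT.bal_leaf hl' hs'.symm
    have : (R ∩ (Y \ {a, x})) ∩ core S (Y \ {a, x}) = R ∩ (Y \ {a, x}) := by
      refine Finset.inter_eq_left.2 fun p hp => ?_
      obtain ⟨h2, h3⟩ := Finset.mem_inter.1 hp
      rw [hcore', Finset.mem_erase]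
      refine ⟨?_, hRc h2⟩
      rintro rfl; simp at h3
    rw [this] at h1
    exact fin (Finset.card_eq_zero.1 (by omega))
  by_cases hbn : NonLeaf S (Y \ {a, x}) b
  swap
  · exact leaf b c hs' (leaf_of_not_nonLeaf hb' hc' hS hbn)
  by_cases hcn : NonLeaf S (Y \ {a, x}) c
  swap
  · exact leaf c b hs'.swap (leaf_of_not_nonLeaf hc' hb' (by rwa [Sym2.eq_swap]) hcn)
  have hlt : (Y \ {a, x}).card < n := by
    have := card_sdiff_pair hx.mem_left hx.mem_right hx.ne
    omega
  have hE' := ih _ hlt hT hbn hcn rfl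
  rcases hE'.isSides hs' with h0 | h0
  · exfalso
    obtain ⟨-, hcore, -⟩ := h.connected
    have h1 : Y \ {a, x} ⊆ core S Y := by
      intro p hp
      rcases hs'.cases hT.gp hb' hc' hbc hp with h1 | h1 | rfl | rfl
      · rw [h0] at h1; simp at h1
      · exact hRc (Finset.mem_inter.1 h1).1
      · exact hb.mem_core
      · exact hc.mem_core
    have h2 : Y \ {a, x} ⊆ (core S Y).erase a := fun p hp =>
      Finset.mem_erase.2 ⟨by rintro rfl; simp at hp, h1 hp⟩
    have h3 := Finset.card_le_card h2
    rw [Finset.card_erase_of_mem hl.mem_core, hcore, hT.card] at h3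
    omega
  · exact fin h0

end PlaneMatching

namespace PlaneMatching

variable {S : Finset (Sym2 Pt)} {Y : Finset Pt} {m : ℕ} {a a' b c d v v' : Pt} {L R : Finset Pt}

theorem Tight.unbl_leaf_side (h : Tight S Y m) (hl : Leaf S Y a v) (hs : IsSides Y a v L R)
    {x : Pt} (hx : x ∈ insert a L) : Unbl S ((insert a L).erase x) := by
  have haL : a ∉ L := fun h => hs.ne_left h rfl
  have hbal := h.bal_leaf hl hs
  rcases Finset.mem_insert.1 hx with rfl | hx
  · rw [Finset.erase_insert haL]
    exact unbl_of_cw h.gp hs.subset (by rw [sum_cw]; omega)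
  have hT := (h.leaf_split hl hs).1
  have hLpos := Finset.card_pos.2 ⟨x, hx⟩
  obtain ⟨z, hz, hzv⟩ : ∃ z ∈ L, s(z, v) ∈ S := by
    by_contra hcon
    push Not at hcon
    have := h.closed (U := L ∩ core S Y) Finset.inter_subset_right (fun x hx y hy hxy => by
      have hx' := (Finset.mem_inter.1 hx).1
      rcases h.nbr_side hl hs hx' hy hxy with h1 | rfl
      · exact Finset.mem_inter.2 ⟨h1, mem_core_right (hs.subset hx') hy hxy⟩
      · exact absurd hxy (hcon x hx')) hl.mem_core (by simp [haL])
    rw [this] at hbal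
    simp at hbal; omega
  have hvZ : v ∉ (insert a L).erase x := by
    simp only [Finset.mem_erase, Finset.mem_insert, not_and, not_or]
    exact fun _ => ⟨(h.ne hl.2.2.1).symm, fun h => hs.ne_right h rfl⟩
  have hsub : inner S ((insert a L).erase x) ⊆ inner S (L ∪ {a, v}) \ {s(a, v), s(z, v)} := by
    intro e he
    rw [Finset.mem_sdiff]
    refine ⟨inner_mono (fun p hp => ?_) he, ?_⟩
    · have := Finset.mem_of_mem_erase hp
      rw [Finset.mem_insert] at this
      rw [mem_union_pair]; tauto
    · intro h1
      rw [Finset.mem_insert, Finset.mem_singleton] at h1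
      rcases h1 with rfl | rfl <;> exact hvZ (mem_inner.1 he).2.2
  have h1 := Finset.card_le_card hsub
  have hza : z ≠ a := hs.ne_left hz
  have h2 := Finset.card_sdiff_add_card_eq_card (s := {s(a, v), s(z, v)})
    (t := inner S (L ∪ {a, v})) (by
      intro e he
      rw [Finset.mem_insert, Finset.mem_singleton] at he
      rcases he with rfl | rfl
      · exact mem_inner.2 ⟨hl.2.2.1, by simp, by simp⟩
      · exact mem_inner.2 ⟨hzv, by simp [hz], by simp⟩)
  rw [Finset.card_pair (fun h => hza (Sym2.congr_left.1 h).symm)] at h2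
  have h3 := hT.le
  refine unbl_of_card_inner_lt (m := (L ∩ core S Y).card)
    (h.gp.mono ((Finset.erase_subset _ _).trans ?_)) ?_ (Or.inr (by omega))
  · exact Finset.insert_subset hl.1 hs.subset
  · rw [Finset.card_erase_of_mem (Finset.mem_insert_of_mem hx), Finset.card_insert_of_notMem haL]
    omega

/-- Two leaf edges with different parents have disjoint far sides. -/
theorem Tight.far_sides (h : Tight S Y m) (hl : Leaf S Y a v) (hl' : Leaf S Y b v') (hvv : v ≠ v')
    {A A' B B' : Finset Pt} (hA : IsSides Y a v A A') (hB : IsSides Y b v' B B')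
    (hvA : v' ∈ A) (hvB : v ∈ B) (hdA : d ∈ A') (hdB : d ∈ B') : False := by
  have hbA : b ∈ A := by
    refine (h.nbr_side hl hA hvA hl'.1 ?_).resolve_right ?_
    · rw [Sym2.eq_swap]; exact hl'.2.2.1
    · exact (hB.ne_left hvB).symm
  have hav : a ≠ v := h.ne hl.2.2.1
  have haB : a ∉ B' := by
    have : a ∈ B := by
      refine (h.nbr_side hl' hB hvB hl.1 ?_).resolve_right ?_
      · rw [Sym2.eq_swap]; exact hl.2.2.1
      · exact (hA.ne_left hvA).symm
    exact hB.disjoint this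
  have hvB' : v ∉ B' := hB.disjoint hvB
  have hT := (h.leaf_split hl hA).1
  have hsub := hA.union_subset hl.1 hl.2.1
  have hlQ : Leaf S (A ∪ {a, v}) b v' :=
    ⟨by simp [hbA], by simp [hvA], hl'.2.2.1, fun q hq => hl'.2.2.2 q (hsub hq)⟩
  have e1 := hT.bal_leaf hlQ (hB.symm.mono hsub)
  have e2 := h.bal_leaf hl' hB.symm
  have f1 : B' ∩ (A ∪ {a, v}) = B' ∩ A := by
    ext p
    simp only [Finset.mem_inter, mem_union_pair]
    constructor
    · rintro ⟨h1, h2 | rfl | rfl⟩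
      · exact ⟨h1, h2⟩
      · exact absurd h1 haB
      · exact absurd h1 hvB'
    · tauto
  have f2 : B' ∩ A ∩ core S (A ∪ {a, v}) = B' ∩ A ∩ core S Y := by
    ext p
    simp only [Finset.mem_inter]
    constructor
    · rintro ⟨h1, h2⟩; exact ⟨h1, core_mono hsub h2⟩
    · rintro ⟨h1, h2⟩
      obtain ⟨hp, q, hq, hpq⟩ := mem_core.1 h2
      have := h.nbr_side hl hA h1.2 hq hpq
      exact ⟨h1, mem_core_left (mem_union_pair.2 (Or.inl h1.2)) (mem_union_pair.2 (by tauto)) hpq⟩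
  rw [f1, f2] at e1
  have f3 : B' \ A = B' ∩ A' := by
    ext p
    simp only [Finset.mem_sdiff, Finset.mem_inter]
    constructor
    · rintro ⟨h1, h2⟩
      refine ⟨h1, ?_⟩
      rcases hA.cases h.gp hl.1 hl.2.1 hav (hB.symm.subset h1) with h3 | h3 | rfl | rfl
      · exact absurd h3 h2
      · exact h3
      · exact absurd h1 haB
      · exact absurd h1 hvB'
    · rintro ⟨h1, h2⟩; exact ⟨h1, hA.symm.disjoint h2⟩
  have g1 := Finset.card_inter_add_card_sdiff B' A
  have g2 := Finset.card_inter_add_card_sdiff (B' ∩ core S Y) A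
  have g3 : B' ∩ core S Y ∩ A = B' ∩ A ∩ core S Y := by
    ext p; simp only [Finset.mem_inter]; tauto
  have g4 : (B' ∩ core S Y) \ A = ∅ := by
    refine h.closed (Finset.sdiff_subset.trans Finset.inter_subset_right) ?_ hl.mem_core
      (by simp [haB])
    intro x hx y hy hxy
    have hx1 : x ∈ B' := (Finset.mem_inter.1 (Finset.mem_sdiff.1 hx).1).1
    have hx2 : x ∈ A' := by
      have : x ∈ B' \ A := Finset.mem_sdiff.2 ⟨hx1, (Finset.mem_sdiff.1 hx).2⟩
      rw [f3] at this
      exact (Finset.mem_inter.1 this).2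
    have hyc := mem_core_right (hB.symm.subset hx1) hy hxy
    have hy' : y ∈ A' ∧ y ∈ B' := by
      rcases h.nbr_side hl' hB.symm hx1 hy hxy with h1 | rfl
      · rcases h.nbr_side hl hA.symm hx2 hy hxy with h2 | rfl
        · exact ⟨h2, h1⟩
        · exact absurd h1 hvB'
      · rcases h.nbr_side hl hA.symm hx2 hy hxy with h2 | h2
        · exact absurd h2 (hA.disjoint hvA)
        · exact absurd h2.symm hvv
    simp only [Finset.mem_sdiff, Finset.mem_inter]
    exact ⟨⟨hy'.2, hyc⟩, hA.symm.disjoint hy'.1⟩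
  rw [g4, g3, Finset.card_empty] at g2
  have : 0 < (B' \ A).card := Finset.card_pos.2 ⟨d, by rw [f3]; simp [hdA, hdB]⟩
  omega

/-- `d` is the only point in the angle at `v` between the leaves `a` and `a'`. -/
structure Sector (S : Finset (Sym2 Pt)) (Y : Finset Pt) (v a a' d : Pt) : Prop where
  leaf : Leaf S Y a v
  leaf' : Leaf S Y a' v
  nonLeaf : NonLeaf S Y v
  hv : HV Y v
  left : 0 < orient v a d
  right : 0 < orient v d a'
  mem : d ∈ Y
  notMem : d ∉ core S Y
  hvd : HV Y d
  empty : ∀ p ∈ core S Y, 0 < orient v a p → ¬ 0 < orient v p a'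

theorem Tight.exists_sector (h : Tight S Y m) (hn : NonLeaf S Y v) (hv : HV Y v)
    (hl : Leaf S Y a v) (hl' : Leaf S Y a' v) (haa : 0 < orient v a a')
    (hno : ∀ p, Leaf S Y p v → 0 < orient v a p → ¬ 0 < orient v p a') :
    ∃ d, Sector S Y v a a' d := by
  have hvY := hn.1
  have hav := h.ne hl.2.2.1
  have hav' := h.ne hl'.2.2.1
  have haa' : a ≠ a' := by rintro rfl; simp at haa
  obtain ⟨κ, hκ⟩ := hv.exists_key
  have s1 : IsSides Y a v (lft Y a v) (lft Y v a) := IsSides.mk _ _ _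
  have s2 : IsSides Y a' v (lft Y v a') (lft Y a' v) := (IsSides.mk _ _ _).symm
  have m1 : ∀ {x y}, x ∈ Y → y ∈ Y → x ≠ v → y ≠ v → (y ∈ lft Y v x ↔ κ x < κ y) := by
    intro x y hx hy hxv hyv
    rw [mem_lft, hκ x hx y hy hxv hyv]; tauto
  have m2 : ∀ {x y}, x ∈ Y → y ∈ Y → x ≠ v → y ≠ v → (y ∈ lft Y x v ↔ κ y < κ x) := by
    intro x y hx hy hxv hyv
    rw [mem_lft, hκ y hy x hx hyv hxv, orient_rotate x v y]; tauto
  have hκaa : κ a < κ a' := (hκ a hl.1 a' hl'.1 hav hav').2 haa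
  have hinj := key_injOn h.gp hvY hκ
  let W := lft Y v a ∩ lft Y a' v
  have hW : ∀ p, p ∈ W ↔ p ∈ Y ∧ p ≠ v ∧ κ a < κ p ∧ κ p < κ a' := by
    intro p
    constructor
    · intro hp
      obtain ⟨h1, h2⟩ := Finset.mem_inter.1 hp
      have hpY := s1.symm.subset h1
      have hpv := s1.symm.ne_right h1
      exact ⟨hpY, hpv, (m1 hl.1 hpY hav hpv).1 h1, (m2 hl'.1 hpY hav' hpv).1 h2⟩
    · rintro ⟨h1, h2, h3, h4⟩
      exact Finset.mem_inter.2 ⟨(m1 hl.1 h1 hav h2).2 h3, (m2 hl'.1 h1 hav' h2).2 h4⟩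
  have hWsub : W ⊆ Y := fun p hp => ((hW p).1 hp).1
  -- the sum of the weights
  have b1 := h.bal_leaf hl s1.symm
  have b2 := h.bal_leaf hl' s2
  have hdec : lft Y v a = insert a' (W ∪ lft Y v a') := by
    ext p
    rw [Finset.mem_insert, Finset.mem_union, hW]
    constructor
    · intro hp
      have hpY := s1.symm.subset hp
      have hpv := s1.symm.ne_right hp
      have h1 := (m1 hl.1 hpY hav hpv).1 hp
      rcases lt_trichotomy (κ p) (κ a') with h2 | h2 | h2
      · exact Or.inr (Or.inl ⟨hpY, hpv, h1, h2⟩)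
      · exact Or.inl (hinj (by simp [hpY, hpv]) (by simp [hl'.1, hav']) h2)
      · exact Or.inr (Or.inr ((m1 hl'.1 hpY hav' hpv).2 h2))
    · rintro (rfl | hp | hp)
      · exact (m1 hl.1 hl'.1 hav hav').2 hκaa
      · exact (m1 hl.1 hp.1 hav hp.2.1).2 hp.2.2.1
      · have hpY := s2.subset hp
        have hpv := s2.ne_right hp
        exact (m1 hl.1 hpY hav hpv).2 (hκaa.trans ((m1 hl'.1 hpY hav' hpv).1 hp))
  have hdisj : Disjoint W (lft Y v a') := Finset.disjoint_left.2 fun p hp hp' =>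
    s2.disjoint hp' (Finset.mem_inter.1 hp).2
  have ha'n : a' ∉ W ∪ lft Y v a' := by
    rw [Finset.mem_union, hW]
    rintro (h1 | h1)
    · exact lt_irrefl _ h1.2.2.2
    · exact s2.ne_left h1 rfl
  have hsumW : ∑ p ∈ W, cw S Y p = -1 := by
    have e1 : ∑ p ∈ lft Y v a, cw S Y p = 0 := by rw [sum_cw]; omega
    have e2 : ∑ p ∈ lft Y v a', cw S Y p = 0 := by rw [sum_cw]; omega
    rw [hdec, Finset.sum_insert ha'n, Finset.sum_union hdisj, e2, cw, if_pos hl'.mem_core] at e1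
    omega
  have hWnbr : ∀ x ∈ W, ∀ y ∈ Y, s(x, y) ∈ S → y ∈ W ∨ y = v := by
    intro x hx y hy hxy
    obtain ⟨h1, h2⟩ := Finset.mem_inter.1 hx
    rcases h.nbr_side hl s1.symm h1 hy hxy with h3 | h3
    · rcases h.nbr_side hl' s2.symm h2 hy hxy with h4 | h4
      · exact Or.inl (Finset.mem_inter.2 ⟨h3, h4⟩)
      · exact Or.inr h4
    · exact Or.inr h3
  have hWv : ∀ x ∈ W, s(x, v) ∉ S := by
    intro x hx hxv
    obtain ⟨x1, x2, x3, x4⟩ := (hW x).1 hx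
    rcases leaf_or_nonLeaf (mem_core_left x1 hvY hxv) with ⟨w, hw⟩ | hxn
    · obtain rfl := hw.2.2.2 v hvY hxv
      exact hno x hw ((hκ a hl.1 x x1 hav x2).1 x3) ((hκ x x1 a' hl'.1 x2 hav').1 x4)
    · have hE := h.hedge_of_nonLeaf hxn hn hxv
      rcases hE.isSides (IsSides.mk Y x v) with h0 | h0
      · have := (m2 x1 hl.1 x2 hav).2 x3
        rw [h0] at this; simp at this
      · have := (m1 x1 hl'.1 x2 hav').2 x4
        rw [h0] at this; simp at this
  have hWc : W ∩ core S Y = ∅ := by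
    refine h.closed Finset.inter_subset_right ?_ hl.mem_core (fun h => ?_)
    · intro x hx y hy hxy
      have hxW := (Finset.mem_inter.1 hx).1
      rcases hWnbr x hxW y hy hxy with h1 | rfl
      · exact Finset.mem_inter.2 ⟨h1, mem_core_right (hWsub hxW) hy hxy⟩
      · exact absurd hxy (hWv x hxW)
    · exact lt_irrefl _ ((hW a).1 (Finset.mem_inter.1 h).1).2.2.1
  have hW1 : W.card = 1 := by
    rw [sum_cw, hWc] at hsumW
    simpa using hsumW
  obtain ⟨d, hd⟩ := Finset.card_eq_one.1 hW1
  have hdW : d ∈ W := by simp [hd]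
  obtain ⟨d1, d2, d3, d4⟩ := (hW d).1 hdW
  have hdc : d ∉ core S Y := fun hdc => by
    have := Finset.mem_inter.2 ⟨hdW, hdc⟩
    rw [hWc] at this; simp at this
  refine ⟨d, hl, hl', hn, hv, (hκ a hl.1 d d1 hav d2).1 d3, (hκ d d1 a' hl'.1 d2 hav').1 d4,
    d1, hdc, ?_, ?_⟩
  swap
  · intro p hp h1 h2
    have hpY := core_subset hp
    have hpv : p ≠ v := by rintro rfl; simp at h1
    have : p ∈ W ∩ core S Y := Finset.mem_inter.2 ⟨(hW p).2
      ⟨hpY, hpv, (hκ a hl.1 p hpY hav hpv).2 h1, (hκ p hpY a' hl'.1 hpv hav').2 h2⟩, hp⟩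
    rw [hWc] at this; simp at this
  by_contra hnd
  obtain ⟨x, hx, y, hy, hxo, hyo, hxy⟩ := exists_exit h.gp d1 hvY d2 hnd
  have hxv : x ≠ v := by rintro rfl; simp at hxo
  have hyv : y ≠ v := by rintro rfl; simp at hyo
  -- the two sides of the line through `v` and `d`
  have lo : ∀ p, p ∈ insert a (lft Y a v) ↔ p ∈ Y ∧ p ≠ v ∧ κ p < κ d := by
    intro p
    rw [Finset.mem_insert]
    constructor
    · rintro (rfl | hp)
      · exact ⟨hl.1, hav, d3⟩
      · have hpY := s1.subset hp
        have hpv := s1.ne_right hp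
        exact ⟨hpY, hpv, ((m2 hl.1 hpY hav hpv).1 hp).trans d3⟩
    · rintro ⟨h1, h2, h3⟩
      rcases lt_trichotomy (κ p) (κ a) with h4 | h4 | h4
      · exact Or.inr ((m2 hl.1 h1 hav h2).2 h4)
      · exact Or.inl (hinj (by simp [h1, h2]) (by simp [hl.1, hav]) h4)
      · have : p ∈ W := (hW p).2 ⟨h1, h2, h4, h3.trans d4⟩
        rw [hd, Finset.mem_singleton] at this
        subst this; exact absurd h3 (lt_irrefl _)
  have hi : ∀ p, p ∈ insert a' (lft Y v a') ↔ p ∈ Y ∧ p ≠ v ∧ κ d < κ p := by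
    intro p
    rw [Finset.mem_insert]
    constructor
    · rintro (rfl | hp)
      · exact ⟨hl'.1, hav', d4⟩
      · have hpY := s2.subset hp
        have hpv := s2.ne_right hp
        exact ⟨hpY, hpv, d4.trans ((m1 hl'.1 hpY hav' hpv).1 hp)⟩
    · rintro ⟨h1, h2, h3⟩
      rcases lt_trichotomy (κ p) (κ a') with h4 | h4 | h4
      · have : p ∈ W := (hW p).2 ⟨h1, h2, d3.trans h3, h4⟩
        rw [hd, Finset.mem_singleton] at this
        subst this; exact absurd h3 (lt_irrefl _)
      · exact Or.inl (hinj (by simp [h1, h2]) (by simp [hl'.1, hav']) h4)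
      · exact Or.inr ((m1 hl'.1 h1 hav' h2).2 h4)
  have hxlo : x ∈ insert a (lft Y a v) := by
    refine (lo x).2 ⟨hx, hxv, (m2 d1 hx d2 hxv).1 (mem_lft.2 ⟨hx, hxo⟩)⟩
  have hyhi : y ∈ insert a' (lft Y v a') := by
    refine (hi y).2 ⟨hy, hyv, (m1 d1 hy d2 hyv).1 (mem_lft.2 ⟨hy, ?_⟩)⟩
    rw [orient_swap]; linarith
  have hxyS : s(x, y) ∉ S := by
    intro hS
    have hκxy : κ d < κ y := ((hi y).1 hyhi).2.2
    rcases Finset.mem_insert.1 hxlo with rfl | h1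
    · exact hyv (hl.2.2.2 y hy hS)
    · rcases h.nbr_side hl s1 h1 hy hS with h2 | h2
      · have := ((lo y).1 (Finset.mem_insert_of_mem h2)).2.2
        exact absurd this hκxy.not_gt
      · exact hyv h2
  have hE : HEdge Y x y := hxy
  refine h.blocked (hE.unbl hxyS ?_)
  have hdv : s(d, v) ∉ S := fun h1 => hdc (mem_core_left d1 hvY h1)
  refine (h.unbl_leaf_side hl s1 hxlo).of_line d2 hdv (h.unbl_leaf_side hl' s2 hyhi) ?_ ?_ ?_
  · intro p hp
    obtain ⟨h1, h2, h3⟩ := (lo p).1 (Finset.mem_of_mem_erase hp)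
    exact (mem_lft.1 ((m2 d1 h1 d2 h2).2 h3)).2
  · intro p hp
    obtain ⟨h1, h2, h3⟩ := (hi p).1 (Finset.mem_of_mem_erase hp)
    have := (mem_lft.1 ((m1 d1 h1 d2 h2).2 h3)).2
    rw [orient_swap] at this; linarith
  · intro p
    have hxk := ((lo x).1 hxlo).2.2
    have hyk := ((hi y).1 hyhi).2.2
    rw [Finset.mem_sdiff, Finset.mem_erase, Finset.mem_erase, lo, hi, Finset.mem_insert,
      Finset.mem_singleton]
    constructor
    · rintro ⟨h1, h2⟩
      push Not at h2
      by_cases hpv : p = v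
      · tauto
      rcases lt_trichotomy (κ p) (κ d) with h4 | h4 | h4
      · tauto
      · right; right; left
        exact hinj (by simp [h1, hpv]) (by simp [d1, d2]) h4
      · tauto
    · rintro (⟨h1, h2, h3, h4⟩ | ⟨h1, h2, h3, h4⟩ | rfl | rfl)
      · refine ⟨h2, ?_⟩
        rintro (rfl | rfl)
        · exact h1 rfl
        · exact absurd h4 hyk.not_gt
      · refine ⟨h2, ?_⟩
        rintro (rfl | rfl)
        · exact absurd h4 hxk.not_gt
        · exact h1 rfl
      · refine ⟨d1, ?_⟩
        rintro (rfl | rfl)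
        · exact lt_irrefl _ hxk
        · exact lt_irrefl _ hyk
      · exact ⟨hvY, fun h => h.elim (fun h => hxv h.symm) (fun h => hyv h.symm)⟩

end PlaneMatching

namespace PlaneMatching

variable {S : Finset (Sym2 Pt)} {Y : Finset Pt} {m : ℕ} {a a' b c d v v' : Pt} {L R : Finset Pt}

theorem Tight.eq_of_closed_pair (h : Tight S Y m) (hl : Leaf S Y a v) (hn : ¬ NonLeaf S Y v) :
    core S Y = {a, v} := by
  have hl' : Leaf S Y v a := leaf_of_not_nonLeaf hl.2.1 hl.1 (by rw [Sym2.eq_swap]; exact hl.2.2.1) hn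
  have hsub : ({a, v} : Finset Pt) ⊆ core S Y := by
    intro p hp
    simp only [Finset.mem_insert, Finset.mem_singleton] at hp
    rcases hp with rfl | rfl
    · exact hl.mem_core
    · exact hl'.mem_core
  refine Finset.Subset.antisymm (fun z hz => ?_) hsub
  by_contra hzU
  have := h.closed hsub (by
    intro x hx y hy hxy
    simp only [Finset.mem_insert, Finset.mem_singleton] at hx ⊢
    rcases hx with rfl | rfl
    · exact Or.inr (hl.2.2.2 y hy hxy)
    · exact Or.inl (hl'.2.2.2 y hy hxy)) hz hzU
  simp at this

theorem Sector.inj_parent (h : Tight S Y m) (h1 : Sector S Y v a a' d) {b b' : Pt}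
    (h2 : Sector S Y v' b b' d) : v = v' := by
  by_contra hvv
  -- a leaf edge at `v` separating `d` from another non-leaf
  have key : ∀ {v v' a a'}, v ≠ v' → NonLeaf S Y v' → Sector S Y v a a' d →
      ∃ e A A', Leaf S Y e v ∧ IsSides Y e v A A' ∧ v' ∈ A ∧ d ∈ A' := by
    intro v v' a a' hvv hn h1
    obtain ⟨κ, hκ⟩ := h1.hv.exists_key
    have hdv : d ≠ v := by rintro rfl; exact h1.notMem h1.nonLeaf.mem_core
    have hav := h.ne h1.leaf.2.2.1
    have hav' := h.ne h1.leaf'.2.2.1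
    have hva : v' ≠ a := by rintro rfl; exact h1.leaf.not_nonLeaf hn
    have hva' : v' ≠ a' := by rintro rfl; exact h1.leaf'.not_nonLeaf hn
    have g1 : orient v a v' ≠ 0 := h.gp _ h1.nonLeaf.1 _ h1.leaf.1 _ hn.1 hav.symm hvv hva.symm
    have g2 : orient v v' a' ≠ 0 := h.gp _ h1.nonLeaf.1 _ hn.1 _ h1.leaf'.1 hvv hav'.symm hva'
    rcases g1.lt_or_gt with g | g
    · refine ⟨a, lft Y a v, lft Y v a, h1.leaf, IsSides.mk _ _ _, mem_lft.2 ⟨hn.1, ?_⟩,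
        mem_lft.2 ⟨h1.mem, h1.left⟩⟩
      rw [orient_swap]; linarith
    · have g3 := h1.empty v' hn.mem_core g
      refine ⟨a', lft Y v a', lft Y a' v, h1.leaf', (IsSides.mk _ _ _).symm, mem_lft.2 ⟨hn.1, ?_⟩,
        mem_lft.2 ⟨h1.mem, ?_⟩⟩
      · rw [orient_swap_right]
        have := lt_of_le_of_ne (not_lt.1 g3) g2
        linarith
      · rw [← orient_rotate a' v d]; exact h1.right
  obtain ⟨e, A, A', hl, hA, hvA, hdA⟩ := key hvv h2.nonLeaf h1
  obtain ⟨e', B, B', hl', hB, hvB, hdB⟩ := key (Ne.symm hvv) h1.nonLeaf h2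
  exact h.far_sides hl hl' hvv hA hB hvA hvB hdA hdB

theorem Sector.inj_leaf (h : Tight S Y m) (h1 : Sector S Y v a a' d) {b b' : Pt}
    (h2 : Sector S Y v b b' d) : a = b := by
  obtain ⟨κ, hκ⟩ := h1.hv.exists_key
  have hdv : d ≠ v := by rintro rfl; exact h1.notMem h1.nonLeaf.mem_core
  have hinj := key_injOn h.gp h1.nonLeaf.1 hκ
  have key : ∀ {a a' b b'}, Sector S Y v a a' d → Sector S Y v b b' d → ¬ κ a < κ b := by
    intro a a' b b' h1 h2 hab
    have hav := h.ne h1.leaf.2.2.1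
    have hbv := h.ne h2.leaf.2.2.1
    have hav' := h.ne h1.leaf'.2.2.1
    refine h1.empty b h2.leaf.mem_core ((hκ a h1.leaf.1 b h2.leaf.1 hav hbv).1 hab) ?_
    rw [← hκ b h2.leaf.1 a' h1.leaf'.1 hbv hav']
    exact ((hκ b h2.leaf.1 d h2.mem hbv hdv).2 h2.left).trans
      ((hκ d h1.mem a' h1.leaf'.1 hdv hav').2 h1.right)
  have hav := h.ne h1.leaf.2.2.1
  have hbv := h.ne h2.leaf.2.2.1
  rcases lt_trichotomy (κ a) (κ b) with h3 | h3 | h3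
  · exact absurd h3 (key h1 h2)
  · exact hinj (by simp [h1.leaf.1, hav]) (by simp [h2.leaf.1, hbv]) h3
  · exact absurd h3 (key h2 h1)

/-- The vertices of the convex hull. -/
def hull (Y : Finset Pt) : Finset Pt := by
  classical exact Y.filter (HV Y)

theorem mem_hull {p : Pt} : p ∈ hull Y ↔ HV Y p := by
  simp only [hull, Finset.mem_filter]
  exact ⟨fun h => h.2, fun h => ⟨h.1, h⟩⟩

theorem mem_exchange {A B : Finset Pt} {x y p : Pt} (hxB : x ∉ B) (hyA : y ∉ A) (hxd : x ≠ d)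
    (hxv : x ≠ v) (hyd : y ≠ d) (hyv : y ≠ v) :
    (p ∈ A ∨ p ∈ B ∨ p = d ∨ p = v) ∧ ¬(p = x ∨ p = y) ↔
      (p ≠ x ∧ p ∈ A) ∨ (p ≠ y ∧ p ∈ B) ∨ p = d ∨ p = v := by
  constructor
  · rintro ⟨h1 | h1 | h1 | h1, h2⟩
    · exact Or.inl ⟨fun h => h2 (Or.inl h), h1⟩
    · exact Or.inr (Or.inl ⟨fun h => h2 (Or.inr h), h1⟩)
    · exact Or.inr (Or.inr (Or.inl h1))
    · exact Or.inr (Or.inr (Or.inr h1))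
  · rintro (⟨h1, h2⟩ | ⟨h1, h2⟩ | rfl | rfl)
    · exact ⟨Or.inl h2, fun h => h.elim h1 fun h => hyA (h ▸ h2)⟩
    · exact ⟨Or.inr (Or.inl h2), fun h => h.elim (fun h => hxB (h ▸ h2)) h1⟩
    · exact ⟨Or.inr (Or.inr (Or.inl rfl)), fun h => h.elim (hxd ∘ Eq.symm) (hyd ∘ Eq.symm)⟩
    · exact ⟨Or.inr (Or.inr (Or.inr rfl)), fun h => h.elim (hxv ∘ Eq.symm) (hyv ∘ Eq.symm)⟩

/-- In a star, all points outside the core are on the hull. -/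
theorem Tight.star (h : Tight S Y m) (hst : ∀ x ∈ Y, ∀ y ∈ Y, s(x, y) ∈ S → x = v ∨ y = v)
    (hv : v ∈ core S Y) (hd : d ∈ Y) (hdc : d ∉ core S Y) : HV Y d := by
  by_contra hnd
  have hvY := core_subset hv
  have hdv : d ≠ v := by rintro rfl; exact hdc hv
  have hdvS : s(d, v) ∉ S := fun h1 => hdc (mem_core_left hd hvY h1)
  have hs := IsSides.mk Y d v
  have hcard : (lft Y d v).card + (lft Y v d).card + 2 = 2 * m := by
    have h1 := hs.sum_add h.gp hd hvY hdv (fun _ => (1 : ℤ))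
    have h2 := h.card
    simp at h1
    omega
  have hun : ∀ Z ⊆ Y, v ∉ Z → Even Z.card → Unbl S Z := by
    intro Z hZ hvZ ⟨k, hk⟩
    refine unbl_of_card_inner_lt (m := k) (h.gp.mono hZ) (by omega) ?_
    have : inner S Z = ∅ := Finset.eq_empty_of_forall_notMem fun e he => by
      induction e using Sym2.ind with
      | _ x y =>
      obtain ⟨h1, h2, h3⟩ := mem_inner.1 he
      rcases hst x (hZ h2) y (hZ h3) h1 with rfl | rfl
      · exact hvZ h2
      · exact hvZ h3
    rw [this]; simp; omega
  have hvL : v ∉ lft Y d v := fun h => hs.ne_right h rfl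
  have hvR : v ∉ lft Y v d := fun h => hs.symm.ne_right h rfl
  have hneg : ∀ p ∈ lft Y v d, orient d v p < 0 := by
    intro p hp
    have := (mem_lft.1 hp).2
    rw [orient_swap] at this; linarith
  by_cases hev : Even (lft Y d v).card
  · refine h.blocked ((hun _ hs.subset hvL hev).of_line hdv hdvS (hun _ hs.symm.subset hvR ?_)
      (fun p hp => (mem_lft.1 hp).2) hneg (hs.mem_union h.gp hd hvY hdv))
    obtain ⟨k, hk⟩ := hev
    exact ⟨m - 1 - k, by omega⟩
  · rw [Nat.not_even_iff_odd] at hev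
    obtain ⟨k, hk⟩ := hev
    obtain ⟨x, hx, y, hy, hxo, hyo, hxy⟩ := exists_exit h.gp hd hvY hdv hnd
    have hE : HEdge Y x y := hxy
    have hxv : x ≠ v := by rintro rfl; simp at hxo
    have hyv : y ≠ v := by rintro rfl; simp at hyo
    have hxd : x ≠ d := by rintro rfl; simp at hxo
    have hyd : y ≠ d := by rintro rfl; simp at hyo
    have hxL : x ∈ lft Y d v := mem_lft.2 ⟨hx, hxo⟩
    have hyR : y ∈ lft Y v d := mem_lft.2 ⟨hy, by rw [orient_swap]; linarith⟩
    refine h.blocked (hE.unbl (fun hS => (hst x hx y hy hS).elim hxv hyv) ?_)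
    refine (hun ((lft Y d v).erase x) ((Finset.erase_subset _ _).trans hs.subset)
      (fun h => hvL (Finset.mem_of_mem_erase h)) ⟨k, ?_⟩).of_line hdv hdvS
      (hun ((lft Y v d).erase y) ((Finset.erase_subset _ _).trans hs.symm.subset)
        (fun h => hvR (Finset.mem_of_mem_erase h)) ⟨m - 2 - k, ?_⟩)
      (fun p hp => (mem_lft.1 (Finset.mem_of_mem_erase hp)).2)
      (fun p hp => hneg p (Finset.mem_of_mem_erase hp)) ?_
    · rw [Finset.card_erase_of_mem hxL]; omega
    · rw [Finset.card_erase_of_mem hyR]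
      have := Finset.card_pos.2 ⟨y, hyR⟩
      omega
    · intro p
      have hpc := hs.mem_union h.gp hd hvY hdv p
      have hxR := hs.disjoint hxL
      have hyL := hs.symm.disjoint hyR
      rw [Finset.mem_sdiff, Finset.mem_erase, Finset.mem_erase, Finset.mem_insert,
        Finset.mem_singleton, hpc]
      exact mem_exchange hxR hyL hxd hxv hyd hyv

/-- A tight configuration has many hull vertices. -/
theorem Tight.card_hull (h : Tight S Y m) : m + 1 ≤ 3 * (hull Y).card := by
  classical
  obtain ⟨he, hcore, -⟩ := h.connected
  have hm := h.pos
  let N := (core S Y).filter (NonLeaf S Y)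
  let Λ := (core S Y).filter fun p => ¬ NonLeaf S Y p
  have hNΛ : N.card + Λ.card = m + 1 := by
    rw [← hcore]; exact Finset.card_filter_add_card_filter_not _
  have hNm : ∀ p, p ∈ N ↔ NonLeaf S Y p := fun p => by
    simp only [N, Finset.mem_filter]
    exact ⟨fun h => h.2, fun h => ⟨h.mem_core, h⟩⟩
  have hΛm : ∀ p, p ∈ Λ → ∃ v, Leaf S Y p v := fun p hp => by
    simp only [Λ, Finset.mem_filter] at hp
    exact (leaf_or_nonLeaf hp.1).resolve_right hp.2
  obtain ⟨u, hu⟩ : ∃ u, HV Y u :=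
    exists_HV (Finset.card_pos.1 (by rw [h.card]; omega))
  have hupos : 0 < (hull Y).card := Finset.card_pos.2 ⟨u, mem_hull.2 hu⟩
  have hpar : 2 ≤ m → ∀ p v, Leaf S Y p v → NonLeaf S Y v := by
    intro hm2 p v hl
    by_contra hn
    have := h.eq_of_closed_pair hl hn
    rw [this] at hcore
    have := Finset.card_le_two (a := p) (b := v)
    omega
  rcases hm.eq_or_lt with h1 | hm2
  · omega
  have hpar := hpar hm2
  obtain ⟨a0, v0, hl0⟩ := h.exists_leaf
  have hv0 := hpar _ _ hl0
  by_cases hone : ∀ w, NonLeaf S Y w → w = v0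
  · have hst : ∀ x ∈ Y, ∀ y ∈ Y, s(x, y) ∈ S → x = v0 ∨ y = v0 := by
      intro x hx y hy hxy
      rcases leaf_or_nonLeaf (mem_core_left hx hy hxy) with ⟨v, hl⟩ | hn
      · right
        rw [hl.2.2.2 y hy hxy]
        exact hone v (hpar _ _ hl)
      · exact Or.inl (hone x hn)
    have : Y \ core S Y ⊆ hull Y := fun d hd => by
      obtain ⟨h1, h2⟩ := Finset.mem_sdiff.1 hd
      exact mem_hull.2 (h.star hst hv0.mem_core h1 h2)
    have h1 := Finset.card_le_card this
    have h2 := Finset.card_sdiff_add_card_eq_card (core_subset (S := S) (Y := Y))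
    rw [h.card] at h2
    omega
  push Not at hone
  have hNhv : ∀ v, NonLeaf S Y v → HV Y v := by
    intro v hn
    by_cases hex : ∃ w ∈ Y, NonLeaf S Y w ∧ s(v, w) ∈ S
    · obtain ⟨w, -, hw, hvw⟩ := hex
      exact (h.hedge_of_nonLeaf hn hw hvw).left_HV
    · push Not at hex
      exfalso
      obtain ⟨w, hw, hwv⟩ : ∃ w, NonLeaf S Y w ∧ w ≠ v := by
        obtain ⟨w, hw, hwv⟩ := hone
        by_cases hv : v = v0
        · exact ⟨w, hw, fun h => hwv (h.trans hv)⟩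
        · exact ⟨v0, hv0, Ne.symm hv⟩
      have := h.closed (U := (core S Y).filter fun p => p = v ∨ s(v, p) ∈ S)
        (Finset.filter_subset _ _) (by
          intro x hx y hy hxy
          rw [Finset.mem_filter] at hx ⊢
          refine ⟨mem_core_right (core_subset hx.1) hy hxy, ?_⟩
          rcases hx.2 with rfl | hvx
          · exact Or.inr hxy
          · left
            have hnx : ¬ NonLeaf S Y x := fun hnx => hex x (core_subset hx.1) hnx hvx
            exact (leaf_of_not_nonLeaf (core_subset hx.1) hn.1
              (by rwa [Sym2.eq_swap]) hnx).2.2.2 y hy hxy) hw.mem_core (by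
          rw [Finset.mem_filter]
          rintro ⟨-, h1 | h1⟩
          · exact hwv h1
          · exact hex w hw.1 hw h1)
      have hv : v ∈ (core S Y).filter fun p => p = v ∨ s(v, p) ∈ S :=
        Finset.mem_filter.2 ⟨hn.mem_core, Or.inl rfl⟩
      rw [this] at hv
      simp at hv
  let T := Λ.filter fun a => ∃ v a' d, Sector S Y v a a' d
  let T' := Λ.filter fun a => ¬ ∃ v a' d, Sector S Y v a a' d
  have hTT : T.card + T'.card = Λ.card := Finset.card_filter_add_card_filter_not _
  have hNT : N ⊆ hull Y := fun v hv => mem_hull.2 (hNhv v ((hNm v).1 hv))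
  have hT : T.card ≤ (hull Y \ N).card := by
    refine Finset.card_le_card_of_forall_subsingleton (fun a d => ∃ v a', Sector S Y v a a' d) ?_ ?_
    · intro a ha
      obtain ⟨v, a', d, hs⟩ := (Finset.mem_filter.1 ha).2
      refine ⟨d, Finset.mem_sdiff.2 ⟨mem_hull.2 hs.hvd, fun hd => ?_⟩, v, a', hs⟩
      exact hs.notMem ((hNm d).1 hd).mem_core
    · rintro d - a ⟨-, v, a', h1⟩ b ⟨-, v', b', h2⟩
      obtain rfl := h1.inj_parent h h2
      exact h1.inj_leaf h h2
  have hT' : T'.card ≤ N.card := by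
    refine Finset.card_le_card_of_forall_subsingleton (fun a v => Leaf S Y a v) ?_ ?_
    · intro a ha
      obtain ⟨v, hl⟩ := hΛm a (Finset.mem_filter.1 ha).1
      exact ⟨v, (hNm v).2 (hpar _ _ hl), hl⟩
    · rintro v hv a ⟨ha, hla⟩ b ⟨hb, hlb⟩
      have hvn := (hNm v).1 hv
      have hhv := hNhv v hvn
      obtain ⟨κ, hκ⟩ := hhv.exists_key
      have hinj := key_injOn h.gp hvn.1 hκ
      have key : ∀ a b, a ∈ T' → Leaf S Y a v → Leaf S Y b v → ¬ κ a < κ b := by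
        intro a b ha hla hlb hab
        have hne : ∀ {p}, Leaf S Y p v → p ≠ v := fun hp => h.ne hp.2.2.1
        obtain ⟨a', ha', hmin⟩ := Finset.exists_min_image
          (Y.filter fun p => Leaf S Y p v ∧ κ a < κ p) κ
          ⟨b, Finset.mem_filter.2 ⟨hlb.1, hlb, hab⟩⟩
        obtain ⟨h1, h2, h3⟩ := Finset.mem_filter.1 ha'
        obtain ⟨d, hd⟩ := h.exists_sector hvn hhv hla h2
          ((hκ a hla.1 a' h1 (hne hla) (hne h2)).1 h3) (by
            intro p hp hp1 hp2
            have e1 := (hκ a hla.1 p hp.1 (hne hla) (hne hp)).2 hp1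
            have e2 := (hκ p hp.1 a' h1 (hne hp) (hne h2)).2 hp2
            exact absurd e2 (not_lt.2 (hmin p (Finset.mem_filter.2 ⟨hp.1, hp, e1⟩))))
        exact (Finset.mem_filter.1 ha).2 ⟨v, a', d, hd⟩
      rcases lt_trichotomy (κ a) (κ b) with h3 | h3 | h3
      · exact absurd h3 (key a b ha hla hlb)
      · exact hinj (by simp [hla.1, h.ne hla.2.2.1]) (by simp [hlb.1, h.ne hlb.2.2.1]) h3
      · exact absurd h3 (key b a hb hlb hla)
  have h1 := Finset.card_sdiff_add_card_eq_card hNT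
  omega

end PlaneMatching

namespace PlaneMatching

/-- The height of `p` in the direction `θ`. -/
def val (θ : ℝ) (p : Pt) : ℝ := Real.cos θ * p.1 + Real.sin θ * p.2

theorem val_add_pi (θ : ℝ) (p : Pt) : val (θ + Real.pi) p = -val θ p := by
  simp only [val, Real.cos_add_pi, Real.sin_add_pi]; ring

theorem continuous_val (p : Pt) : Continuous fun θ => val θ p := by
  unfold val; fun_prop

theorem isAff_val (θ : ℝ) : IsAff (val θ) := ⟨Real.cos θ, Real.sin θ, 0, fun p => by simp [val]⟩

/-- The sum of the heights of the two ends of an edge. -/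
def esum (θ : ℝ) (e : Sym2 Pt) : ℝ :=
  Sym2.lift ⟨fun x y => val θ x + val θ y, fun _ _ => add_comm _ _⟩ e

@[simp] theorem esum_mk (θ : ℝ) (x y : Pt) : esum θ s(x, y) = val θ x + val θ y := rfl

theorem esum_add_pi (θ : ℝ) (e : Sym2 Pt) : esum (θ + Real.pi) e = -esum θ e := by
  induction e using Sym2.ind with
  | _ x y => simp only [esum_mk, val_add_pi]; ring

theorem continuous_esum (e : Sym2 Pt) : Continuous fun θ => esum θ e := by
  induction e using Sym2.ind with
  | _ x y => exact (continuous_val x).add (continuous_val y)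

/-- The number of points with value less than `z`. -/
def nlt (Y : Finset Pt) (f : Pt → ℝ) (z : ℝ) : ℕ := (Y.filter fun p => f p < z).card

/-- The number of points with value at most `z`. -/
def nle (Y : Finset Pt) (f : Pt → ℝ) (z : ℝ) : ℕ := (Y.filter fun p => f p ≤ z).card

variable {S : Finset (Sym2 Pt)} {Y : Finset Pt} {m i j k α : ℕ} {f : Pt → ℝ} {z z' θ : ℝ}

theorem nlt_mono (h : z ≤ z') : nlt Y f z ≤ nlt Y f z' :=
  Finset.card_le_card (Finset.monotone_filter_right _ fun _ _ hp => lt_of_lt_of_le hp h)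

theorem nle_le_nlt (h : z < z') : nle Y f z ≤ nlt Y f z' :=
  Finset.card_le_card (Finset.monotone_filter_right _ fun _ _ hp => lt_of_le_of_lt hp h)

/-- `z` is an `i`-th smallest value of `f` on `Y`. -/
def IsOrd (Y : Finset Pt) (f : Pt → ℝ) (i : ℕ) (z : ℝ) : Prop := nlt Y f z < i ∧ i ≤ nle Y f z

theorem IsOrd.le (h : IsOrd Y f i z) (h' : IsOrd Y f j z') (hij : i ≤ j) : z ≤ z' := by
  by_contra hc
  have := nle_le_nlt (Y := Y) (f := f) (not_le.1 hc)
  have := h.1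
  have := h'.2
  omega

theorem IsOrd.eq (h : IsOrd Y f i z) (h' : IsOrd Y f i z') : z = z' :=
  le_antisymm (h.le h' le_rfl) (h'.le h le_rfl)

theorem nlt_neg : nlt Y (fun p => -f p) (-z) + nle Y f z = Y.card := by
  have := Finset.card_filter_add_card_filter_not (s := Y) (fun p => f p ≤ z)
  simp only [nlt, nle, neg_lt_neg_iff]
  simp only [not_le] at this
  omega

theorem nle_neg : nle Y (fun p => -f p) (-z) + nlt Y f z = Y.card := by
  have := Finset.card_filter_add_card_filter_not (s := Y) (fun p => f p < z)
  simp only [nlt, nle, neg_le_neg_iff]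
  simp only [not_lt] at this
  omega

theorem IsOrd.neg (h : IsOrd Y f i z) (hij : i + j = Y.card + 1) :
    IsOrd Y (fun p => -f p) j (-z) := by
  have h1 := nlt_neg (Y := Y) (f := f) (z := z)
  have h2 := nle_neg (Y := Y) (f := f) (z := z)
  have := h.1
  have := h.2
  constructor <;> omega

/-- Order statistics are continuous. -/
theorem exists_ord (Y : Finset Pt) (hi : 1 ≤ i) (hi' : i ≤ Y.card) :
    ∃ z : ℝ → ℝ, Continuous z ∧ ∀ θ, IsOrd Y (val θ) i (z θ) := by
  have hne : (Y.powersetCard i).attach.Nonempty :=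
    Finset.attach_nonempty_iff.2 (Finset.powersetCard_nonempty.2 hi')
  have hT : ∀ T : {T // T ∈ Y.powersetCard i}, T.1.Nonempty := fun T => by
    rw [← Finset.card_pos, (Finset.mem_powersetCard.1 T.2).2]; omega
  refine ⟨fun θ => (Y.powersetCard i).attach.inf' hne fun T => T.1.sup' (hT T) (val θ), ?_, ?_⟩
  · exact Continuous.finset_inf'_apply _ fun T _ =>
      Continuous.finset_sup'_apply _ fun p _ => continuous_val p
  · intro θ
    set z := (Y.powersetCard i).attach.inf' hne fun T => T.1.sup' (hT T) (val θ) with hz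
    constructor
    · by_contra hc
      obtain ⟨T, hTs, hTc⟩ := Finset.exists_subset_card_eq (not_lt.1 hc)
      have hTm : T ∈ Y.powersetCard i :=
        Finset.mem_powersetCard.2 ⟨hTs.trans (Finset.filter_subset _ _), hTc⟩
      have h1 : z ≤ T.sup' (hT ⟨T, hTm⟩) (val θ) :=
        Finset.inf'_le (fun T : {T // T ∈ Y.powersetCard i} => T.1.sup' (hT T) (val θ))
          (Finset.mem_attach _ ⟨T, hTm⟩)
      have h2 : T.sup' (hT ⟨T, hTm⟩) (val θ) < z :=
        (Finset.sup'_lt_iff _).2 fun p hp => (Finset.mem_filter.1 (hTs hp)).2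
      linarith
    · obtain ⟨T, -, hT'⟩ := Finset.exists_mem_eq_inf' hne
        fun T : {T // T ∈ Y.powersetCard i} => T.1.sup' (hT T) (val θ)
      rw [← hz] at hT'
      have h1 := Finset.mem_powersetCard.1 T.2
      refine h1.2.symm.le.trans (Finset.card_le_card fun p hp => Finset.mem_filter.2
        ⟨h1.1 hp, (Finset.le_sup' (val θ) hp).trans hT'.symm.le⟩)

theorem GP.card_line_le (hY : GP Y) (θ z : ℝ) : (Y.filter fun p => val θ p = z).card ≤ 2 := by
  by_contra hc
  obtain ⟨a, b, c, ha, hb, hc, hab, hac, hbc⟩ := Finset.two_lt_card_iff.1 (not_le.1 hc)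
  rw [Finset.mem_filter] at ha hb hc
  refine hY a ha.1 b hb.1 c hc.1 hab hac hbc ?_
  have h1 : val θ b - val θ a = 0 := by rw [ha.2, hb.2]; ring
  have h2 : val θ c - val θ a = 0 := by rw [ha.2, hc.2]; ring
  have h3 := Real.sin_sq_add_cos_sq θ
  simp only [val] at h1 h2
  simp only [orient]
  linear_combination (norm := ring_nf)
    (Real.cos θ * (c.2 - a.2) - Real.sin θ * (c.1 - a.1)) * h1 -
      (Real.cos θ * (b.2 - a.2) - Real.sin θ * (b.1 - a.1)) * h2 -
      ((b.1 - a.1) * (c.2 - a.2) - (b.2 - a.2) * (c.1 - a.1)) * h3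

theorem nlt_add_line (Y : Finset Pt) (f : Pt → ℝ) (z : ℝ) :
    nlt Y f z + (Y.filter fun p => f p = z).card = nle Y f z := by
  rw [nlt, nle, ← Finset.card_union_of_disjoint]
  · congr 1
    ext p
    simp only [Finset.mem_union, Finset.mem_filter, ← and_or_left, le_iff_lt_or_eq]
  · exact Finset.disjoint_filter.2 fun p _ h1 h2 => h1.ne h2

/-- Cutting along the line at height `z`, with two points on it shared fairly. -/
theorem exists_split (hY : GP Y) (h1 : nlt Y (val θ) z ≤ k)
    (h2 : nlt Y (val θ) z = k ∨ k < nle Y (val θ) z) :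
    ∃ A B, Sep A B ∧ (∀ p, p ∈ Y ↔ p ∈ A ∨ p ∈ B) ∧ A.card = k ∧
      (∀ x ∈ A, ∀ y ∈ A, x ≠ y → val θ x + val θ y < 2 * z) ∧
      ∀ x ∈ B, ∀ y ∈ B, x ≠ y → 2 * z < val θ x + val θ y ∨
        (val θ x = z ∧ val θ y = z ∧ nlt Y (val θ) z = k) := by
  rcases eq_or_ne (nlt Y (val θ) z) k with hk | hk
  · refine ⟨Y.filter fun p => val θ p < z, Y.filter fun p => ¬ val θ p < z, ?_, ?_, hk, ?_, ?_⟩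
    · refine sep_lex ((isAff_const z).add (isAff_val θ).neg) (isAff_const (-1)) ?_ ?_
      · intro p hp
        have := (Finset.mem_filter.1 hp).2
        exact Or.inl (by linarith)
      · intro p hp
        have := (Finset.mem_filter.1 hp).2
        rcases (not_lt.1 this).lt_or_eq with h | h
        · exact Or.inl (by linarith)
        · exact Or.inr ⟨by linarith, by norm_num⟩
    · intro p
      simp only [Finset.mem_filter, ← and_or_left]
      exact ⟨fun h => ⟨h, em _⟩, fun h => h.1⟩
    · intro x hx y hy _
      have := (Finset.mem_filter.1 hx).2
      have := (Finset.mem_filter.1 hy).2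
      linarith
    · intro x hx y hy _
      have h3 := not_lt.1 (Finset.mem_filter.1 hx).2
      have h4 := not_lt.1 (Finset.mem_filter.1 hy).2
      by_cases h5 : 2 * z < val θ x + val θ y
      · exact Or.inl h5
      · exact Or.inr ⟨by linarith, by linarith, hk⟩
  · have h2 := h2.resolve_left hk
    have h3 := nlt_add_line Y (val θ) z
    have h4 := hY.card_line_le θ z
    have h5 : (Y.filter fun p => val θ p = z).card = 2 := by omega
    obtain ⟨x, y, hxy, hl⟩ := Finset.card_eq_two.1 h5
    have hline : ∀ p, p ∈ Y ∧ val θ p = z ↔ p = x ∨ p = y := fun p => by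
      rw [← Finset.mem_filter (p := fun p => val θ p = z), hl]; simp
    have hx := (hline x).2 (Or.inl rfl)
    have hy := (hline y).2 (Or.inr rfl)
    have hxn : x ∉ Y.filter fun p => val θ p < z := fun h =>
      (Finset.mem_filter.1 h).2.ne hx.2
    refine ⟨insert x (Y.filter fun p => val θ p < z), insert y (Y.filter fun p => z < val θ p),
      ?_, ?_, ?_, ?_, ?_⟩
    · set g : Pt → ℝ := fun p => Real.cos θ * p.2 - Real.sin θ * p.1 with hgd
      have hgne : g x ≠ g y := by
        intro h
        have hv : val θ x = val θ y := hx.2.trans hy.2.symm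
        have h6 := Real.sin_sq_add_cos_sq θ
        simp only [hgd] at h
        simp only [val] at hv
        apply hxy
        refine Prod.ext ?_ ?_
        · linear_combination Real.cos θ * hv - Real.sin θ * h - (x.1 - y.1) * h6
        · linear_combination Real.sin θ * hv + Real.cos θ * h - (x.2 - y.2) * h6
      have hpos : 0 < (g x - g y) ^ 2 := by
        have := sub_ne_zero.2 hgne
        positivity
      have hga : IsAff g := ⟨-Real.sin θ, Real.cos θ, 0, fun p => by simp only [hgd]; ring⟩
      refine sep_lex ((isAff_const z).add (isAff_val θ).neg)
        ((hga.add (isAff_const (-((g x + g y) / 2)))).smul (g x - g y)) ?_ ?_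
      · intro p hp
        rcases Finset.mem_insert.1 hp with rfl | hp
        · exact Or.inr ⟨by linarith [hx.2], by nlinarith⟩
        · have := (Finset.mem_filter.1 hp).2
          exact Or.inl (by linarith)
      · intro p hp
        rcases Finset.mem_insert.1 hp with rfl | hp
        · exact Or.inr ⟨by linarith [hy.2], by nlinarith⟩
        · have := (Finset.mem_filter.1 hp).2
          exact Or.inl (by linarith)
    · intro p
      rw [Finset.mem_insert, Finset.mem_insert, Finset.mem_filter, Finset.mem_filter]
      constructor
      · intro hp
        rcases lt_trichotomy (val θ p) z with h | h | h
        · exact Or.inl (Or.inr ⟨hp, h⟩)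
        · exact ((hline p).1 ⟨hp, h⟩).imp Or.inl Or.inl
        · exact Or.inr (Or.inr ⟨hp, h⟩)
      · rintro ((rfl | h) | (rfl | h))
        · exact hx.1
        · exact h.1
        · exact hy.1
        · exact h.1
    · rw [Finset.card_insert_of_notMem hxn]
      have : (Y.filter fun p => val θ p < z).card = nlt Y (val θ) z := rfl
      omega
    · have : ∀ p ∈ insert x (Y.filter fun p => val θ p < z), p ≠ x → val θ p < z :=
        fun p hp hpx => (Finset.mem_filter.1 ((Finset.mem_insert.1 hp).resolve_left hpx)).2
      intro p hp q hq hpq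
      rcases eq_or_ne p x with rfl | hpx
      · linarith [this q hq hpq.symm, hx.2]
      · rcases eq_or_ne q x with rfl | hqx
        · linarith [this p hp hpx, hx.2]
        · linarith [this p hp hpx, this q hq hqx]
    · have : ∀ p ∈ insert y (Y.filter fun p => z < val θ p), p ≠ y → z < val θ p :=
        fun p hp hpx => (Finset.mem_filter.1 ((Finset.mem_insert.1 hp).resolve_left hpx)).2
      intro p hp q hq hpq
      left
      rcases eq_or_ne p y with rfl | hpx
      · linarith [this q hq hpq.symm, hy.2]
      · rcases eq_or_ne q y with rfl | hqx
        · linarith [this p hp hpx, hy.2]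
        · linarith [this p hp hpx, this q hq hqx]

theorem isOpen_le_card_filter {ι : Type*} (E : Finset ι) (P : ι → ℝ → Prop)
    [∀ θ, DecidablePred fun e => P e θ] (hP : ∀ e ∈ E, IsOpen {θ | P e θ}) (k : ℕ) :
    IsOpen {θ | k ≤ (E.filter fun e => P e θ).card} := by
  rw [isOpen_iff_eventually]
  intro θ hθ
  have : ∀ᶠ t in nhds θ, ∀ e ∈ E.filter fun e => P e θ, P e t := by
    rw [Finset.eventually_all]
    intro e he
    rw [Finset.mem_filter] at he
    exact (hP e he.1).eventually_mem he.2
  filter_upwards [this] with t ht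
  exact le_trans hθ (Finset.card_le_card fun e he =>
    Finset.mem_filter.2 ⟨(Finset.mem_filter.1 he).1, ht e he⟩)

theorem forall_or_forall_of_isOpen {U V : Set ℝ} (hU : IsOpen U) (hV : IsOpen V)
    (hd : ∀ θ, θ ∈ U → θ ∉ V) (hc : ∀ θ, θ ∈ U ∨ θ ∈ V) : (∀ θ, θ ∈ U) ∨ ∀ θ, θ ∈ V :=
  (isPreconnected_univ.subset_or_subset hU hV (Set.disjoint_left.2 hd) (fun θ _ => hc θ)).imp
    (fun h θ => h (mem_univ θ)) fun h θ => h (mem_univ θ)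

/-- A continuous odd strict threshold that avoids `f` would contradict oddness. -/
theorem exists_eq_of_antiperiodic {f c : ℝ → ℝ} (hf : Continuous f) (hc : Continuous c)
    (hf' : ∀ θ, f (θ + Real.pi) = -f θ) (hc' : ∀ θ, c (θ + Real.pi) = -c θ) : ∃ θ, f θ = c θ := by
  by_contra h
  push Not at h
  rcases forall_or_forall_of_isOpen (isOpen_lt hf hc) (isOpen_lt hc hf)
    (fun θ (h1 : f θ < c θ) (h2 : c θ < f θ) => lt_asymm h1 h2) (fun θ => lt_or_gt_of_ne (h θ)) with h1 | h1
  all_goals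
    have h2 := h1 0
    have h3 := h1 (0 + Real.pi)
    simp only [Set.mem_ofPred_eq, hf', hc'] at h2 h3
    linarith

theorem card_inner_le {A Z : Finset Pt} (hl : ∀ e ∈ S, ¬ e.IsDiag) (hA : A ⊆ Z)
    {P : Sym2 Pt → Prop} [DecidablePred P]
    (h : ∀ x ∈ A, ∀ y ∈ A, x ≠ y → P s(x, y)) :
    (inner S A).card ≤ ((inner S Z).filter P).card := by
  refine Finset.card_le_card fun e he => Finset.mem_filter.2 ⟨inner_mono hA he, ?_⟩
  induction e using Sym2.ind with
  | _ x y =>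
  obtain ⟨h1, h2, h3⟩ := mem_inner.1 he
  exact h x h2 y h3 fun h => hl _ h1 (by simpa using h)

theorem exists_cut_of_even (hY : GP Y) (hl : ∀ e ∈ S, ¬ e.IsDiag) (hc : Y.card = 2 * m)
    (hm : 1 ≤ m) : ∃ A B, Sep A B ∧ (∀ p, p ∈ Y ↔ p ∈ A ∨ p ∈ B) ∧ A.card = m ∧
      2 * (inner S A).card ≤ (inner S Y).card ∧ 2 * (inner S B).card ≤ (inner S Y).card := by
  obtain ⟨u, hu, hu'⟩ := exists_ord Y hm (by omega)
  obtain ⟨w, hw, hw'⟩ := exists_ord Y (i := m + 1) (by omega) (by omega)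
  have hπ : ∀ θ, w (θ + Real.pi) = -u θ := fun θ => by
    refine (hw' _).eq ?_
    have := (hu' θ).neg (j := m + 1) (by omega)
    simpa only [← val_add_pi] using this
  have hπ' : ∀ θ, u (θ + Real.pi) = -w θ := fun θ => by
    refine (hu' _).eq ?_
    have := (hw' θ).neg (j := m) (by omega)
    simpa only [← val_add_pi] using this
  set E := inner S Y with hE
  obtain ⟨θ, h1, h2⟩ : ∃ θ, 2 * (E.filter fun e => esum θ e < u θ + w θ).card ≤ E.card ∧
      2 * (E.filter fun e => u θ + w θ < esum θ e).card ≤ E.card := by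
    by_contra! hcon
    have hsum : ∀ θ, (E.filter fun e => esum θ e < u θ + w θ).card +
        (E.filter fun e => u θ + w θ < esum θ e).card ≤ E.card := fun θ => by
      rw [← Finset.card_union_of_disjoint
        (Finset.disjoint_filter.2 fun e _ h1 h2 => lt_asymm h1 h2)]
      exact Finset.card_le_card (Finset.union_subset (Finset.filter_subset _ _)
        (Finset.filter_subset _ _))
    have hanti : ∀ θ, (E.filter fun e => esum (θ + Real.pi) e < u (θ + Real.pi) + w (θ + Real.pi)) =
        E.filter fun e => u θ + w θ < esum θ e := fun θ => by
      refine Finset.filter_congr fun e _ => ?_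
      rw [esum_add_pi, hπ, hπ']
      constructor <;> intro h <;> linarith
    have hanti' : ∀ θ, (E.filter fun e => u (θ + Real.pi) + w (θ + Real.pi) < esum (θ + Real.pi) e) =
        E.filter fun e => esum θ e < u θ + w θ := fun θ => by
      refine Finset.filter_congr fun e _ => ?_
      rw [esum_add_pi, hπ, hπ']
      constructor <;> intro h <;> linarith
    have hoL := isOpen_le_card_filter E (fun e θ => esum θ e < u θ + w θ)
      (fun e _ => isOpen_lt (continuous_esum e) (hu.add hw)) (E.card / 2 + 1)
    have hoR := isOpen_le_card_filter E (fun e θ => u θ + w θ < esum θ e)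
      (fun e _ => isOpen_lt (hu.add hw) (continuous_esum e)) (E.card / 2 + 1)
    rcases forall_or_forall_of_isOpen hoL hoR (fun θ h1 h2 => by
        have := hsum θ
        simp only [Set.mem_ofPred_eq] at h1 h2
        omega) (fun θ => by
        simp only [Set.mem_ofPred_eq]
        by_cases h : 2 * (E.filter fun e => esum θ e < u θ + w θ).card ≤ E.card
        · right; have := hcon θ h; omega
        · left; omega) with h | h
    all_goals
      have h1 := h 0
      have h2 := h (0 + Real.pi)
      have h3 := hsum 0
      simp only [Set.mem_ofPred_eq, hanti, hanti'] at h1 h2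
      omega
  have hou := hu' θ
  have how := hw' θ
  have huw := hou.le how (Nat.le_succ m)
  set z := (u θ + w θ) / 2 with hz
  have hz2 : u θ + w θ = 2 * z := by rw [hz]; ring
  have hs1 : nlt Y (val θ) z ≤ m := by
    have h3 := nlt_mono (Y := Y) (f := val θ) (z := z) (z' := w θ) (by linarith)
    have := how.1
    omega
  have hs2 : nlt Y (val θ) z = m ∨ m < nle Y (val θ) z := by
    rcases huw.lt_or_eq with h | h
    · left
      have h3 := nle_le_nlt (Y := Y) (f := val θ) (z := u θ) (z' := z) (by linarith)
      have := hou.2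
      omega
    · right
      have : z = w θ := by linarith
      rw [this]
      exact how.2
  obtain ⟨A, B, hsep, hAB, hAc, hA, hB⟩ := exists_split hY hs1 hs2
  refine ⟨A, B, hsep, hAB, hAc, le_trans (Nat.mul_le_mul_left _ ?_) h1,
    le_trans (Nat.mul_le_mul_left _ ?_) h2⟩
  · refine card_inner_le hl (fun p hp => (hAB p).2 (Or.inl hp)) fun x hx y hy hxy => ?_
    rw [esum_mk, hz2]
    exact hA x hx y hy hxy
  · refine card_inner_le hl (fun p hp => (hAB p).2 (Or.inr hp)) fun x hx y hy hxy => ?_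
    rw [esum_mk, hz2]
    refine (hB x hx y hy hxy).resolve_right ?_
    rintro ⟨h3, h4, h5⟩
    rcases huw.lt_or_eq with h | h
    · have h6 := nle_le_nlt (Y := Y) (f := val θ) (z := z) (z' := w θ) (by linarith)
      have h7 := how.1
      have h8 := nlt_add_line Y (val θ) z
      have h9 : 0 < (Y.filter fun p => val θ p = z).card :=
        Finset.card_pos.2 ⟨x, Finset.mem_filter.2 ⟨(hAB x).2 (Or.inr hx), h3⟩⟩
      omega
    · have : z = u θ := by linarith
      have := hou.1
      simp_all

end PlaneMatching

namespace PlaneMatching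

variable {S : Finset (Sym2 Pt)} {Y : Finset Pt} {m i j k α : ℕ} {f : Pt → ℝ} {z z' θ : ℝ}

/-- The edge `e` lies beyond the line of height `u`, or on it when this is the middle line. -/
def Beyond (u w : ℝ → ℝ) (e : Sym2 Pt) (θ : ℝ) : Prop :=
  2 * u θ < esum θ e ∨ (∀ p ∈ e, val θ p = u θ) ∧ w θ = u θ

theorem Beyond.le {u w : ℝ → ℝ} {e : Sym2 Pt} (h : Beyond u w e θ) : 2 * u θ ≤ esum θ e := by
  rcases h with h | ⟨h, -⟩
  · exact h.le
  · induction e using Sym2.ind with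
    | _ x y =>
    have h1 := h x (by simp)
    have h2 := h y (by simp)
    rw [esum_mk]
    linarith

theorem isOpen_beyond (hY : GP Y) {u w : ℝ → ℝ} (hu : Continuous u)
    (hu' : ∀ θ, IsOrd Y (val θ) m (u θ)) (hw' : ∀ θ, IsOrd Y (val θ) (m + 1) (w θ)) {x y : Pt}
    (hx : x ∈ Y) (hy : y ∈ Y) (hxy : x ≠ y) : IsOpen {θ | Beyond u w s(x, y) θ} := by
  rw [isOpen_iff_eventually]
  rintro θ (h | ⟨h, hwu⟩)
  · filter_upwards [(isOpen_lt (continuous_const.mul hu) (continuous_esum s(x, y))).eventually_mem h]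
      with t ht using Or.inl ht
  · have hxu := h x (by simp)
    have hyu := h y (by simp)
    have hou := hu' θ
    have how := hw' θ
    rw [hwu] at how
    have hline := nlt_add_line Y (val θ) (u θ)
    have hle := hY.card_line_le θ (u θ)
    have hcard : (Y.filter fun p => val θ p < u θ).card = m - 1 := by
      have : nlt Y (val θ) (u θ) = m - 1 := by
        have := hou.1
        have := how.2
        omega
      exact this
    have hm : 1 ≤ m := by have := hou.1; omega
    have hev : ∀ᶠ t in nhds θ, ∀ p ∈ Y.filter fun p => val θ p < u θ,
        val t p < val t x ∧ val t p < val t y := by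
      rw [Finset.eventually_all]
      intro p hp
      have hp := (Finset.mem_filter.1 hp).2
      exact ((isOpen_lt (continuous_val p) (continuous_val x)).eventually_mem
        (show val θ p < val θ x by rw [hxu]; exact hp)).and
        ((isOpen_lt (continuous_val p) (continuous_val y)).eventually_mem
        (show val θ p < val θ y by rw [hyu]; exact hp))
    have hxn : x ∉ Y.filter fun p => val θ p < u θ := fun h => (Finset.mem_filter.1 h).2.ne hxu
    have hyn : y ∉ Y.filter fun p => val θ p < u θ := fun h => (Finset.mem_filter.1 h).2.ne hyu
    filter_upwards [hev] with t ht
    have hx1 : m ≤ nle Y (val t) (val t x) := by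
      have : (insert x (Y.filter fun p => val θ p < u θ)).card = m := by
        rw [Finset.card_insert_of_notMem hxn]; omega
      refine this.symm.le.trans (Finset.card_le_card fun p hp => Finset.mem_filter.2 ?_)
      rcases Finset.mem_insert.1 hp with rfl | hp
      · exact ⟨hx, le_rfl⟩
      · exact ⟨(Finset.mem_filter.1 hp).1, (ht p hp).1.le⟩
    have hy1 : m ≤ nle Y (val t) (val t y) := by
      have : (insert y (Y.filter fun p => val θ p < u θ)).card = m := by
        rw [Finset.card_insert_of_notMem hyn]; omega
      refine this.symm.le.trans (Finset.card_le_card fun p hp => Finset.mem_filter.2 ?_)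
      rcases Finset.mem_insert.1 hp with rfl | hp
      · exact ⟨hy, le_rfl⟩
      · exact ⟨(Finset.mem_filter.1 hp).1, (ht p hp).2.le⟩
    have hle : ∀ {z}, m ≤ nle Y (val t) z → u t ≤ z := fun {z} h => by
      by_contra hc
      have := nle_le_nlt (Y := Y) (f := val t) (not_le.1 hc)
      have := (hu' t).1
      omega
    have hx2 := hle hx1
    have hy2 := hle hy1
    by_cases hlt : 2 * u t < val t x + val t y
    · exact Or.inl hlt
    have hx3 : val t x = u t := by linarith
    have hy3 : val t y = u t := by linarith
    refine Or.inr ⟨fun p hp => ?_, ?_⟩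
    · rcases Sym2.mem_iff.1 hp with rfl | rfl
      · exact hx3
      · exact hy3
    · have hc : m + 1 ≤ nle Y (val t) (u t) := by
        have : (insert x (insert y (Y.filter fun p => val θ p < u θ))).card = m + 1 := by
          rw [Finset.card_insert_of_notMem, Finset.card_insert_of_notMem hyn]
          · omega
          · rw [Finset.mem_insert]
            exact fun h => h.elim hxy hxn
        refine this.symm.le.trans (Finset.card_le_card fun p hp => Finset.mem_filter.2 ?_)
        rcases Finset.mem_insert.1 hp with rfl | hp
        · exact ⟨hx, hx3.le⟩
        rcases Finset.mem_insert.1 hp with rfl | hp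
        · exact ⟨hy, hy3.le⟩
        · exact ⟨(Finset.mem_filter.1 hp).1, hx3 ▸ (ht p hp).1.le⟩
      exact (hw' t).eq ⟨by have := (hu' t).1; omega, hc⟩

theorem exists_cut_of_odd (hY : GP Y) (hl : ∀ e ∈ S, ¬ e.IsDiag) (hc : Y.card = 2 * m)
    (hm : 1 ≤ m) (hB : (inner S Y).card ≤ 2 * α + 2) :
    ∃ A B, Sep A B ∧ (∀ p, p ∈ Y ↔ p ∈ A ∨ p ∈ B) ∧ A.card = m - 1 ∧
      (inner S A).card ≤ α ∧ (inner S B).card ≤ α + 1 := by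
  classical
  obtain ⟨u, hu, hu'⟩ := exists_ord Y hm (by omega)
  obtain ⟨w, hw, hw'⟩ := exists_ord Y (i := m + 1) (by omega) (by omega)
  have hπ : ∀ θ, w (θ + Real.pi) = -u θ := fun θ => by
    refine (hw' _).eq ?_
    have := (hu' θ).neg (j := m + 1) (by omega)
    simpa only [← val_add_pi] using this
  have hπ' : ∀ θ, u (θ + Real.pi) = -w θ := fun θ => by
    refine (hu' _).eq ?_
    have := (hw' θ).neg (j := m) (by omega)
    simpa only [← val_add_pi] using this
  have huw : ∀ θ, u θ ≤ w θ := fun θ => (hu' θ).le (hw' θ) (Nat.le_succ m)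
  set E := inner S Y with hE
  obtain ⟨θ, h1, h2⟩ : ∃ θ, (E.filter fun e => esum θ e < 2 * u θ).card ≤ α ∧
      (E.filter fun e => Beyond u w e θ).card ≤ α + 1 := by
    by_contra! hcon
    have hoL := isOpen_le_card_filter E (fun e θ => esum θ e < 2 * u θ)
      (fun e _ => isOpen_lt (continuous_esum e) (continuous_const.mul hu)) (α + 1)
    have hoR := isOpen_le_card_filter E (fun e θ => Beyond u w e θ)
      (fun e he => by
        induction e using Sym2.ind with
        | _ x y =>
        obtain ⟨h1, h2, h3⟩ := mem_inner.1 he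
        exact isOpen_beyond hY hu hu' hw' h2 h3 fun h => hl _ h1 (by simpa using h)) (α + 2)
    rcases forall_or_forall_of_isOpen hoL hoR (fun θ h1 h2 => by
        have : (E.filter fun e => esum θ e < 2 * u θ).card +
            (E.filter fun e => Beyond u w e θ).card ≤ E.card := by
          rw [← Finset.card_union_of_disjoint
            (Finset.disjoint_filter.2 fun e _ h1 h2 => absurd h1 (not_lt.2 h2.le))]
          exact Finset.card_le_card (Finset.union_subset (Finset.filter_subset _ _)
            (Finset.filter_subset _ _))
        simp only [Set.mem_ofPred_eq] at h1 h2
        omega) (fun θ => by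
        simp only [Set.mem_ofPred_eq]
        by_cases h : (E.filter fun e => esum θ e < 2 * u θ).card ≤ α
        · right; have := hcon θ h; omega
        · left; omega) with h | h
    · have hE0 : E.Nonempty := by
        have h0 : α + 1 ≤ _ := h 0
        have := Finset.card_le_card (Finset.filter_subset (fun e => esum 0 e < 2 * u 0) E)
        exact Finset.card_pos.1 (by omega)
      obtain ⟨e, he⟩ := hE0
      obtain ⟨θ, hθ⟩ := exists_eq_of_antiperiodic (c := fun θ => u θ + w θ) (continuous_esum e)
        (hu.add hw)
        (fun θ => esum_add_pi θ e) (fun θ => by rw [hπ, hπ']; ring)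
      have h1 : α + 1 ≤ (E.filter fun e => esum θ e < 2 * u θ).card := h θ
      have h2 : α + 1 ≤ (E.filter fun e => 2 * w θ < esum θ e).card := by
        have h2 : α + 1 ≤ _ := h (θ + Real.pi)
        have h3 : (E.filter fun e => esum (θ + Real.pi) e < 2 * u (θ + Real.pi)) =
            E.filter fun e => 2 * w θ < esum θ e := by
          refine Finset.filter_congr fun e _ => ?_
          rw [esum_add_pi, hπ']
          constructor <;> intro h <;> linarith
        rwa [h3] at h2
      have hθ' := huw θ
      have h3 : (E.filter fun e => esum θ e < 2 * u θ) ∪ (E.filter fun e => 2 * w θ < esum θ e) = E := by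
        refine Finset.eq_of_subset_of_card_le (Finset.union_subset (Finset.filter_subset _ _)
            (Finset.filter_subset _ _)) ?_
        rw [Finset.card_union_of_disjoint
          (Finset.disjoint_filter.2 fun e _ h1 h2 => by linarith)]
        omega
      rw [← h3, Finset.mem_union, Finset.mem_filter, Finset.mem_filter] at he
      rcases he with he | he <;> linarith [he.2]
    · obtain ⟨p, hp⟩ : Y.Nonempty := Finset.card_pos.1 (by omega)
      obtain ⟨θ, hθ⟩ := exists_eq_of_antiperiodic (f := fun θ => 2 * val θ p)
        (c := fun θ => u θ + w θ)
        (continuous_const.mul (continuous_val p)) (hu.add hw)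
        (fun θ => by rw [val_add_pi]; ring) (fun θ => by rw [hπ, hπ']; ring)
      have htie : w θ = u θ := by
        by_contra hne
        have hlt := lt_of_le_of_ne (huw θ) (Ne.symm hne)
        have h1 := nle_le_nlt (Y := Y) (f := val θ) (z := u θ) (z' := val θ p) (by linarith)
        have h2 := nle_le_nlt (Y := Y) (f := val θ) (z := val θ p) (z' := w θ) (by linarith)
        have h3 := nlt_add_line Y (val θ) (val θ p)
        have h4 : 0 < (Y.filter fun q => val θ q = val θ p).card :=
          Finset.card_pos.2 ⟨p, Finset.mem_filter.2 ⟨hp, rfl⟩⟩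
        have := (hu' θ).2
        have := (hw' θ).1
        omega
      have h1 : α + 2 ≤ (E.filter fun e => Beyond u w e θ).card := h θ
      have h2 : α + 2 ≤ (E.filter fun e => Beyond u w e (θ + Real.pi)).card := h (θ + Real.pi)
      have h3 := Finset.card_union_add_card_inter (E.filter fun e => Beyond u w e θ)
        (E.filter fun e => Beyond u w e (θ + Real.pi))
      have h4 : ((E.filter fun e => Beyond u w e θ) ∪
          (E.filter fun e => Beyond u w e (θ + Real.pi))).card ≤ E.card :=
        Finset.card_le_card (Finset.union_subset (Finset.filter_subset _ _)
            (Finset.filter_subset _ _))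
      have h5 : ((E.filter fun e => Beyond u w e θ) ∩
          (E.filter fun e => Beyond u w e (θ + Real.pi))).card ≤ 1 := by
        have key : ∀ x y, s(x, y) ∈ (E.filter fun e => Beyond u w e θ) ∩
            (E.filter fun e => Beyond u w e (θ + Real.pi)) →
            x ∈ (Y.filter fun p => val θ p = u θ) ∧ y ∈ (Y.filter fun p => val θ p = u θ) ∧ x ≠ y := by
          intro x y he
          rw [Finset.mem_inter, Finset.mem_filter, Finset.mem_filter] at he
          obtain ⟨⟨hE1, hb⟩, -, hb'⟩ := he
          obtain ⟨h1, h2, h3⟩ := mem_inner.1 hE1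
          have h6 := hb'.le
          rw [esum_add_pi, hπ', htie] at h6
          rcases hb with hb | ⟨hb, -⟩
          · linarith
          · exact ⟨Finset.mem_filter.2 ⟨h2, hb x (by simp)⟩,
              Finset.mem_filter.2 ⟨h3, hb y (by simp)⟩, fun h => hl _ h1 (by simpa using h)⟩
        refine Finset.card_le_one.2 fun e he e' he' => ?_
        induction e using Sym2.ind with
        | _ x y =>
        induction e' using Sym2.ind with
        | _ x' y' =>
        obtain ⟨hx, hy, hxy⟩ := key x y he
        obtain ⟨hx', hy', hxy'⟩ := key x' y' he'
        have hline : (Y.filter fun p => val θ p = u θ) = {x, y} := by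
          symm
          refine Finset.eq_of_subset_of_card_le ?_ ?_
          · intro p hp
            rcases Finset.mem_insert.1 hp with rfl | hp
            · exact hx
            · rw [Finset.mem_singleton.1 hp]; exact hy
          · rw [Finset.card_pair hxy]; exact hY.card_line_le θ (u θ)
        rw [hline, Finset.mem_insert, Finset.mem_singleton] at hx' hy'
        rcases hx' with rfl | rfl <;> rcases hy' with rfl | rfl
        · exact absurd rfl hxy'
        · rfl
        · exact Sym2.eq_swap
        · exact absurd rfl hxy'
      omega
  have hou := hu' θ
  obtain ⟨A, B, hsep, hAB, hAc, hA, hB⟩ := exists_split (k := m - 1) (θ := θ) (z := u θ) hY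
    (by have := hou.1; omega) (Or.inr (by have := hou.2; omega))
  refine ⟨A, B, hsep, hAB, hAc, le_trans ?_ h1, le_trans ?_ h2⟩
  · exact card_inner_le hl (fun p hp => (hAB p).2 (Or.inl hp)) hA
  · refine card_inner_le hl (fun p hp => (hAB p).2 (Or.inr hp)) fun x hx y hy hxy => ?_
    rcases hB x hx y hy hxy with h | ⟨h3, h4, h5⟩
    · exact Or.inl h
    · refine Or.inr ⟨fun p hp => ?_, ?_⟩
      · rcases Sym2.mem_iff.1 hp with rfl | rfl
        · exact h3
        · exact h4
      · have h6 := nlt_add_line Y (val θ) (u θ)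
        have h7 : 2 ≤ (Y.filter fun p => val θ p = u θ).card := by
          rw [← Finset.card_pair hxy]
          refine Finset.card_le_card fun p hp => ?_
          rcases Finset.mem_insert.1 hp with rfl | hp
          · exact Finset.mem_filter.2 ⟨(hAB _).2 (Or.inr hx), h3⟩
          · rw [Finset.mem_singleton.1 hp]
            exact Finset.mem_filter.2 ⟨(hAB _).2 (Or.inr hy), h4⟩
        exact (hw' θ).eq ⟨by omega, by omega⟩

/-- Repeated halving reduces a mild excess of edges to none. -/
theorem unbl_of_pieces {P : Finset Pt → Prop} (hl : ∀ e ∈ S, ¬ e.IsDiag)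
    (hP : ∀ Y A B, P Y → Sep A B → (∀ p, p ∈ Y ↔ p ∈ A ∨ p ∈ B) → P A) {κ κ' : ℕ} (hκ : 1 ≤ κ)
    (hbase : ∀ Y m, P Y → GP Y → Y.card = 2 * m → κ ≤ m → m ≤ κ' → (inner S Y).card ≤ m → Unbl S Y) :
    ∀ d Y m, P Y → GP Y → Y.card = 2 * m → 2 ^ d * κ ≤ m → m ≤ 2 ^ d * κ' →
      (inner S Y).card + 1 ≤ m + 2 ^ d → Unbl S Y := by
  intro d
  induction d with
  | zero =>
    intro Y m hPY hY hc h1 h2 h3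
    exact hbase Y m hPY hY hc (by simpa using h1) (by simpa using h2) (by simpa using h3)
  | succ d ih =>
    intro Y m hPY hY hc h1 h2 h3
    rw [pow_succ] at h1 h2 h3
    have hd : 0 < 2 ^ d := by positivity
    have hdκ : 0 < 2 ^ d * κ := by positivity
    have e1 : 2 ^ d * 2 * κ = 2 * (2 ^ d * κ) := by ring
    have e2 : 2 ^ d * 2 * κ' = 2 * (2 ^ d * κ') := by ring
    rw [e1] at h1
    rw [e2] at h2
    have hcard : ∀ {A B : Finset Pt}, Sep A B → (∀ p, p ∈ Y ↔ p ∈ A ∨ p ∈ B) →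
        A.card + B.card = Y.card := fun {A B} hsep hAB => by
      rw [← Finset.card_union_of_disjoint hsep.disjoint]
      congr 1
      ext p
      rw [Finset.mem_union, hAB]
    rcases Nat.even_or_odd' m with ⟨t, rfl | rfl⟩
    · obtain ⟨A, B, hsep, hAB, hAc, hA, hB⟩ := exists_cut_of_even hY hl hc (by omega)
      have hs := hcard hsep hAB
      have hAY : A ⊆ Y := fun p hp => (hAB p).2 (Or.inl hp)
      have hBY : B ⊆ Y := fun p hp => (hAB p).2 (Or.inr hp)
      exact (ih A t (hP Y A B hPY hsep hAB) (hY.mono hAY) (by omega) (by omega) (by omega)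
        (by omega)).of_sep (ih B t (hP Y B A hPY hsep.symm fun p => (hAB p).trans or_comm)
        (hY.mono hBY) (by omega) (by omega) (by omega) (by omega)) hsep hAB
    · obtain ⟨A, B, hsep, hAB, hAc, hA, hB⟩ := exists_cut_of_odd (α := t + 2 ^ d - 1) hY hl hc
        (by omega) (by omega)
      have hs := hcard hsep hAB
      have hAY : A ⊆ Y := fun p hp => (hAB p).2 (Or.inl hp)
      have hBY : B ⊆ Y := fun p hp => (hAB p).2 (Or.inr hp)
      exact (ih A t (hP Y A B hPY hsep hAB) (hY.mono hAY) (by omega) (by omega) (by omega)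
        (by omega)).of_sep (ih B (t + 1) (hP Y B A hPY hsep.symm fun p => (hAB p).trans or_comm)
        (hY.mono hBY) (by omega) (by omega) (by omega) (by omega)) hsep hAB

end PlaneMatching

namespace PlaneMatching

variable {S : Finset (Sym2 Pt)} {X Y : Finset Pt} {m k : ℕ} {a b c p q : Pt}

theorem HV.false_of_comb (h : HV Y q) (ha : a ∈ Y) (hb : b ∈ Y) (hc : c ∈ Y) (hp : p ∈ Y)
    (ha' : a ≠ q) (hb' : b ≠ q) (hc' : c ≠ q) (hp' : p ≠ q) {wa wb wc wp : ℝ}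
    (h1 : 0 ≤ wa) (h2 : 0 ≤ wb) (h3 : 0 ≤ wc) (h4 : 0 ≤ wp) (hpos : 0 < wa + wb + wc + wp)
    (hx : wa * (a.1 - q.1) + wb * (b.1 - q.1) + wc * (c.1 - q.1) + wp * (p.1 - q.1) = 0)
    (hy : wa * (a.2 - q.2) + wb * (b.2 - q.2) + wc * (c.2 - q.2) + wp * (p.2 - q.2) = 0) :
    False := by
  obtain ⟨-, α, β, h⟩ := h
  have ka := h a ha ha'
  have kb := h b hb hb'
  have kc := h c hc hc'
  have kp := h p hp hp'
  obtain ⟨δ, hδ, h5, h6, h7, h8⟩ : ∃ δ > 0, δ ≤ α * (a.1 - q.1) + β * (a.2 - q.2) ∧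
      δ ≤ α * (b.1 - q.1) + β * (b.2 - q.2) ∧ δ ≤ α * (c.1 - q.1) + β * (c.2 - q.2) ∧
      δ ≤ α * (p.1 - q.1) + β * (p.2 - q.2) :=
    ⟨_, lt_min (lt_min (lt_min ka kb) kc) kp,
      (min_le_left _ _).trans ((min_le_left _ _).trans (min_le_left _ _)),
      (min_le_left _ _).trans ((min_le_left _ _).trans (min_le_right _ _)),
      (min_le_left _ _).trans (min_le_right _ _), min_le_right _ _⟩
  have h9 := mul_le_mul_of_nonneg_left h5 h1
  have h10 := mul_le_mul_of_nonneg_left h6 h2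
  have h11 := mul_le_mul_of_nonneg_left h7 h3
  have h12 := mul_le_mul_of_nonneg_left h8 h4
  have h13 : wa * (α * (a.1 - q.1) + β * (a.2 - q.2)) + wb * (α * (b.1 - q.1) + β * (b.2 - q.2)) +
      wc * (α * (c.1 - q.1) + β * (c.2 - q.2)) + wp * (α * (p.1 - q.1) + β * (p.2 - q.2)) = 0 := by
    linear_combination α * hx + β * hy
  have := mul_pos hpos hδ
  linarith

/-- A hull vertex does not lie below a chord of the hull. -/
theorem HV.lt_of_between (h : HV Y q) (ha : a ∈ Y) (hb : b ∈ Y) (hc : c ∈ Y) (hp : p ∈ Y)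
    (ha' : a ≠ q) (hb' : b ≠ q) (hc' : c ≠ q) (hp' : p ≠ q) (hab : a.1 < b.1) (haq : a.1 ≤ q.1)
    (hqb : q.1 ≤ b.1) {ε t : ℝ} (ht0 : 0 ≤ t) (ht1 : t ≤ 1) (ht : q.1 = (1 - t) * p.1 + t * c.1)
    (hq0 : 0 < ε * orient a b q) (hpc : ε * orient a b p ≤ ε * orient a b c) :
    ε * orient a b p < ε * orient a b q := by
  by_contra hcon
  rw [not_lt] at hcon
  set ρ := (1 - t) * (ε * orient a b p) + t * (ε * orient a b c) with hρ
  have hρq : ε * orient a b q ≤ ρ := by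
    have := mul_le_mul_of_nonneg_left hcon (sub_nonneg.2 ht1)
    have := mul_le_mul_of_nonneg_left (hcon.trans hpc) ht0
    linarith
  have hD : 0 < b.1 - a.1 := by linarith
  have hw1 : 0 ≤ (ρ - ε * orient a b q) * (b.1 - q.1) := mul_nonneg (by linarith) (by linarith)
  have hw2 : 0 ≤ (ρ - ε * orient a b q) * (q.1 - a.1) := mul_nonneg (by linarith) (by linarith)
  have hw3 : 0 ≤ ε * orient a b q * t * (b.1 - a.1) := by positivity
  have hw4 : 0 ≤ ε * orient a b q * (1 - t) * (b.1 - a.1) :=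
    mul_nonneg (mul_nonneg hq0.le (by linarith)) hD.le
  refine h.false_of_comb ha hb hc hp ha' hb' hc' hp' hw1 hw2 hw3 hw4 ?_ ?_ ?_
  · have : 0 < ρ * (b.1 - a.1) := mul_pos (by linarith) hD
    linarith
  · linear_combination (-(ε * orient a b q * (b.1 - a.1))) * ht
  · simp only [hρ, orient]
    linear_combination
      (-(ε * (b.2 - a.2) * ((b.1 - a.1) * (q.2 - a.2) - (b.2 - a.2) * (q.1 - a.1)))) * ht

/-- The points `f` form a monotone chain in the box spanned by `a`, `b`, `c`. -/
def Chain (a b c : Pt) (f : Fin k → Pt) : Prop :=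
  (∀ i, (f i).1 ∈ Icc a.1 b.1 ∧ orient a b (f i) ∈ uIcc 0 (orient a b c)) ∧
    StrictMono (fun i => (f i).1) ∧
    (StrictMono (fun i => orient a b (f i)) ∨ StrictAnti fun i => orient a b (f i))

/-- A parallelogram inscribed in the triangle `a b c`. -/
def para (a b c : Pt) : Set Pt :=
  {p | p.1 ∈ Icc ((a.1 + c.1) / 2) ((b.1 + c.1) / 2) ∧
    orient a b p ∈ uIcc 0 (orient a b c / 2)}

theorem para_subset (hab : a.1 < b.1) (hc0 : orient a b c ≠ 0) (hac : a.1 ≤ c.1)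
    (hcb : c.1 ≤ b.1) {s : Set Pt} (hs : Convex ℝ s) (ha : a ∈ s) (hb : b ∈ s) (hc : c ∈ s) :
    para a b c ⊆ s := by
  rintro p ⟨⟨h1, h2⟩, h3⟩
  have hD : 0 < b.1 - a.1 := by linarith
  obtain ⟨t, ht0, ht1, ht⟩ : ∃ t, 0 ≤ t ∧ t ≤ 1 / 2 ∧ orient a b p = t * orient a b c := by
    refine ⟨orient a b p / orient a b c, ?_, ?_, by field_simp⟩
    · rcases lt_or_gt_of_ne hc0 with h | h
      · rw [uIcc_of_ge (by linarith)] at h3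
        exact div_nonneg_of_nonpos h3.2 h.le
      · rw [uIcc_of_le (by linarith)] at h3
        exact div_nonneg h3.1 h.le
    · rcases lt_or_gt_of_ne hc0 with h | h
      · rw [uIcc_of_ge (by linarith)] at h3
        rw [div_le_iff_of_neg h]; linarith [h3.1]
      · rw [uIcc_of_le (by linarith)] at h3
        rw [div_le_iff₀ h]; linarith [h3.2]
  set wa := ((1 - t) * b.1 + t * c.1 - p.1) / (b.1 - a.1) with hwa
  set wb := (p.1 - ((1 - t) * a.1 + t * c.1)) / (b.1 - a.1) with hwb
  have hwa' : wa * (b.1 - a.1) = (1 - t) * b.1 + t * c.1 - p.1 := by rw [hwa]; field_simp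
  have hwb' : wb * (b.1 - a.1) = p.1 - ((1 - t) * a.1 + t * c.1) := by rw [hwb]; field_simp
  have hwa0 : 0 ≤ wa := div_nonneg (by nlinarith) hD.le
  have hwb0 : 0 ≤ wb := div_nonneg (by nlinarith) hD.le
  have hsum : wa + wb + t = 1 := by
    have : (wa + wb + t - 1) * (b.1 - a.1) = 0 := by linear_combination hwa' + hwb'
    rcases mul_eq_zero.1 this with h | h <;> linarith
  have hp : p = wa • a + wb • b + t • c := by
    have hx : p.1 = wa * a.1 + wb * b.1 + t * c.1 := by
      have : (p.1 - (wa * a.1 + wb * b.1 + t * c.1)) * (b.1 - a.1) = 0 := by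
        linear_combination (-a.1) * hwa' - b.1 * hwb'
      rcases mul_eq_zero.1 this with h | h <;> linarith
    have hy : p.2 = wa * a.2 + wb * b.2 + t * c.2 := by
      have : (p.2 - (wa * a.2 + wb * b.2 + t * c.2)) * (b.1 - a.1) = 0 := by
        simp only [orient] at ht
        linear_combination ht + (b.2 - a.2) * hx + (b.2 * a.1 - a.2 * b.1) * hsum
      rcases mul_eq_zero.1 this with h | h <;> linarith
    exact Prod.ext (by simpa using hx) (by simpa using hy)
  rw [hp]
  have := hs.sum_mem (t := Finset.univ) (w := ![wa, wb, t]) (z := ![a, b, c])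
    (by intro i _; fin_cases i; exacts [hwa0, hwb0, ht0])
    (by simp [Fin.sum_univ_succ]; linarith)
    (by intro i _; fin_cases i; exacts [ha, hb, hc])
  simpa [Fin.sum_univ_succ, add_assoc] using this

theorem exists_strictMono_of_card_le {ι : Type*} (T : Finset ι) {g : ι → ℝ} (hg : InjOn g T)
    (hk : k ≤ T.card) : ∃ f : Fin k → ι, (∀ i, f i ∈ T) ∧ StrictMono fun i => g (f i) := by
  classical
  have hc : (T.image g).card = T.card := Finset.card_image_of_injOn hg
  have h : ∀ i : Fin k, ∃ p ∈ T, g p = (T.image g).orderEmbOfFin hc (Fin.castLE hk i) := fun i =>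
    Finset.mem_image.1 (Finset.orderEmbOfFin_mem _ hc _)
  choose f hf hf' using h
  refine ⟨f, hf, fun i j hij => ?_⟩
  simp only [hf']
  exact ((T.image g).orderEmbOfFin hc).strictMono hij

theorem exists_chain (hY : GP Y) (h : 4 * k + 4 ≤ (hull Y).card) :
    ∃ a ∈ Y, ∃ b ∈ Y, ∃ c ∈ Y, ∃ f : Fin k → Pt, a.1 < b.1 ∧ c.1 ∈ Icc a.1 b.1 ∧
      orient a b c ≠ 0 ∧ Chain a b c f ∧ ∀ i, f i ∈ Y ∧ f i ≠ a ∧ f i ≠ b ∧ f i ≠ c := by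
  classical
  have hJY : hull Y ⊆ Y := fun p hp => (mem_hull.1 hp).1
  have hcard := Finset.card_le_card hJY
  have hne : Y.Nonempty := Finset.card_pos.1 (by omega)
  obtain ⟨a, ha, hamin⟩ := Finset.exists_min_image Y (fun p => p.1) hne
  obtain ⟨b, hb, hbmax⟩ := Finset.exists_max_image Y (fun p => p.1) hne
  have hab : a.1 < b.1 := by
    by_contra hc
    obtain ⟨x, y, z, hx, hy, hz, hxy, hxz, hyz⟩ := Finset.two_lt_card_iff.1 (show 2 < Y.card by omega)
    refine hY x hx y hy z hz hxy hxz hyz ?_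
    have hall : ∀ p ∈ Y, p.1 = a.1 := fun p hp => by
      have := hamin p hp
      have := hbmax p hp
      linarith
    simp only [orient, hall x hx, hall y hy, hall z hz]
    ring
  have hab' : a ≠ b := fun h => hab.ne (h ▸ rfl)
  set J := (hull Y).erase a |>.erase b with hJ
  have hJc : 4 * k + 2 ≤ J.card := by
    have h1 := Finset.pred_card_le_card_erase (s := hull Y) (a := a)
    have h2 := Finset.pred_card_le_card_erase (s := (hull Y).erase a) (a := b)
    rw [← hJ] at h2
    omega
  have hJm : ∀ p ∈ J, HV Y p ∧ p ≠ a ∧ p ≠ b := fun p hp => by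
    obtain ⟨h1, h2⟩ := Finset.mem_erase.1 hp
    obtain ⟨h3, h4⟩ := Finset.mem_erase.1 h2
    exact ⟨mem_hull.1 h4, h3, h1⟩
  obtain ⟨ε, hε, hJε⟩ : ∃ ε : ℝ, (ε = 1 ∨ ε = -1) ∧
      2 * k + 1 ≤ (J.filter fun p => 0 < ε * orient a b p).card := by
    by_contra! hcon
    have h1 := hcon 1 (Or.inl rfl)
    have h2 := hcon (-1) (Or.inr rfl)
    have h3 : J ⊆ (J.filter fun p => 0 < 1 * orient a b p) ∪
        J.filter fun p => 0 < -1 * orient a b p := by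
      intro p hp
      have hp' := hJm p hp
      rw [Finset.mem_union, Finset.mem_filter, Finset.mem_filter]
      rcases lt_or_gt_of_ne (hY a ha b hb p hp'.1.1 hab' hp'.2.1.symm hp'.2.2.symm) with h | h
      · exact Or.inr ⟨hp, by linarith⟩
      · exact Or.inl ⟨hp, by linarith⟩
    have := (Finset.card_le_card h3).trans (Finset.card_union_le _ _)
    omega
  obtain ⟨c, hc, hcmax⟩ := Finset.exists_max_image Y (fun p => ε * orient a b p) hne
  set T := (J.filter fun p => 0 < ε * orient a b p).erase c with hT
  have hTm : ∀ p ∈ T, HV Y p ∧ p ≠ a ∧ p ≠ b ∧ 0 < ε * orient a b p ∧ p ≠ c := fun p hp => by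
    obtain ⟨h1, h2⟩ := Finset.mem_erase.1 hp
    obtain ⟨h3, h4⟩ := Finset.mem_filter.1 h2
    obtain ⟨h5, h6, h7⟩ := hJm p h3
    exact ⟨h5, h6, h7, h4, h1⟩
  have hTc : 2 * k ≤ T.card := by
    have := Finset.pred_card_le_card_erase (s := J.filter fun p => 0 < ε * orient a b p) (a := c)
    rw [← hT] at this
    omega
  have hc0 : 0 < ε * orient a b c := by
    obtain ⟨p, hp⟩ := Finset.card_pos.1 (show 0 < (J.filter fun p => 0 < ε * orient a b p).card by omega)
    obtain ⟨h3, h4⟩ := Finset.mem_filter.1 hp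
    exact h4.trans_le (hcmax p (hJm p h3).1.1)
  have key : ∀ p ∈ T, ∀ q ∈ T, p ≠ q → ∀ t : ℝ, 0 ≤ t → t ≤ 1 → q.1 = (1 - t) * p.1 + t * c.1 →
      ε * orient a b p < ε * orient a b q := by
    intro p hp q hq hpq t ht0 ht1 ht
    obtain ⟨h1, h2, h3, h4, h5⟩ := hTm q hq
    obtain ⟨g1, -⟩ := hTm p hp
    exact h1.lt_of_between ha hb hc g1.1 h2.symm h3.symm h5.symm hpq hab (hamin q h1.1)
      (hbmax q h1.1) ht0 ht1 ht h4 (hcmax p g1.1)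
  have hinj : InjOn (fun p : Pt => p.1) T := by
    intro p hp q hq hpq
    by_contra hne
    have h1 := key p hp q hq hne 0 le_rfl zero_le_one (by simp only at hpq; linarith)
    have h2 := key q hq p hp (Ne.symm hne) 0 le_rfl zero_le_one (by simp only at hpq; linarith)
    linarith
  have hbet : ∀ {x y z : ℝ}, x < y → y ≤ z → ∃ t : ℝ, 0 ≤ t ∧ t ≤ 1 ∧ y = (1 - t) * x + t * z :=
    fun {x y z} h1 h2 => by
      have h3 : 0 < z - x := by linarith
      refine ⟨(y - x) / (z - x), div_nonneg (by linarith) h3.le, (div_le_one h3).2 (by linarith), ?_⟩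
      field_simp; ring
  have hbet' : ∀ {x y z : ℝ}, y < x → z ≤ y → ∃ t : ℝ, 0 ≤ t ∧ t ≤ 1 ∧ y = (1 - t) * x + t * z :=
    fun {x y z} h1 h2 => by
      have h3 : 0 < x - z := by linarith
      refine ⟨(x - y) / (x - z), div_nonneg (by linarith) h3.le, (div_le_one h3).2 (by linarith), ?_⟩
      field_simp; ring
  obtain ⟨f, hfT, hfx, hfv⟩ : ∃ f : Fin k → Pt, (∀ i, f i ∈ T) ∧ StrictMono (fun i => (f i).1) ∧
      (StrictMono (fun i => ε * orient a b (f i)) ∨ StrictAnti fun i => ε * orient a b (f i)) := by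
    have hsplit := Finset.card_filter_add_card_filter_not (s := T) (fun p => p.1 ≤ c.1)
    rcases le_or_gt k (T.filter fun p => p.1 ≤ c.1).card with hk | hk
    · obtain ⟨f, hf, hf'⟩ := exists_strictMono_of_card_le (T.filter fun p => p.1 ≤ c.1)
        (g := fun p => p.1) (hinj.mono (Finset.coe_subset.2 (Finset.filter_subset _ _))) hk
      refine ⟨f, fun i => (Finset.mem_filter.1 (hf i)).1, hf', Or.inl fun i j hij => ?_⟩
      have hx := hf' hij
      obtain ⟨t, h0, h1, ht⟩ := hbet hx (Finset.mem_filter.1 (hf j)).2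
      exact key _ (Finset.mem_filter.1 (hf i)).1 _ (Finset.mem_filter.1 (hf j)).1
        (fun h => by simp [h] at hx) t h0 h1 ht
    · obtain ⟨f, hf, hf'⟩ := exists_strictMono_of_card_le (T.filter fun p => ¬ p.1 ≤ c.1)
        (g := fun p => p.1) (k := k) (hinj.mono (Finset.coe_subset.2 (Finset.filter_subset _ _))) (by omega)
      refine ⟨f, fun i => (Finset.mem_filter.1 (hf i)).1, hf', Or.inr fun i j hij => ?_⟩
      have hx := hf' hij
      obtain ⟨t, h0, h1, ht⟩ := hbet' hx (not_le.1 (Finset.mem_filter.1 (hf i)).2).le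
      exact key _ (Finset.mem_filter.1 (hf j)).1 _ (Finset.mem_filter.1 (hf i)).1
        (fun h => by simp [h] at hx) t h0 h1 ht
  refine ⟨a, ha, b, hb, c, hc, f, hab, ⟨hamin c hc, hbmax c hc⟩, fun h0 => ?_, ⟨fun i => ?_, hfx, ?_⟩,
    fun i => ?_⟩
  · rw [h0] at hc0; simp at hc0
  · obtain ⟨h1, -, -, h2, -⟩ := hTm _ (hfT i)
    refine ⟨⟨hamin _ h1.1, hbmax _ h1.1⟩, ?_⟩
    have h3 := hcmax _ h1.1
    rcases hε with rfl | rfl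
    · rw [uIcc_of_le (by linarith)]
      constructor <;> linarith
    · rw [uIcc_of_ge (by linarith)]
      constructor <;> linarith
  · rcases hε with rfl | rfl
    · simpa using hfv
    · rcases hfv with h | h
      · right; intro i j hij; have := h hij; simp only at this ⊢; linarith
      · left; intro i j hij; have := h hij; simp only at this ⊢; linarith
  · obtain ⟨h1, h2, h3, -, h4⟩ := hTm _ (hfT i)
    exact ⟨h1.1, h2, h3, h4⟩

/-- `Y` contains all points of `X` in its convex hull. -/
def Island (X Y : Finset Pt) : Prop := Y ⊆ X ∧ ∀ p ∈ X, p ∈ convexHull ℝ (Y : Set Pt) → p ∈ Y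

theorem Sep.pos_of_mem_convexHull {A : Finset Pt} {g : Pt → ℝ} (hg : IsAff g)
    (hA : ∀ p ∈ A, 0 < g p) (hp : p ∈ convexHull ℝ (A : Set Pt)) : 0 < g p := by
  obtain ⟨α, β, γ, hg⟩ := hg
  have hc : Convex ℝ {p : Pt | 0 < g p} := by
    intro x hx y hy s t hs ht hst
    have hx : 0 < g x := hx
    have hy : 0 < g y := hy
    show 0 < g (s • x + t • y)
    have : g (s • x + t • y) = s * g x + t * g y := by
      simp only [hg, Prod.fst_add, Prod.snd_add, Prod.smul_fst, Prod.smul_snd, smul_eq_mul]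
      linear_combination (-γ) * hst
    rw [this]
    rcases hs.lt_or_eq with h | h
    · have := mul_pos h hx
      have := mul_nonneg ht hy.le
      linarith
    · subst h
      have : t = 1 := by linarith
      subst this
      linarith
  exact convexHull_min (fun p hp => hA p hp) hc hp

theorem Island.of_sep (h : Island X Y) {A B : Finset Pt} (hs : Sep A B)
    (hY : ∀ p, p ∈ Y ↔ p ∈ A ∨ p ∈ B) : Island X A := by
  have hAY : A ⊆ Y := fun p hp => (hY p).2 (Or.inl hp)
  refine ⟨hAY.trans h.1, fun p hp hpA => ?_⟩
  have hpY := h.2 p hp (convexHull_mono (by exact_mod_cast hAY) hpA)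
  refine ((hY p).1 hpY).resolve_right fun hB => ?_
  obtain ⟨g, hg, h1, h2⟩ := hs
  have := Sep.pos_of_mem_convexHull hg h1 hpA
  linarith [h2 p hB]

/-- A point set with no sparse chain has the matching property. -/
theorem unbl_of_no_chain (hX : GP X) {n d κ κ' : ℕ} (hc : X.card = 2 * n) (hl : ∀ e ∈ S, ¬ e.IsDiag)
    (h1 : 2 ^ d * κ ≤ n) (h2 : n ≤ 2 ^ d * κ') (hS : S.card + 1 ≤ n + 2 ^ d)
    (hk : 12 * k + 12 ≤ κ)
    (hno : ∀ a ∈ X, ∀ b ∈ X, ∀ c ∈ X, ∀ f : Fin k → Pt, a.1 < b.1 → c.1 ∈ Icc a.1 b.1 →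
      orient a b c ≠ 0 → Chain a b c f → (∀ i, f i ∈ X ∧ f i ≠ a ∧ f i ≠ b ∧ f i ≠ c) →
      ∀ Z ⊆ X, (∀ p ∈ X, p ∈ para a b c → p ∈ Z) → 2 * κ' < Z.card) : Unbl S X := by
  refine unbl_of_pieces (P := Island X) (κ := κ) (κ' := κ') hl
    (fun Y A B hY hs hAB => hY.of_sep hs hAB) (by omega) ?_ d X n ⟨le_rfl, fun p hp _ => hp⟩ hX hc
    h1 h2 ?_
  · intro Y m hYX hY hYc hκ hκ' hin
    by_contra hbl
    have ht : Tight S Y m := ⟨hY, hYc, by omega, hbl, hin, hl⟩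
    obtain ⟨a, ha, b, hb, c, hc, f, hab, hac, hc0, hch, hf⟩ := exists_chain (k := k) hY (by
      have := ht.card_hull; omega)
    have := hno a (hYX.1 ha) b (hYX.1 hb) c (hYX.1 hc) f hab hac hc0 hch
      (fun i => ⟨hYX.1 (hf i).1, (hf i).2⟩) Y hYX.1 fun p hp hpp => hYX.2 p hp
        (para_subset hab hc0 hac.1 hac.2 (convex_convexHull ℝ _) (subset_convexHull ℝ _ ha)
          (subset_convexHull ℝ _ hb) (subset_convexHull ℝ _ hc) hpp)
    omega
  · have : (inner S X).card ≤ S.card := Finset.card_le_card Finset.inter_subset_left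
    omega

end PlaneMatching

namespace PlaneMatching

variable {k : ℕ} {a b c p : Pt}

theorem measurePreserving_comp_equiv {ι ι' α : Type*} [Fintype ι] [Fintype ι'] [MeasurableSpace α]
    (μ : Measure α) [SigmaFinite μ] (e : ι ≃ ι') :
    MeasurePreserving (fun f : ι' → α => f ∘ e) (Measure.pi fun _ => μ) (Measure.pi fun _ => μ) :=
  measurePreserving_arrowCongr' (fun _ => μ) (fun _ => μ) e.symm (MeasurableEquiv.refl α)
    fun _ => MeasurePreserving.id _

/-- Strictly increasing sequences in `[u, w]`. -/
def ordSimplex (k : ℕ) (u w : ℝ) : Set (Fin k → ℝ) := {f | StrictMono f ∧ ∀ i, f i ∈ Icc u w}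

theorem measurableSet_ordSimplex (k : ℕ) (u w : ℝ) : MeasurableSet (ordSimplex k u w) := by
  have : ordSimplex k u w = (⋂ i, ⋂ j, ⋂ _ : i < j, {f : Fin k → ℝ | f i < f j}) ∩
      ⋂ i, {f | f i ∈ Icc u w} := by
    ext f; simp [ordSimplex, StrictMono]
  rw [this]
  refine .inter (.iInter fun i => .iInter fun j => .iInter fun _ => ?_) (.iInter fun i => ?_)
  · exact measurableSet_lt (measurable_pi_apply i) (measurable_pi_apply j)
  · exact measurable_pi_apply i measurableSet_Icc

theorem volume_ordSimplex_le (k : ℕ) {u w : ℝ} (huw : u ≤ w) :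
    volume (ordSimplex k u w) ≤ ENNReal.ofReal ((w - u) ^ k / k.factorial) := by
  classical
  have hm (τ : Equiv.Perm (Fin k)) := measurePreserving_comp_equiv (volume : Measure ℝ) τ
  have h1 : ∑ τ : Equiv.Perm (Fin k), volume ((fun f : Fin k → ℝ => f ∘ τ) ⁻¹' ordSimplex k u w) ≤
      volume (univ.pi fun _ : Fin k => Icc u w) := by
    rw [← measure_biUnion_finset]
    · refine measure_mono (iUnion₂_subset fun τ _ f hf i _ => ?_)
      have := hf.2 (τ.symm i)
      simpa using this
    · intro τ _ τ' _ hne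
      refine Set.disjoint_left.2 fun f hf hf' => hne ?_
      have h2 : StrictMono (f ∘ τ) := hf.1
      have h3 : StrictMono (f ∘ τ') := hf'.1
      have h4 : f ∘ τ = f ∘ τ' := by
        refine (StrictMono.range_inj h2 h3).1 ?_
        rw [τ.surjective.range_comp, τ'.surjective.range_comp]
      have h5 : Function.Injective f := by
        have := h2.injective.comp τ.symm.injective
        simpa [Function.comp_assoc] using this
      ext i
      exact congrArg _ (h5 (congrFun h4 i))
    · exact fun τ _ => (hm τ).measurable (measurableSet_ordSimplex k u w)
  have h2 (τ : Equiv.Perm (Fin k)) :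
      volume ((fun f : Fin k → ℝ => f ∘ τ) ⁻¹' ordSimplex k u w) = volume (ordSimplex k u w) :=
    (hm τ).measure_preimage (measurableSet_ordSimplex k u w).nullMeasurableSet
  simp only [h2, Finset.sum_const, Finset.card_univ, Fintype.card_perm, Fintype.card_fin,
    nsmul_eq_mul, volume_pi_pi, Real.volume_Icc, Finset.prod_const] at h1
  have hk : (0 : ℝ) < k.factorial := by exact_mod_cast k.factorial_pos
  rw [ENNReal.ofReal_div_of_pos hk, ENNReal.ofReal_pow (by linarith), ENNReal.ofReal_natCast,
    ENNReal.le_div_iff_mul_le (by simp [k.factorial_ne_zero]) (by simp), mul_comm]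
  exact h1

/-- Strictly decreasing sequences in `[u, w]`. -/
def antiSimplex (k : ℕ) (u w : ℝ) : Set (Fin k → ℝ) :=
  (fun f : Fin k → ℝ => f ∘ Fin.revPerm) ⁻¹' ordSimplex k u w

theorem volume_antiSimplex (k : ℕ) (u w : ℝ) :
    volume (antiSimplex k u w) = volume (ordSimplex k u w) :=
  (measurePreserving_comp_equiv (volume : Measure ℝ) Fin.revPerm).measure_preimage
    (measurableSet_ordSimplex k u w).nullMeasurableSet

theorem measurableSet_antiSimplex (k : ℕ) (u w : ℝ) : MeasurableSet (antiSimplex k u w) :=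
  (measurePreserving_comp_equiv (volume : Measure ℝ) Fin.revPerm).measurable
    (measurableSet_ordSimplex k u w)

/-- The vertical shear taking the line `a b` to the horizontal axis. -/
def shear (a b p : Pt) : Pt := (p.1, -(a.2 + (b.2 - a.2) / (b.1 - a.1) * (p.1 - a.1)) + p.2)

theorem measurePreserving_shear (a b : Pt) : MeasurePreserving (shear a b) :=
  (MeasurePreserving.id (volume : Measure ℝ)).skew_product
    (g := fun x y => -(a.2 + (b.2 - a.2) / (b.1 - a.1) * (x - a.1)) + y)
    (by fun_prop) (ae_of_all _ fun x => map_add_left_eq_self _ _)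

theorem orient_eq_shear (hab : a.1 < b.1) (p : Pt) :
    orient a b p = (b.1 - a.1) * (shear a b p).2 := by
  have : b.1 - a.1 ≠ 0 := by linarith
  simp only [orient, shear]
  field_simp
  ring

theorem mul_mem_uIcc_mul_iff {D x y : ℝ} (hD : 0 < D) : D * x ∈ uIcc 0 (D * y) ↔ x ∈ uIcc 0 y := by
  simp only [mem_uIcc]
  constructor
  · rintro (⟨h1, h2⟩ | ⟨h1, h2⟩)
    · exact Or.inl ⟨by nlinarith, le_of_mul_le_mul_left h2 hD⟩
    · exact Or.inr ⟨le_of_mul_le_mul_left h1 hD, by nlinarith⟩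
  · rintro (⟨h1, h2⟩ | ⟨h1, h2⟩)
    · exact Or.inl ⟨by positivity, mul_le_mul_of_nonneg_left h2 hD.le⟩
    · exact Or.inr ⟨mul_le_mul_of_nonneg_left h1 hD.le, by nlinarith⟩

theorem measurableSet_para (a b c : Pt) : MeasurableSet (para a b c) := by
  have h1 : Measurable (orient a b) := by unfold orient; fun_prop
  exact (measurable_fst measurableSet_Icc).inter (h1 measurableSet_uIcc)

theorem volume_para (hab : a.1 < b.1) :
    volume (para a b c) = ENNReal.ofReal (|orient a b c| / 4) := by
  have hD : 0 < b.1 - a.1 := by linarith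
  have h : para a b c = shear a b ⁻¹' (Icc ((a.1 + c.1) / 2) ((b.1 + c.1) / 2) ×ˢ
      uIcc 0 ((shear a b c).2 / 2)) := by
    ext p
    simp only [para, orient_eq_shear hab, mul_div_assoc, mul_mem_uIcc_mul_iff hD]
    rfl
  rw [h, (measurePreserving_shear a b).measure_preimage
    (measurableSet_Icc.prod measurableSet_uIcc).nullMeasurableSet, Measure.volume_eq_prod,
    Measure.prod_prod, Real.volume_Icc, Real.volume_interval, ← ENNReal.ofReal_mul (by linarith),
    orient_eq_shear hab c, abs_mul, abs_of_pos hD, sub_zero, abs_div, abs_two]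
  congr 1
  ring

theorem volume_chain_le (hab : a.1 < b.1) :
    volume {f : Fin k → Pt | Chain a b c f} ≤
      ENNReal.ofReal (2 * |orient a b c| ^ k / (k.factorial : ℝ) ^ 2) := by
  have hD : 0 < b.1 - a.1 := by linarith
  set s := (shear a b c).2 with hs
  have hmp := (volume_measurePreserving_arrowProdEquivProdArrow ℝ ℝ (Fin k)).comp
    (measurePreserving_pi (fun _ : Fin k => (volume : Measure Pt)) (fun _ => volume)
      fun _ => measurePreserving_shear a b)
  have hsub : {f : Fin k → Pt | Chain a b c f} ⊆
      (MeasurableEquiv.arrowProdEquivProdArrow ℝ ℝ (Fin k) ∘ fun f i => shear a b (f i)) ⁻¹'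
        (ordSimplex k a.1 b.1 ×ˢ (ordSimplex k (min 0 s) (max 0 s) ∪
          antiSimplex k (min 0 s) (max 0 s))) := by
    rintro f ⟨h1, h2, h3⟩
    refine ⟨⟨h2, fun i => (h1 i).1⟩, ?_⟩
    have h4 : ∀ i, (shear a b (f i)).2 ∈ Icc (min 0 s) (max 0 s) := fun i => by
      have := (h1 i).2
      rw [orient_eq_shear hab, orient_eq_shear hab, mul_mem_uIcc_mul_iff hD] at this
      exact this
    simp only [orient_eq_shear hab] at h3
    rcases h3 with h3 | h3
    · exact Or.inl ⟨fun i j hij => lt_of_mul_lt_mul_left (h3 hij) hD.le, h4⟩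
    · refine Or.inr ⟨fun i j hij => ?_, fun i => h4 _⟩
      exact lt_of_mul_lt_mul_left (h3 (Fin.rev_lt_rev.2 hij)) hD.le
  have hmm : (0 : ℝ) ≤ |s| ^ k / k.factorial := by positivity
  have hms : max 0 s - min 0 s = |s| := by rw [max_sub_min_eq_abs, sub_zero]
  calc volume {f : Fin k → Pt | Chain a b c f} ≤ _ := measure_mono hsub
    _ = volume (ordSimplex k a.1 b.1) * volume (ordSimplex k (min 0 s) (max 0 s) ∪
          antiSimplex k (min 0 s) (max 0 s)) := by
        rw [← Measure.prod_prod]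
        exact hmp.measure_preimage ((measurableSet_ordSimplex _ _ _).prod
          ((measurableSet_ordSimplex _ _ _).union
            (measurableSet_antiSimplex _ _ _))).nullMeasurableSet
    _ ≤ ENNReal.ofReal ((b.1 - a.1) ^ k / k.factorial) *
          (ENNReal.ofReal (|s| ^ k / k.factorial) + ENNReal.ofReal (|s| ^ k / k.factorial)) := by
        have h5 := volume_ordSimplex_le k (min_le_max : min 0 s ≤ max 0 s)
        rw [hms] at h5
        refine mul_le_mul' (volume_ordSimplex_le k hab.le) ((measure_union_le _ _).trans ?_)
        rw [volume_antiSimplex]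
        exact add_le_add h5 h5
    _ = _ := by
        rw [← ENNReal.ofReal_add hmm hmm, ← ENNReal.ofReal_mul (by positivity),
          orient_eq_shear hab, abs_mul, abs_of_pos hD, mul_pow]
        congr 1
        rw [← hs]
        field_simp
        ring

theorem pi_rest_le {ι α : Type*} [Fintype ι] [MeasurableSpace α] (μ : Measure α)
    [IsProbabilityMeasure μ] {G : Set α} (hG : MeasurableSet G) (K : ℕ) :
    (Measure.pi fun _ : ι => μ) {r | ∀ T : Finset ι, K < T.card → ∃ j ∈ T, r j ∉ G} ≤
      ENNReal.ofReal (2 ^ K * Real.exp (-(μ.real G * Fintype.card ι / 2))) := by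
  classical
  set p := μ.real G with hp
  have hp0 : 0 ≤ p := measureReal_nonneg
  have hp1 : p ≤ 1 := measureReal_le_one
  have hq : μ.real Gᶜ = 1 - p := by rw [measureReal_compl hG]; simp [hp]
  set F : Finset (Finset ι) := Finset.univ.filter fun T => T.card ≤ K with hF
  have hsub : {r : ι → α | ∀ T : Finset ι, K < T.card → ∃ j ∈ T, r j ∉ G} ⊆
      ⋃ T ∈ F, univ.pi fun j => if j ∈ T then G else Gᶜ := by
    intro r hr
    refine mem_iUnion₂.2 ⟨Finset.univ.filter fun j => r j ∈ G, ?_, fun j _ => ?_⟩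
    · rw [hF, Finset.mem_filter]
      refine ⟨Finset.mem_univ _, ?_⟩
      by_contra! hc
      obtain ⟨j, hj, hj'⟩ := hr _ hc
      exact hj' (Finset.mem_filter.1 hj).2
    · by_cases h : r j ∈ G <;> simp [h]
  have hval (T : Finset ι) : (Measure.pi fun _ : ι => μ) (univ.pi fun j => if j ∈ T then G else Gᶜ) =
      ENNReal.ofReal (p ^ T.card * (1 - p) ^ (Fintype.card ι - T.card)) := by
    rw [Measure.pi_pi]
    have : ∀ j, μ (if j ∈ T then G else Gᶜ) = ENNReal.ofReal (if j ∈ T then p else 1 - p) := by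
      intro j
      split_ifs
      · rw [hp, ofReal_measureReal]
      · rw [← hq, ofReal_measureReal]
    simp only [this]
    rw [← ENNReal.ofReal_prod_of_nonneg (fun j _ => by split_ifs <;> linarith), Finset.prod_ite,
      Finset.prod_const, Finset.prod_const, Finset.filter_mem_eq_inter, Finset.univ_inter]
    congr 3
    rw [← Finset.card_compl]
    congr 1
    ext j; simp
  calc _ ≤ _ := measure_mono hsub
    _ ≤ ∑ T ∈ F, _ := measure_biUnion_finset_le _ _
    _ = ∑ T ∈ F, ENNReal.ofReal (p ^ T.card * (1 - p) ^ (Fintype.card ι - T.card)) :=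
        Finset.sum_congr rfl fun T _ => hval T
    _ = ENNReal.ofReal (∑ T ∈ F, p ^ T.card * (1 - p) ^ (Fintype.card ι - T.card)) :=
        (ENNReal.ofReal_sum_of_nonneg fun T _ =>
          mul_nonneg (pow_nonneg hp0 _) (pow_nonneg (by linarith) _)).symm
    _ ≤ _ := ENNReal.ofReal_le_ofReal ?_
  have hle (T : Finset ι) (hT : T ∈ F) : p ^ T.card * (1 - p) ^ (Fintype.card ι - T.card) ≤
      2 ^ K * ((p / 2) ^ T.card * (1 - p) ^ (Fintype.card ι - T.card)) := by
    have h1 : p ^ T.card = 2 ^ T.card * (p / 2) ^ T.card := by rw [← mul_pow]; congr 1; ring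
    rw [h1, mul_assoc]
    refine mul_le_mul_of_nonneg_right (pow_le_pow_right₀ one_le_two (Finset.mem_filter.1 hT).2) ?_
    exact mul_nonneg (pow_nonneg (by linarith) _) (pow_nonneg (by linarith) _)
  calc _ ≤ ∑ T ∈ F, 2 ^ K * ((p / 2) ^ T.card * (1 - p) ^ (Fintype.card ι - T.card)) :=
        Finset.sum_le_sum hle
    _ ≤ ∑ T : Finset ι, 2 ^ K * ((p / 2) ^ T.card * (1 - p) ^ (Fintype.card ι - T.card)) := by
        refine Finset.sum_le_sum_of_subset_of_nonneg (Finset.filter_subset _ _) fun T _ _ => ?_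
        exact mul_nonneg (by positivity)
          (mul_nonneg (pow_nonneg (by linarith) _) (pow_nonneg (by linarith) _))
    _ = 2 ^ K * (p / 2 + (1 - p)) ^ Fintype.card ι := by
        rw [← Finset.mul_sum, Fintype.sum_pow_mul_eq_add_pow]
    _ ≤ 2 ^ K * (Real.exp (-(p / 2))) ^ Fintype.card ι := by
        refine mul_le_mul_of_nonneg_left (pow_le_pow_left₀ (by linarith) ?_ _) (by positivity)
        have := Real.add_one_le_exp (-(p / 2))
        linarith
    _ = _ := by
        rw [← Real.exp_nat_mul]
        congr 2
        ring

end PlaneMatching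

namespace PlaneMatching

variable {k K N : ℕ} {a b c p : Pt} {Γ : Set Pt} {R : Type*}

theorem volume_ne_zero_of_interior (hΓi : (interior Γ).Nonempty) : volume Γ ≠ 0 :=
  ((isOpen_interior.measure_pos volume hΓi).trans_le (measure_mono interior_subset)).ne'

theorem isProbabilityMeasure_unifOn (hc : IsCompact Γ) (hΓi : (interior Γ).Nonempty) :
    IsProbabilityMeasure (unifOn Γ) := by
  refine ⟨?_⟩
  rw [unifOn, Measure.smul_apply, Measure.restrict_apply_univ, smul_eq_mul]
  exact ENNReal.inv_mul_cancel (volume_ne_zero_of_interior hΓi) hc.measure_lt_top.ne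

theorem inv_volume (hΓi : (interior Γ).Nonempty) :
    (volume Γ)⁻¹ = ENNReal.ofReal (volume Γ).toReal⁻¹ := by
  rw [← ENNReal.toReal_inv, ENNReal.ofReal_toReal]
  exact ENNReal.inv_ne_top.2 (volume_ne_zero_of_interior hΓi)

theorem unifOn_real_para (hΓi : (interior Γ).Nonempty) (hab : a.1 < b.1) (h : para a b c ⊆ Γ) :
    (unifOn Γ).real (para a b c) = (volume Γ).toReal⁻¹ * (|orient a b c| / 4) := by
  rw [measureReal_def, unifOn, Measure.smul_apply, Measure.restrict_eq_self _ h,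
    volume_para hab, smul_eq_mul, inv_volume hΓi, ENNReal.toReal_mul, ENNReal.toReal_ofReal (by positivity),
    ENNReal.toReal_ofReal (by positivity)]

theorem pi_unifOn_le (hc : IsCompact Γ) (hΓi : (interior Γ).Nonempty) (s : Set (Fin k → Pt)) :
    (Measure.pi fun _ : Fin k => unifOn Γ) s ≤ ENNReal.ofReal ((volume Γ).toReal⁻¹ ^ k) * volume s := by
  have := isProbabilityMeasure_unifOn hc hΓi
  have h : (Measure.pi fun _ : Fin k => unifOn Γ) =
      ((volume Γ)⁻¹ ^ k) • (volume.restrict (univ.pi fun _ : Fin k => Γ)) := by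
    rw [volume_pi, Measure.restrict_pi_pi]
    refine Measure.pi_eq fun t ht => ?_
    rw [Measure.smul_apply, Measure.pi_pi, smul_eq_mul]
    simp only [unifOn, Measure.smul_apply, smul_eq_mul, Finset.prod_mul_distrib, Finset.prod_const,
      Finset.card_univ, Fintype.card_fin]
  rw [h, Measure.smul_apply, smul_eq_mul, inv_volume hΓi, ← ENNReal.ofReal_pow (by positivity)]
  exact mul_le_mul_right (Measure.restrict_apply_le _ _) _

/-- The first three points span a box containing a chain, and few of the remaining points lie in the
inscribed parallelogram. -/
def badSet (Γ : Set Pt) (k K : ℕ) (R : Type*) : Set ((Fin 3 → Pt) × ((Fin k → Pt) × (R → Pt))) :=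
  {z | (∀ i, z.1 i ∈ Γ) ∧ (z.1 0).1 < (z.1 1).1 ∧ (z.1 2).1 ∈ Icc (z.1 0).1 (z.1 1).1 ∧
    orient (z.1 0) (z.1 1) (z.1 2) ≠ 0 ∧ Chain (z.1 0) (z.1 1) (z.1 2) z.2.1 ∧
    ∀ T : Finset R, K < T.card → ∃ j ∈ T, z.2.2 j ∉ para (z.1 0) (z.1 1) (z.1 2)}

section Measurable

variable {Ω : Type*} [MeasurableSpace Ω]

theorem measurable_le_prop {f g : Ω → ℝ} (hf : Measurable f) (hg : Measurable g) :
    Measurable fun ω => f ω ≤ g ω := measurableSet_setOfPred.1 (measurableSet_le hf hg)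

theorem measurable_lt_prop {f g : Ω → ℝ} (hf : Measurable f) (hg : Measurable g) :
    Measurable fun ω => f ω < g ω := measurableSet_setOfPred.1 (measurableSet_lt hf hg)

theorem measurable_mem_uIcc_prop {f g : Ω → ℝ} (hf : Measurable f) (hg : Measurable g) :
    Measurable fun ω => f ω ∈ uIcc 0 (g ω) := by
  simp only [mem_uIcc]
  exact ((measurable_le_prop measurable_const hf).and (measurable_le_prop hf hg)).or
    ((measurable_le_prop hg hf).and (measurable_le_prop hf measurable_const))

theorem measurable_orient {f g h : Ω → Pt} (hf : Measurable f) (hg : Measurable g)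
    (hh : Measurable h) : Measurable fun ω => orient (f ω) (g ω) (h ω) := by
  unfold orient; fun_prop

theorem measurable_mem_Icc_prop {f g h : Ω → ℝ} (hf : Measurable f) (hg : Measurable g)
    (hh : Measurable h) : Measurable fun ω => f ω ∈ Icc (g ω) (h ω) :=
  (measurable_le_prop hg hf).and (measurable_le_prop hf hh)

theorem measurable_strictMono_prop {f : Fin k → Ω → ℝ} (hf : ∀ i, Measurable (f i)) :
    Measurable fun ω => StrictMono fun i => f i ω :=
  .forall fun i => .forall fun j => .imp measurable_const (measurable_lt_prop (hf i) (hf j))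

theorem measurable_strictAnti_prop {f : Fin k → Ω → ℝ} (hf : ∀ i, Measurable (f i)) :
    Measurable fun ω => StrictAnti fun i => f i ω :=
  .forall fun i => .forall fun j => .imp measurable_const (measurable_lt_prop (hf j) (hf i))

end Measurable

theorem measurableSet_badSet [Fintype R] (hc : IsCompact Γ) : MeasurableSet (badSet Γ k K R) := by
  have ma (i : Fin 3) : Measurable fun z : (Fin 3 → Pt) × ((Fin k → Pt) × (R → Pt)) => z.1 i :=
    (measurable_pi_apply i).comp measurable_fst
  have mf (i : Fin k) : Measurable fun z : (Fin 3 → Pt) × ((Fin k → Pt) × (R → Pt)) => z.2.1 i :=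
    (measurable_pi_apply i).comp (measurable_fst.comp measurable_snd)
  have mr (i : R) : Measurable fun z : (Fin 3 → Pt) × ((Fin k → Pt) × (R → Pt)) => z.2.2 i :=
    (measurable_pi_apply i).comp (measurable_snd.comp measurable_snd)
  have mo := measurable_orient (ma 0) (ma 1) (ma 2)
  have mof (i : Fin k) := measurable_orient (ma 0) (ma 1) (mf i)
  have mor (i : R) := measurable_orient (ma 0) (ma 1) (mr i)
  refine measurableSet_setOfPred.2 ?_
  refine .and (.forall fun i => measurableSet_setOfPred.1 ((ma i) hc.measurableSet)) ?_
  refine .and (measurable_lt_prop (ma 0).fst (ma 1).fst) ?_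
  refine .and (measurable_mem_Icc_prop (ma 2).fst (ma 0).fst (ma 1).fst) ?_
  refine .and (measurableSet_setOfPred.1 (mo (measurableSet_singleton 0).compl)) ?_
  refine .and ?_ ?_
  · refine .and (.forall fun i => ?_) (.and (measurable_strictMono_prop fun i => (mf i).fst) ?_)
    · exact .and (measurable_mem_Icc_prop (mf i).fst (ma 0).fst (ma 1).fst)
        (measurable_mem_uIcc_prop (mof i) mo)
    · exact .or (measurable_strictMono_prop mof) (measurable_strictAnti_prop mof)
  · refine .forall fun T => .imp measurable_const (.exists fun j => .and measurable_const (.not ?_))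
    exact .and (measurable_mem_Icc_prop (mr j).fst (((ma 0).fst.add (ma 2).fst).div_const 2)
      (((ma 1).fst.add (ma 2).fst).div_const 2)) (measurable_mem_uIcc_prop (mor j) (mo.div_const 2))

theorem measure_badSet_le [Fintype R] [Nonempty R] (hc : IsCompact Γ) (hconv : Convex ℝ Γ)
    (hΓi : (interior Γ).Nonempty) :
    ((Measure.pi fun _ : Fin 3 => unifOn Γ).prod ((Measure.pi fun _ : Fin k => unifOn Γ).prod
      (Measure.pi fun _ : R => unifOn Γ))) (badSet Γ k K R) ≤
      ENNReal.ofReal (2 * 2 ^ K * (8 / Fintype.card R) ^ k / k.factorial) := by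
  have := isProbabilityMeasure_unifOn hc hΓi
  rw [Measure.prod_apply (measurableSet_badSet hc)]
  suffices h : ∀ y : Fin 3 → Pt, ((Measure.pi fun _ : Fin k => unifOn Γ).prod
      (Measure.pi fun _ : R => unifOn Γ)) (Prod.mk y ⁻¹' badSet Γ k K R) ≤
      ENNReal.ofReal (2 * 2 ^ K * (8 / Fintype.card R) ^ k / k.factorial) by
    refine (lintegral_mono h).trans ?_
    rw [lintegral_const, measure_univ, mul_one]
  intro y
  by_cases hy : (∀ i, y i ∈ Γ) ∧ (y 0).1 < (y 1).1 ∧ (y 2).1 ∈ Icc (y 0).1 (y 1).1 ∧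
      orient (y 0) (y 1) (y 2) ≠ 0
  swap
  · have : Prod.mk y ⁻¹' badSet Γ k K R = ∅ := by
      refine eq_empty_of_forall_notMem fun z hz => hy ?_
      exact ⟨hz.1, hz.2.1, hz.2.2.1, hz.2.2.2.1⟩
    rw [this, measure_empty]
    exact bot_le
  obtain ⟨h1, hab, hac, ho⟩ := hy
  have hpara := para_subset hab ho hac.1 hac.2 hconv (h1 0) (h1 1) (h1 2)
  set A := |orient (y 0) (y 1) (y 2)| with hA
  set v := (volume Γ).toReal⁻¹ with hv
  have hv0 : 0 ≤ v := by positivity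
  have hA0 : 0 ≤ A := abs_nonneg _
  have hreal := unifOn_real_para hΓi hab hpara
  calc _ ≤ ((Measure.pi fun _ : Fin k => unifOn Γ).prod (Measure.pi fun _ : R => unifOn Γ))
        ({f | Chain (y 0) (y 1) (y 2) f} ×ˢ
          {r | ∀ T : Finset R, K < T.card → ∃ j ∈ T, r j ∉ para (y 0) (y 1) (y 2)}) :=
        measure_mono fun z hz => ⟨hz.2.2.2.2.1, hz.2.2.2.2.2⟩
    _ = _ := Measure.prod_prod _ _
    _ ≤ (ENNReal.ofReal (v ^ k) * ENNReal.ofReal (2 * A ^ k / (k.factorial : ℝ) ^ 2)) *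
          ENNReal.ofReal (2 ^ K * Real.exp (-(v * (A / 4) * Fintype.card R / 2))) := by
        refine mul_le_mul' ((pi_unifOn_le hc hΓi _).trans
          (mul_le_mul' le_rfl (volume_chain_le hab))) ?_
        rw [← hreal]
        exact pi_rest_le (unifOn Γ) (measurableSet_para _ _ _) K
    _ = ENNReal.ofReal (v ^ k * (2 * A ^ k / (k.factorial : ℝ) ^ 2) *
          (2 ^ K * Real.exp (-(v * (A / 4) * Fintype.card R / 2)))) := by
        rw [← ENNReal.ofReal_mul (by positivity), ← ENNReal.ofReal_mul (by positivity)]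
    _ ≤ _ := ENNReal.ofReal_le_ofReal ?_
  have hR : (0 : ℝ) < Fintype.card R := by exact_mod_cast Fintype.card_pos
  set t := v * (A / 4) * Fintype.card R / 2 with ht
  have hk : (0 : ℝ) < k.factorial := by exact_mod_cast k.factorial_pos
  have hexp : t ^ k / k.factorial * Real.exp (-t) ≤ 1 := by
    have := Real.pow_div_factorial_le_exp t (by positivity) k
    rw [Real.exp_neg]
    exact mul_inv_le_one_of_le₀ this (Real.exp_pos _).le
  have hvA : v ^ k * A ^ k = (8 / Fintype.card R) ^ k * t ^ k := by
    rw [← mul_pow, ← mul_pow]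
    congr 1
    rw [ht]; field_simp; ring
  calc _ = 2 * 2 ^ K * (v ^ k * A ^ k) / (k.factorial : ℝ) ^ 2 * Real.exp (-t) := by ring
    _ = 2 * 2 ^ K * (8 / Fintype.card R) ^ k / k.factorial *
          (t ^ k / k.factorial * Real.exp (-t)) := by rw [hvA]; field_simp
    _ ≤ _ := mul_le_of_le_one_right (by positivity) hexp

/-- The chain and the box selected by `σ` witness a sparse chain of `x`. -/
def Sparse (Γ : Set Pt) (K : ℕ) (x : Fin N → Pt) (σ : Fin 3 ⊕ Fin k → Fin N) : Prop :=
  (∀ i, x i ∈ Γ) ∧ (x (σ (.inl 0))).1 < (x (σ (.inl 1))).1 ∧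
    (x (σ (.inl 2))).1 ∈ Icc (x (σ (.inl 0))).1 (x (σ (.inl 1))).1 ∧
    orient (x (σ (.inl 0))) (x (σ (.inl 1))) (x (σ (.inl 2))) ≠ 0 ∧
    Chain (x (σ (.inl 0))) (x (σ (.inl 1))) (x (σ (.inl 2))) (fun i => x (σ (.inr i))) ∧
    ∀ T : Finset (Fin N), K < T.card →
      ∃ j ∈ T, x j ∉ para (x (σ (.inl 0))) (x (σ (.inl 1))) (x (σ (.inl 2)))

theorem measure_sparse_le (hc : IsCompact Γ) (hconv : Convex ℝ Γ) (hΓi : (interior Γ).Nonempty)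
    {σ : Fin 3 ⊕ Fin k → Fin N} (hσ : Function.Injective σ) (hN : 2 * (3 + k) ≤ N) :
    (Measure.pi fun _ : Fin N => unifOn Γ) {x | Sparse Γ K x σ} ≤
      ENNReal.ofReal (2 * 2 ^ K * (16 / N) ^ k / k.factorial) := by
  classical
  have := isProbabilityMeasure_unifOn hc hΓi
  let R := {j // j ∉ range σ}
  have hcard : Fintype.card R = N - (3 + k) := by
    have h1 : Fintype.card (range σ) = 3 + k := by
      rw [Set.card_range_of_injective hσ]; simp
    have h2 := Fintype.card_subtype_compl (fun j => j ∈ range σ)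
    rw [Fintype.card_fin] at h2
    exact h2.trans (congrArg _ h1)
  have hne : Nonempty R := Fintype.card_pos_iff.1 (by omega)
  let e : Fin 3 ⊕ (Fin k ⊕ R) ≃ Fin N := (Equiv.sumAssoc _ _ _).symm.trans
    (((Equiv.ofInjective σ hσ).sumCongr (Equiv.refl R)).trans (Equiv.Set.sumCompl (range σ)))
  have e1 : ∀ i, e (.inl i) = σ (.inl i) := fun i => rfl
  have e2 : ∀ i, e (.inr (.inl i)) = σ (.inr i) := fun i => rfl
  have hm := ((MeasurePreserving.id (Measure.pi fun _ : Fin 3 => unifOn Γ)).prod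
    (measurePreserving_sumPiEquivProdPi fun _ : Fin k ⊕ R => unifOn Γ)).comp
    ((measurePreserving_sumPiEquivProdPi fun _ : Fin 3 ⊕ (Fin k ⊕ R) => unifOn Γ).comp
      (measurePreserving_comp_equiv (unifOn Γ) e))
  have hle := measure_badSet_le (k := k) (K := K) (R := R) hc hconv hΓi
  rw [← hm.measure_preimage (measurableSet_badSet hc).nullMeasurableSet] at hle
  refine (measure_mono ?_).trans (hle.trans (ENNReal.ofReal_le_ofReal ?_))
  · rintro x ⟨h1, h2, h3, h4, h5, h6⟩
    refine ⟨fun i => h1 _, h2, h3, h4, h5, fun T hT => ?_⟩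
    obtain ⟨j, hj, hj'⟩ := h6 (T.map ⟨fun r => e (.inr (.inr r)), fun r s h => by simpa using h⟩)
      (by rwa [Finset.card_map])
    obtain ⟨r, hr, rfl⟩ := Finset.mem_map.1 hj
    exact ⟨r, hr, hj'⟩
  · have h1 : (N : ℝ) / 2 ≤ Fintype.card R := by
      rw [hcard, Nat.cast_sub (by omega)]
      have : (2 * (3 + k : ℕ) : ℝ) ≤ N := by exact_mod_cast hN
      linarith
    have hN0 : (0 : ℝ) < N := by exact_mod_cast (by omega : 0 < N)
    have h2 : (8 : ℝ) / Fintype.card R ≤ 16 / N := by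
      rw [div_le_div_iff₀ (by linarith) hN0]; linarith
    gcongr

theorem measure_exists_sparse_le (hc : IsCompact Γ) (hconv : Convex ℝ Γ)
    (hΓi : (interior Γ).Nonempty) (hN : 2 * (3 + k) ≤ N) :
    (Measure.pi fun _ : Fin N => unifOn Γ)
      {x | ∃ σ : Fin 3 ⊕ Fin k → Fin N, Function.Injective σ ∧ Sparse Γ K x σ} ≤
      ENNReal.ofReal (2 * 2 ^ K * N ^ 3 * 16 ^ k / k.factorial) := by
  classical
  have hN0 : (0 : ℝ) < N := by exact_mod_cast (by omega : 0 < N)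
  set F : Finset (Fin 3 ⊕ Fin k → Fin N) := Finset.univ.filter Function.Injective with hF
  have hFc : (F.card : ℝ) ≤ N ^ (3 + k) := by
    have := Finset.card_filter_le (Finset.univ : Finset (Fin 3 ⊕ Fin k → Fin N)) Function.Injective
    rw [Finset.card_univ, Fintype.card_fun, Fintype.card_sum, Fintype.card_fin, Fintype.card_fin,
      Fintype.card_fin] at this
    exact_mod_cast this
  calc _ ≤ (Measure.pi fun _ : Fin N => unifOn Γ) (⋃ σ ∈ F, {x | Sparse Γ K x σ}) := by
        refine measure_mono ?_
        rintro x ⟨σ, h1, h2⟩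
        exact mem_iUnion₂.2 ⟨σ, Finset.mem_filter.2 ⟨Finset.mem_univ _, h1⟩, h2⟩
    _ ≤ ∑ σ ∈ F, _ := measure_biUnion_finset_le _ _
    _ ≤ ∑ σ ∈ F, ENNReal.ofReal (2 * 2 ^ K * (16 / N) ^ k / k.factorial) :=
        Finset.sum_le_sum fun σ hσ =>
          measure_sparse_le hc hconv hΓi (Finset.mem_filter.1 hσ).2 hN
    _ = ENNReal.ofReal (F.card * (2 * 2 ^ K * (16 / N) ^ k / k.factorial)) := by
        rw [Finset.sum_const, nsmul_eq_mul, ENNReal.ofReal_mul (by positivity),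
          ENNReal.ofReal_natCast]
    _ ≤ _ := by
        refine ENNReal.ofReal_le_ofReal ((mul_le_mul_of_nonneg_right hFc (by positivity)).trans ?_)
        rw [div_pow, pow_add]
        apply le_of_eq
        field_simp

end PlaneMatching

namespace PlaneMatching

variable {k n : ℕ} {a b c p : Pt} {Γ : Set Pt} {S : Finset (Sym2 Pt)}

theorem volume_line_eq_zero (hab : a ≠ b) : volume {p : Pt | orient a b p = 0} = 0 := by
  have hm : Measurable (orient a b) := by unfold orient; fun_prop
  have hms : MeasurableSet {p : Pt | orient a b p = 0} := hm (measurableSet_singleton 0)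
  by_cases h : a.1 = b.1
  · have h2 : b.2 - a.2 ≠ 0 := fun h2 => hab (Prod.ext h (by linarith))
    refine measure_mono_null (t := {a.1} ×ˢ univ) (fun p hp => ⟨?_, mem_univ _⟩) ?_
    · have hp : orient a b p = 0 := hp
      have : (b.2 - a.2) * (p.1 - a.1) = 0 := by
        rw [orient, ← h] at hp; linarith
      rw [mem_singleton_iff]
      linarith [(mul_eq_zero.1 this).resolve_left h2]
    · rw [Measure.volume_eq_prod, Measure.prod_prod, Real.volume_singleton, zero_mul]
  · have h2 : b.1 - a.1 ≠ 0 := fun h2 => h (by linarith)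
    rw [Measure.volume_eq_prod, Measure.measure_prod_null hms]
    refine ae_of_all _ fun x => ?_
    refine measure_mono_null (t := {a.2 + (b.2 - a.2) * (x - a.1) / (b.1 - a.1)}) (fun y hy => ?_)
      Real.volume_singleton
    have hy : orient a b (x, y) = 0 := hy
    rw [mem_singleton_iff]
    simp only [orient] at hy
    field_simp
    linarith

theorem unifOn_eq_zero {s : Set Pt} (h : volume s = 0) : unifOn Γ s = 0 := by
  rw [unifOn, Measure.smul_apply, Measure.absolutelyContinuous_of_le Measure.restrict_le_self h,
    smul_zero]

theorem pi_eq_zero_of_slice {α : Type*} [MeasurableSpace α] (μ : Measure α) [SigmaFinite μ]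
    {E : Set (Fin (n + 1) → α)} (hE : MeasurableSet E) (l : Fin (n + 1))
    (h : ∀ y : Fin n → α, μ {p | l.insertNth p y ∈ E} = 0) :
    (Measure.pi fun _ : Fin (n + 1) => μ) E = 0 := by
  have hm := (measurePreserving_piFinSuccAbove (fun _ : Fin (n + 1) => μ) l).symm
  rw [← hm.measure_preimage hE.nullMeasurableSet, Measure.prod_apply_symm (hm.measurable hE)]
  refine (lintegral_congr h).trans lintegral_zero

theorem ae_injective_orient_ne {N : ℕ} (hc : IsCompact Γ) (hΓi : (interior Γ).Nonempty) :
    ∀ᵐ x ∂(Measure.pi fun _ : Fin N => unifOn Γ), Function.Injective x ∧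
      ∀ i j l : Fin N, i ≠ j → i ≠ l → j ≠ l → orient (x i) (x j) (x l) ≠ 0 := by
  have := isProbabilityMeasure_unifOn hc hΓi
  obtain _ | N := N
  · exact ae_of_all _ fun x => ⟨fun i => i.elim0, fun i => i.elim0⟩
  have h1 : ∀ i l : Fin (N + 1), ∀ᵐ x ∂(Measure.pi fun _ : Fin (N + 1) => unifOn Γ),
      i ≠ l → x i ≠ x l := by
    intro i l
    by_cases hil : i = l
    · exact ae_of_all _ fun x h => absurd hil h
    obtain ⟨i, rfl⟩ := Fin.exists_succAbove_eq hil
    suffices h : (Measure.pi fun _ : Fin (N + 1) => unifOn Γ) {x | x (l.succAbove i) = x l} = 0 from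
      mem_of_superset (compl_mem_ae_iff.2 h) fun x hx _ => hx
    refine pi_eq_zero_of_slice _
      (measurableSet_eq_fun (measurable_pi_apply _) (measurable_pi_apply _)) l fun y => ?_
    refine unifOn_eq_zero (measure_mono_null (t := {y i}) (fun p hp => ?_) (measure_singleton _))
    have hp : l.insertNth (α := fun _ => Pt) p y (l.succAbove i) =
      l.insertNth (α := fun _ => Pt) p y l := hp
    rw [Fin.insertNth_apply_same, Fin.insertNth_apply_succAbove] at hp
    exact hp.symm
  have h2 : ∀ i j l : Fin (N + 1), ∀ᵐ x ∂(Measure.pi fun _ : Fin (N + 1) => unifOn Γ),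
      i ≠ l → j ≠ l → x i ≠ x j → orient (x i) (x j) (x l) ≠ 0 := by
    intro i j l
    by_cases hil : i = l
    · exact ae_of_all _ fun x h => absurd hil h
    by_cases hjl : j = l
    · exact ae_of_all _ fun x _ h => absurd hjl h
    obtain ⟨i, rfl⟩ := Fin.exists_succAbove_eq hil
    obtain ⟨j, rfl⟩ := Fin.exists_succAbove_eq hjl
    suffices h : (Measure.pi fun _ : Fin (N + 1) => unifOn Γ) ({x | x (l.succAbove i) =
        x (l.succAbove j)}ᶜ ∩ {x | orient (x (l.succAbove i)) (x (l.succAbove j)) (x l) = 0}) = 0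
      from mem_of_superset (compl_mem_ae_iff.2 h) fun x hx _ _ hij h0 => hx ⟨hij, h0⟩
    refine pi_eq_zero_of_slice _ (.inter (.compl
      (measurableSet_eq_fun (measurable_pi_apply _) (measurable_pi_apply _)))
      (measurable_orient (measurable_pi_apply _) (measurable_pi_apply _) (measurable_pi_apply _)
        (measurableSet_singleton 0))) l fun y => ?_
    have key : {p | l.insertNth (α := fun _ => Pt) p y ∈ {x : Fin (N + 1) → Pt | x (l.succAbove i) =
        x (l.succAbove j)}ᶜ ∩ {x | orient (x (l.succAbove i)) (x (l.succAbove j)) (x l) = 0}} =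
        {p | y i ≠ y j ∧ orient (y i) (y j) p = 0} := by
      ext p
      simp
    rw [key]
    by_cases hy : y i = y j
    · simp [hy]
    · exact unifOn_eq_zero (measure_mono_null (fun p hp => hp.2) (volume_line_eq_zero hy))
  filter_upwards [ae_all_iff.2 fun i => ae_all_iff.2 fun l => h1 i l,
    ae_all_iff.2 fun i => ae_all_iff.2 fun j => ae_all_iff.2 fun l => h2 i j l] with x hx1 hx2
  refine ⟨fun i j hij => ?_, fun i j l hij hil hjl => hx2 i j l hil hjl (hx1 i j hij)⟩
  by_contra hne
  exact hx1 i j hne hij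

theorem ae_mem {N : ℕ} (hc : IsCompact Γ) (hΓi : (interior Γ).Nonempty) :
    ∀ᵐ x ∂(Measure.pi fun _ : Fin N => unifOn Γ), ∀ i, x i ∈ Γ := by
  have := isProbabilityMeasure_unifOn hc hΓi
  refine ae_all_iff.2 fun i => ?_
  have h : ∀ᵐ p ∂(unifOn Γ), p ∈ Γ := by
    rw [unifOn]
    exact Measure.ae_smul_measure (ae_restrict_mem hc.measurableSet) _
  exact (Measure.tendsto_eval_ae_ae (μ := fun _ : Fin N => unifOn Γ) (i := i)).eventually h

theorem genPos_of_GP {X : Finset Pt} (h : GP X) : GenPos X := by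
  intro a ha b hb c hc hab hac hbc hcol
  refine h a ha b hb c hc hab hac hbc ?_
  obtain ⟨v, hv⟩ := (collinear_iff_of_mem (p₀ := a) (by simp)).1 hcol
  obtain ⟨r, rfl⟩ := hv b (by simp)
  obtain ⟨s, rfl⟩ := hv c (by simp)
  simp only [orient, vadd_eq_add, Prod.fst_add, Prod.snd_add, Prod.smul_fst, Prod.smul_snd,
    smul_eq_mul]
  ring

/-- Deterministic form of the theorem: absence of sparse chains suffices. -/
theorem unbl_of_not_sparse {d κ κ' : ℕ} {x : Fin (2 * n) → Pt} (hinj : Function.Injective x)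
    (hX : GP (Finset.image x Finset.univ)) (hΓ : ∀ i, x i ∈ Γ) (hl : ∀ e ∈ S, ¬ e.IsDiag)
    (h1 : 2 ^ d * κ ≤ n) (h2 : n ≤ 2 ^ d * κ') (hS : S.card + 1 ≤ n + 2 ^ d) (hk : 12 * k + 12 ≤ κ)
    (hσ : ¬ ∃ σ : Fin 3 ⊕ Fin k → Fin (2 * n), Function.Injective σ ∧ Sparse Γ (2 * κ') x σ) :
    Unbl S (Finset.image x Finset.univ) := by
  refine unbl_of_no_chain (k := k) hX (n := n) (by rw [Finset.card_image_of_injective _ hinj]; simp)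
    hl h1 h2 hS hk ?_
  intro a ha b hb c hc f hab hac ho hch hf Z hZ hpara
  obtain ⟨ia, -, rfl⟩ := Finset.mem_image.1 ha
  obtain ⟨ib, -, rfl⟩ := Finset.mem_image.1 hb
  obtain ⟨ic, -, rfl⟩ := Finset.mem_image.1 hc
  have hfx : ∀ i, ∃ j, x j = f i := fun i => by
    obtain ⟨j, -, hj⟩ := Finset.mem_image.1 (hf i).1
    exact ⟨j, hj⟩
  choose g hg using hfx
  by_contra! hcard
  refine hσ ⟨Sum.elim ![ia, ib, ic] g, ?_, hΓ, hab, hac, ho, ?_, fun T hT => ?_⟩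
  · have hab' : ia ≠ ib := fun h => by simp [h] at hab
    have hac' : ia ≠ ic := fun h => ho (by rw [h, orient_left])
    have hbc' : ib ≠ ic := fun h => ho (by rw [h, orient_right])
    refine Function.Injective.sumElim ?_ (fun i j hij => ?_) ?_
    · intro i j hij
      fin_cases i <;> fin_cases j <;> simp_all
    · have : f i = f j := by rw [← hg, ← hg, hij]
      exact hch.2.1.injective (congrArg Prod.fst this)
    · intro i j hij
      have h3 := (hf j).2
      rw [← hg j, ← hij] at h3
      fin_cases i
      · exact h3.1 rfl
      · exact h3.2.1 rfl
      · exact h3.2.2 rfl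
  · simpa [hg] using hch
  · by_contra! hcon
    have : T.image x ⊆ Z := by
      intro p hp
      obtain ⟨j, hj, rfl⟩ := Finset.mem_image.1 hp
      exact hpara _ (Finset.mem_image_of_mem _ (Finset.mem_univ _)) (hcon j hj)
    have := Finset.card_le_card this
    rw [Finset.card_image_of_injective _ hinj] at this
    omega

end PlaneMatching

namespace PlaneMatching

variable {Γ : Set Pt}

theorem exists_parameters {n : ℕ} {L : ℝ} (hL : 20 ≤ L) (hn : 3 * L ≤ n) :
    ∃ d κ κ' : ℕ, 2 ^ d * κ ≤ n ∧ n ≤ 2 ^ d * κ' ∧ (n : ℝ) / (3 * L) < 2 ^ d ∧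
      12 * ⌊L / 16⌋₊ + 12 ≤ κ ∧ (κ' : ℝ) ≤ 3 * L + 1 := by
  have h3 : (0 : ℝ) < 3 * L := by linarith
  obtain ⟨d, hd1, hd2⟩ := exists_nat_pow_near ((one_le_div h3).2 hn) (one_lt_two (α := ℝ))
  rw [le_div_iff₀ h3] at hd1
  refine ⟨d + 1, ⌊3 * L / 2⌋₊, ⌈3 * L⌉₊, ?_, ?_, hd2, ?_, (Nat.ceil_lt_add_one h3.le).le⟩
  · have h := Nat.floor_le (show 0 ≤ 3 * L / 2 by linarith)
    have : (2 : ℝ) ^ (d + 1) * ⌊3 * L / 2⌋₊ ≤ n := by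
      have := mul_le_mul_of_nonneg_left h (show (0 : ℝ) ≤ 2 ^ (d + 1) by positivity)
      rw [pow_succ] at this ⊢
      linarith
    exact_mod_cast this
  · have h := Nat.le_ceil (3 * L)
    have h2 := mul_le_mul_of_nonneg_left h (show (0 : ℝ) ≤ 2 ^ (d + 1) by positivity)
    rw [div_lt_iff₀ h3] at hd2
    exact_mod_cast hd2.le.trans h2
  · have h := Nat.floor_le (show 0 ≤ L / 16 by linarith)
    have h2 := Nat.lt_floor_add_one (3 * L / 2)
    have : (12 * ⌊L / 16⌋₊ + 12 : ℝ) < ⌊3 * L / 2⌋₊ + 1 := by linarith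
    have : 12 * ⌊L / 16⌋₊ + 12 < ⌊3 * L / 2⌋₊ + 1 := by exact_mod_cast this
    omega

theorem error_le {N k κ' : ℕ} {L : ℝ} (hN : (N : ℝ) = Real.exp L) (hκ' : (κ' : ℝ) ≤ 3 * L + 1)
    (hk : L ≤ 16 * (k + 1)) :
    (2 * 2 ^ (2 * κ') * N ^ 3 * 16 ^ k / k.factorial : ℝ) ≤
      2 * Real.exp 146 * ((16 * Real.exp 144) ^ k / k.factorial) := by
  have h2 : (2 : ℝ) ≤ Real.exp 1 := by
    have := Real.add_one_le_exp (1 : ℝ); linarith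
  have h3 : (2 : ℝ) ^ (2 * κ') * N ^ 3 ≤ Real.exp 146 * Real.exp 144 ^ k := by
    calc (2 : ℝ) ^ (2 * κ') * N ^ 3 ≤ Real.exp 1 ^ (2 * κ') * N ^ 3 := by gcongr
      _ = Real.exp (2 * κ' + 3 * L) := by
        rw [hN, ← Real.exp_nat_mul, ← Real.exp_nat_mul, ← Real.exp_add]
        push_cast; ring_nf
      _ ≤ Real.exp (146 + k * 144) := Real.exp_le_exp.2 (by linarith)
      _ = _ := by rw [Real.exp_add, Real.exp_nat_mul]
  calc _ = 2 * ((2 : ℝ) ^ (2 * κ') * N ^ 3) * 16 ^ k / k.factorial := by ring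
    _ ≤ 2 * (Real.exp 146 * Real.exp 144 ^ k) * 16 ^ k / k.factorial := by gcongr
    _ = _ := by rw [mul_pow]; ring

/-- The event that every small edge set can be avoided. -/
def goodSet (n : ℕ) : Set (Fin (2 * n) → Pt) :=
  {x | GenPos (Finset.image x Finset.univ) ∧ ∀ S : Finset (Sym2 Pt),
    (∀ e ∈ S, IsEdgeOf (Finset.image x Finset.univ) e) →
    (S.card : ℝ) ≤ n + n / (3 * Real.log (2 * n)) →
    ∃ M, IsNCMatching (Finset.image x Finset.univ) M ∧ Avoids M S}

theorem measure_goodSet_compl_le (hc : IsCompact Γ) (hconv : Convex ℝ Γ)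
    (hΓi : (interior Γ).Nonempty) {n : ℕ} (hL : 20 ≤ Real.log (2 * n))
    (hn : 3 * Real.log (2 * n) ≤ n) :
    (Measure.pi fun _ : Fin (2 * n) => unifOn Γ) (goodSet n)ᶜ ≤
      ENNReal.ofReal (2 * Real.exp 146 * ((16 * Real.exp 144) ^ ⌊Real.log (2 * n) / 16⌋₊ /
        (⌊Real.log (2 * n) / 16⌋₊).factorial)) := by
  obtain ⟨d, κ, κ', h1, h2, h3, h4, h5⟩ := exists_parameters hL hn
  set L := Real.log (2 * n) with hLdef
  set k := ⌊L / 16⌋₊ with hk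
  have hn0 : (0 : ℝ) < n := by linarith
  have hkL : (k : ℝ) ≤ L / 16 := Nat.floor_le (by linarith)
  have hkL' := Nat.lt_floor_add_one (L / 16)
  have hN : 2 * (3 + k) ≤ 2 * n := by
    have : (3 + k : ℝ) ≤ n := by linarith
    have : 3 + k ≤ n := by exact_mod_cast this
    omega
  have hb := measure_exists_sparse_le (K := 2 * κ') hc hconv hΓi hN
  refine (measure_mono_ae ?_).trans (hb.trans (ENNReal.ofReal_le_ofReal
    (error_le (L := L) ?_ h5 ?_)))
  · filter_upwards [ae_injective_orient_ne (N := 2 * n) hc hΓi, ae_mem (N := 2 * n) hc hΓi]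
      with x ⟨hinj, hor⟩ hΓ hx
    by_contra hσ
    have hGP : GP (Finset.image x Finset.univ) := by
      intro a ha b hb c hc hab hac hbc
      obtain ⟨i, -, rfl⟩ := Finset.mem_image.1 ha
      obtain ⟨j, -, rfl⟩ := Finset.mem_image.1 hb
      obtain ⟨l, -, rfl⟩ := Finset.mem_image.1 hc
      exact hor i j l (fun h => hab (h ▸ rfl)) (fun h => hac (h ▸ rfl)) fun h => hbc (h ▸ rfl)
    refine hx ⟨genPos_of_GP hGP, fun S hS hcard => ?_⟩
    have hS' : S.card + 1 ≤ n + 2 ^ d := by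
      have : (S.card : ℝ) < n + 2 ^ d := by linarith
      have : S.card < n + 2 ^ d := by exact_mod_cast this
      omega
    exact unbl_of_not_sparse hinj hGP hΓ (fun e he => (hS e he).1) h1 h2 hS' h4 hσ
  · push_cast
    exact (Real.exp_log (by linarith)).symm
  · linarith

theorem tendsto_measure_goodSet (hc : IsCompact Γ) (hconv : Convex ℝ Γ)
    (hΓi : (interior Γ).Nonempty) :
    Tendsto (fun n : ℕ => (Measure.pi fun _ : Fin (2 * n) => unifOn Γ) (goodSet n)) atTop
      (nhds 1) := by
  have := isProbabilityMeasure_unifOn hc hΓi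
  have h2n : Tendsto (fun n : ℕ => (2 * n : ℝ)) atTop atTop :=
    tendsto_natCast_atTop_atTop.const_mul_atTop two_pos
  have hlog : Tendsto (fun n : ℕ => Real.log (2 * n)) atTop atTop :=
    Real.tendsto_log_atTop.comp h2n
  have hk : Tendsto (fun n : ℕ => ⌊Real.log (2 * n) / 16⌋₊) atTop atTop :=
    tendsto_nat_floor_atTop.comp (hlog.atTop_div_const (by norm_num))
  have hB := ((FloorSemiring.tendsto_pow_div_factorial_atTop (16 * Real.exp 144)).comp hk).const_mul
    (2 * Real.exp 146)
  rw [mul_zero] at hB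
  have hB' := ENNReal.tendsto_ofReal hB
  rw [ENNReal.ofReal_zero] at hB'
  have hlow := ENNReal.Tendsto.sub (tendsto_const_nhds (x := (1 : ENNReal))) hB'
    (Or.inl ENNReal.one_ne_top)
  rw [tsub_zero] at hlow
  have hsmall : ∀ᶠ n : ℕ in atTop, 3 * Real.log (2 * n) ≤ n := by
    have := (Real.isLittleO_log_id_atTop.comp_tendsto h2n).bound (show (0 : ℝ) < 1 / 6 by norm_num)
    filter_upwards [this] with n hn
    simp only [Function.comp_apply, id, Real.norm_eq_abs] at hn
    rw [abs_of_nonneg (show (0 : ℝ) ≤ 2 * n by positivity)] at hn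
    linarith [le_abs_self (Real.log (2 * n))]
  refine tendsto_of_tendsto_of_tendsto_of_le_of_le' hlow tendsto_const_nhds ?_
    (Eventually.of_forall fun n => prob_le_one)
  filter_upwards [hsmall, hlog.eventually_ge_atTop 20] with n hn hL
  have h := measure_univ_le_add_compl (μ := Measure.pi fun _ : Fin (2 * n) => unifOn Γ) (goodSet n)
  rw [measure_univ] at h
  refine tsub_le_iff_right.2 (h.trans (add_le_add le_rfl ?_))
  exact measure_goodSet_compl_le hc hconv hΓi hL hn

end PlaneMatching

/-- Theorem `lowerbound`: for `2n` i.i.d. uniform points in a compact convex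
set with nonempty interior, with probability tending to `1` the points are in general position
and every set of at most `n + n/(3 log (2n))` edges can be avoided by a non-crossing perfect
matching. -/
theorem random_lower_bound (Γ : Set Pt) (hΓc : IsCompact Γ) (hΓconv : Convex ℝ Γ)
    (hΓint : (interior Γ).Nonempty) :
    Tendsto (fun n : ℕ =>
      Measure.pi (fun _ : Fin (2 * n) => unifOn Γ)
        {x : Fin (2 * n) → Pt |
          GenPos (Finset.image x Finset.univ) ∧
          ∀ S : Finset (Sym2 Pt),
            (∀ e ∈ S, IsEdgeOf (Finset.image x Finset.univ) e) →
            (S.card : ℝ) ≤ n + n / (3 * Real.log (2 * n)) →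
            ∃ M : Finset (Sym2 Pt),
              IsNCMatching (Finset.image x Finset.univ) M ∧ Avoids M S})
      atTop (nhds 1) :=
  PlaneMatching.tendsto_measure_goodSet hΓc hΓconv hΓint
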